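/- Let f be a C^3 multicritical circle map with irrational rotation number ρ(f) and unique invariant Borel probability measure μ. If ρ(f) ∉ D_τ for some τ > 0, then dim_H(μ) ≤ 1/(τ + 1). -/

import Mathlib

open MeasureTheory Set Filter
open scoped ENNReal NNReal

noncomputable section

/-- The circle `S¹ = ℝ/ℤ`. -/
abbrev Circle1 := AddCircle (1 : ℝ)

/-- Projection `ℝ → S¹`. -/
def projC (x : ℝ) : Circle1 := (x : Circle1)

/-- An orientation-preserving circle homeomorphism, given together with a
(strictly monotone, continuous) lift `F : ℝ → ℝ` satisfying `F (x+1) = F x + 1`. -/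
structure CircleHomeo where
  toHomeo : Circle1 ≃ₜ Circle1
  lift : ℝ → ℝ
  lift_strictMono : StrictMono lift
  lift_continuous : Continuous lift
  lift_add_one : ∀ x : ℝ, lift (x + 1) = lift x + 1
  lift_proj : ∀ x : ℝ, toHomeo (projC x) = projC (lift x)

/-- The underlying map `S¹ → S¹`. -/
def CircleHomeo.toFun (H : CircleHomeo) : Circle1 → Circle1 := H.toHomeo

/-- `α ∈ [0,1)` is the rotation number of `H`: `α = lim Fⁿ(x)/n (mod 1)`. -/
def HasRotationNumber (H : CircleHomeo) (α : ℝ) : Prop :=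
  α ∈ Set.Ico (0 : ℝ) 1 ∧ ∃ β : ℝ, Int.fract β = α ∧
    ∀ x : ℝ, Filter.Tendsto (fun n : ℕ => H.lift^[n] x / n) Filter.atTop (nhds β)

/-- `μ` is an invariant Borel probability measure for `H`. -/
def IsInvProbMeasure (H : CircleHomeo) (μ : Measure Circle1) : Prop :=
  IsProbabilityMeasure μ ∧ μ.map H.toFun = μ

/-- Hausdorff dimension of a measure: `inf {dim_H X : μ X = 1}`. -/
def dimHMeasure (μ : Measure Circle1) : ℝ≥0∞ :=
  ⨅ (X : Set Circle1) (_ : MeasurableSet X) (_ : μ X = 1), dimH X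

/-- The set `D(γ,τ)` of Diophantine numbers of type `(γ,τ)`. -/
def DiophClass (γ τ : ℝ) : Set ℝ :=
  {α : ℝ | ∀ p q : ℤ, q ≠ 0 → γ / |(q : ℝ)| ^ (τ + 2) ≤ |α - (p : ℝ) / (q : ℝ)|}

/-- The set `D_τ = ⋃_{γ > 0} D(γ,τ)`. -/
def DiophTau (τ : ℝ) : Set ℝ := {α : ℝ | ∃ γ > 0, α ∈ DiophClass γ τ}

/-- Iterates of the Gauss map, starting from `α`. -/
def gaussIter (α : ℝ) : ℕ → ℝ
  | 0 => α
  | n + 1 => Int.fract (1 / gaussIter α n)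

/-- The `n`-th partial quotient `a_n` (`n ≥ 1`) of the continued fraction of `α`. -/
def cfA (α : ℝ) (n : ℕ) : ℕ := ⌊1 / gaussIter α (n - 1)⌋₊

/-- Denominators of the convergents: `q_0 = 1`, `q_1 = a_1`, `q_n = a_n q_{n-1} + q_{n-2}`. -/
def cfQ (α : ℝ) : ℕ → ℕ
  | 0 => 1
  | 1 => cfA α 1
  | n + 2 => cfA α (n + 2) * cfQ α (n + 1) + cfQ α n

/-- Positive displacement from `a` to `z` on the circle, a number in `[0,1)`. -/
def circDisp (a z : Circle1) : ℝ := (AddCircle.equivIco 1 0 (z - a)).1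

/-- The circle arc `[a, b)`. -/
def arcIco (a b : Circle1) : Set Circle1 := {z : Circle1 | circDisp a z < circDisp a b}

namespace DynPart

/-- `x_i = f^i(x_0)`. -/
def pt (H : CircleHomeo) (x0 : Circle1) (i : ℕ) : Circle1 := H.toFun^[i] x0

/-- The interval `I_n`: `[x_0, x_{q_n})` for even `n`, `[x_{q_n}, x_0)` for odd `n`. -/
def In (H : CircleHomeo) (α : ℝ) (x0 : Circle1) (n : ℕ) : Set Circle1 :=
  if Even n then arcIco x0 (pt H x0 (cfQ α n)) else arcIco (pt H x0 (cfQ α n)) x0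

/-- `I_n^i = f^i(I_n)`. -/
def Ini (H : CircleHomeo) (α : ℝ) (x0 : Circle1) (n i : ℕ) : Set Circle1 :=
  H.toFun^[i] '' In H α x0 n

/-- The dynamical partition `P_n(x_0)`. -/
def part (H : CircleHomeo) (α : ℝ) (x0 : Circle1) (n : ℕ) : Set (Set Circle1) :=
  {S | ∃ i < cfQ α n, S = Ini H α x0 (n - 1) i} ∪
  {S | ∃ i < cfQ α (n - 1), S = Ini H α x0 n i}

/-- `Δ^{(n)}_{i,j} = I_n^{i + q_{n-1} + j q_n}`. -/
def Δ (H : CircleHomeo) (α : ℝ) (x0 : Circle1) (n i j : ℕ) : Set Circle1 :=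
  Ini H α x0 n (i + cfQ α (n - 1) + j * cfQ α n)

end DynPart

/-- `φ` is a `C³` diffeomorphism from the open set `U` onto the open set `V`. -/
def IsC3DiffeoOn (φ : ℝ → ℝ) (U V : Set ℝ) : Prop :=
  IsOpen U ∧ IsOpen V ∧ ContDiffOn ℝ 3 φ U ∧ Set.BijOn φ U V ∧ ∀ x ∈ U, deriv φ x ≠ 0

/-- `c` is a critical point of power-law type with exponent `p`: in suitable `C³`
coordinates around `c` and `H c`, the map takes the form `x ↦ x |x|^{p-1}`. -/
def IsPowerLawCritPt (H : CircleHomeo) (c p : ℝ) : Prop :=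
  ∃ (U V U' V' : Set ℝ) (φ ψ : ℝ → ℝ),
    c ∈ U ∧ H.lift c ∈ U' ∧ (0 : ℝ) ∈ V ∧ (0 : ℝ) ∈ V' ∧
    IsC3DiffeoOn φ U V ∧ IsC3DiffeoOn ψ U' V' ∧
    φ c = 0 ∧ ψ (H.lift c) = 0 ∧ Set.MapsTo H.lift U U' ∧
    ∀ x ∈ U, ψ (H.lift x) = φ x * |φ x| ^ (p - 1)

/-- A `C³` multicritical circle map: an orientation-preserving `C³` circle
homeomorphism whose critical points are exactly `c_0, …, c_{N-1}` (represented in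
`[0,1)`), each of power-law type with criticality `p_i > 1`. -/
structure MulticriticalCircleMap extends CircleHomeo where
  smooth : ContDiff ℝ 3 lift
  N : ℕ
  N_pos : 0 < N
  crit : Fin N → ℝ
  crit_mem : ∀ i, crit i ∈ Set.Ico (0 : ℝ) 1
  crit_inj : Function.Injective crit
  critExp : Fin N → ℝ
  critExp_gt_one : ∀ i, 1 < critExp i
  crit_powerLaw : ∀ i, IsPowerLawCritPt toCircleHomeo (crit i) (critExp i)
  crit_complete : ∀ x : ℝ, deriv lift x = 0 → ∃ (i : Fin N) (k : ℤ), x = crit i + (k : ℝ)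

/-- `z ∈ S¹` is a critical point of `f^m`. -/
def IsCritPtOfIter (f : MulticriticalCircleMap) (m : ℕ) (z : Circle1) : Prop :=
  ∃ x : ℝ, projC x = z ∧ deriv (f.lift^[m]) x = 0

/-- Indices `0 < j < a_{n+1} - 1` such that the closure of `Δ_j^{(n)}` contains a
critical point of `T_n = f^{q_n}`. -/
def critTimesSet (f : MulticriticalCircleMap) (α : ℝ) (x0 : Circle1) (n : ℕ) : Finset ℕ :=
  @Finset.filter ℕ
    (fun j => ∃ z ∈ closure (DynPart.Δ f.toCircleHomeo α x0 n 0 j),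
      IsCritPtOfIter f (cfQ α n) z)
    (Classical.decPred _)
    (Finset.Ioo 0 (cfA α (n + 1) - 1))

/-- The number `r_n` of bridges (`r_n = #{interior critical times} + 1`). -/
def rn (f : MulticriticalCircleMap) (α : ℝ) (x0 : Circle1) (n : ℕ) : ℕ :=
  (critTimesSet f α x0 n).card + 1

/-- The critical times `0 = k_0^{(n)} < k_1^{(n)} < … < k_{r_n}^{(n)} = a_{n+1} - 1`. -/
def kTime (f : MulticriticalCircleMap) (α : ℝ) (x0 : Circle1) (n : ℕ) (s : ℕ) : ℕ :=
  (((0 : ℕ) :: (critTimesSet f α x0 n).sort (· ≤ ·)) ++ [cfA α (n + 1) - 1]).getD s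
    (cfA α (n + 1) - 1)

/-- The `s`-th bridge `G_s^{(n)} = ⋃_{k_s < j < k_{s+1}} Δ_j^{(n)}`. -/
def bridge (f : MulticriticalCircleMap) (α : ℝ) (x0 : Circle1) (n s : ℕ) : Set Circle1 :=
  ⋃ j ∈ Set.Ioo (kTime f α x0 n s) (kTime f α x0 n (s + 1)),
    DynPart.Δ f.toCircleHomeo α x0 n 0 j

/-- The trimmed bridge `G_{s,γ}^{(n)}`. -/
def bridgeGamma (f : MulticriticalCircleMap) (α : ℝ) (x0 : Circle1) (n : ℕ) (γ : ℝ)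
    (s : ℕ) : Set Circle1 :=
  ⋃ j ∈ {j : ℕ | (kTime f α x0 n s : ℝ) + (cfA α (n + 1) : ℝ) ^ γ < (j : ℝ) ∧
      (j : ℝ) < (kTime f α x0 n (s + 1) : ℝ) + 1 - (cfA α (n + 1) : ℝ) ^ γ},
    DynPart.Δ f.toCircleHomeo α x0 n 0 j

/-- `A^n_{i,γ} = ⋃_{s < r_n} f^i(G_{s,γ}^{(n)})`. -/
def Aset (f : MulticriticalCircleMap) (α : ℝ) (x0 : Circle1) (n i : ℕ) (γ : ℝ) :
    Set Circle1 :=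
  ⋃ s ∈ Set.Iio (rn f α x0 n), f.toCircleHomeo.toFun^[i] '' bridgeGamma f α x0 n γ s

/-- `A^n_γ = ⋃_{i < q_n} A^n_{i,γ}`. -/
def AsetAll (f : MulticriticalCircleMap) (α : ℝ) (x0 : Circle1) (n : ℕ) (γ : ℝ) :
    Set Circle1 :=
  ⋃ i ∈ Set.Iio (cfQ α n), Aset f α x0 n i γ

/-- The Schwarzian derivative `Sf = f'''/f' - (3/2)(f''/f')²`. -/
def schwarzianAt (f : ℝ → ℝ) (x : ℝ) : ℝ :=
  iteratedDeriv 3 f x / deriv f x - 3 / 2 * (iteratedDeriv 2 f x / deriv f x) ^ 2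

end

/-- Pair distortion bound: the cross-ratio kernel of `g` at the pair `x, y` is at most `k`
times that of the identity. -/
def PairBound (g : ℝ → ℝ) (k x y : ℝ) : Prop :=
  deriv g x * deriv g y * (y - x) ^ 2 ≤ k * (g y - g x) ^ 2

lemma PairBound.symm {g : ℝ → ℝ} {k x y : ℝ} (h : PairBound g k x y) : PairBound g k y x := by
  unfold PairBound at *; nlinarith

lemma PairBound.mono {g : ℝ → ℝ} {k k' x y : ℝ} (h : PairBound g k x y) (hk : k ≤ k') :
    PairBound g k' x y :=
  le_trans h (mul_le_mul_of_nonneg_right hk (sq_nonneg _))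

lemma PairBound.comp {f g : ℝ → ℝ} {k l x y : ℝ} (hg : Differentiable ℝ g)
    (hf : Differentiable ℝ f) (hfm : Monotone f) (hgm : StrictMono g) (hxy : x ≠ y)
    (h1 : PairBound g l x y) (h2 : PairBound f k (g x) (g y)) :
    PairBound (f ∘ g) (l * k) x y := by
  unfold PairBound at *
  have dx : deriv (f ∘ g) x = deriv f (g x) * deriv g x := deriv_comp x (hf _) (hg _)
  have dy : deriv (f ∘ g) y = deriv f (g y) * deriv g y := deriv_comp y (hf _) (hg _)
  rw [dx, dy]
  have hfx := hfm.deriv_nonneg (x := g x)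
  have hfy := hfm.deriv_nonneg (x := g y)
  have hd : 0 < (g y - g x) ^ 2 := by
    have : g y ≠ g x := fun h => hxy (hgm.injective h).symm
    have := sub_ne_zero.2 this
    positivity
  simp only [Function.comp]
  have h3 := mul_le_mul_of_nonneg_left h1 (mul_nonneg hfx hfy)
  by_cases hl : 0 ≤ l
  · have h4 := mul_le_mul_of_nonneg_left h2 hl
    nlinarith
  · have hgx := hgm.monotone.deriv_nonneg (x := x)
    have hgy := hgm.monotone.deriv_nonneg (x := y)
    have : 0 ≤ deriv g x * deriv g y * (y - x) ^ 2 := by positivity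
    nlinarith

/-- Logarithm of the cross-ratio of the two intervals `[a,b]` and `[c,d]`. -/
noncomputable def lam (a b c d : ℝ) : ℝ :=
  Real.log (c - a) + Real.log (d - b) - Real.log (c - b) - Real.log (d - a)

lemma lam_le_of_pair {g : ℝ → ℝ} (hg : Differentiable ℝ g) (hm : StrictMono g) {K a b c d : ℝ}
    (hab : a ≤ b) (hbc : b < c) (hcd : c ≤ d)
    (hP : ∀ x ∈ Icc a b, ∀ y ∈ Icc c d, PairBound g K x y) :
    lam (g a) (g b) (g c) (g d) ≤ K * lam a b c d := by
  have step1 : ∀ y ∈ Icc c d, K / (y - a) - deriv g y / (g y - g a) ≤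
      K / (y - b) - deriv g y / (g y - g b) := by
    intro y hy
    have hder : ∀ x ∈ Icc a b, HasDerivAt (fun x => K / (y - x) - deriv g y / (g y - g x))
        (K / (y - x) ^ 2 - deriv g y * deriv g x / (g y - g x) ^ 2) x := by
      intro x hx
      have hxy : x < y := by linarith [hx.2, hy.1]
      have h1 : y - x ≠ 0 := by linarith
      have h2 : g y - g x ≠ 0 := by linarith [hm hxy]
      have e1 := ((hasDerivAt_id x).const_sub y).inv h1
      have e2 := ((hg x).hasDerivAt.const_sub (g y)).inv h2
      refine ((e1.const_mul K).sub (e2.const_mul (deriv g y))).congr_deriv ?_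
      simp only [id]
      field_simp
    have hmon : MonotoneOn (fun x => K / (y - x) - deriv g y / (g y - g x)) (Icc a b) := by
      refine monotoneOn_of_hasDerivWithinAt_nonneg (convex_Icc a b)
        (fun x hx => (hder x hx).continuousAt.continuousWithinAt)
        (fun x hx => (hder x (interior_subset hx)).hasDerivWithinAt) ?_
      intro x hx
      have hx := interior_subset hx
      have hxy : x < y := by linarith [hx.2, hy.1]
      have h1 : 0 < y - x := by linarith
      have h2 : 0 < g y - g x := by linarith [hm hxy]
      have := hP x hx y hy
      unfold PairBound at this
      rw [sub_nonneg, div_le_div_iff₀ (by positivity) (by positivity)]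
      linarith
    exact hmon (left_mem_Icc.2 hab) (right_mem_Icc.2 hab) hab
  have hder : ∀ y ∈ Icc c d, HasDerivAt (fun y => K * (Real.log (y - b) - Real.log (y - a)) -
      (Real.log (g y - g b) - Real.log (g y - g a)))
      (K * ((y - b)⁻¹ - (y - a)⁻¹) - (deriv g y / (g y - g b) - deriv g y / (g y - g a))) y := by
    intro y hy
    have hb : b < y := by linarith [hy.1]
    have ha : a < y := by linarith
    have e1 := ((hasDerivAt_id y).sub_const b).log (by simp; linarith)
    have e2 := ((hasDerivAt_id y).sub_const a).log (by simp; linarith)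
    have e3 := ((hg y).hasDerivAt.sub_const (g b)).log (by linarith [hm hb])
    have e4 := ((hg y).hasDerivAt.sub_const (g a)).log (by linarith [hm ha])
    refine (((e1.sub e2).const_mul K).sub (e3.sub e4)).congr_deriv ?_
    simp only [id, one_div]
  have hmon : MonotoneOn (fun y => K * (Real.log (y - b) - Real.log (y - a)) -
      (Real.log (g y - g b) - Real.log (g y - g a))) (Icc c d) := by
    refine monotoneOn_of_hasDerivWithinAt_nonneg (convex_Icc c d)
      (fun x hx => (hder x hx).continuousAt.continuousWithinAt)
      (fun x hx => (hder x (interior_subset hx)).hasDerivWithinAt) ?_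
    intro y hy
    have := step1 y (interior_subset hy)
    rw [mul_sub, ← div_eq_mul_inv, ← div_eq_mul_inv]
    linarith
  have := hmon (left_mem_Icc.2 hcd) (right_mem_Icc.2 hcd) hcd
  simp only at this
  unfold lam
  nlinarith

lemma lam_eq {a b c d : ℝ} (hab : a ≤ b) (hbc : b < c) (hcd : c ≤ d) :
    lam a b c d = Real.log (1 + (b - a) * (d - c) / ((c - b) * (d - a))) := by
  have h1 : 0 < c - a := by linarith
  have h2 : 0 < d - b := by linarith
  have h3 : 0 < c - b := by linarith
  have h4 : 0 < d - a := by linarith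
  unfold lam
  rw [← Real.log_mul h1.ne' h2.ne', ← Real.log_div (by positivity) h3.ne',
    ← Real.log_div (by positivity) h4.ne']
  congr 1
  field_simp
  ring

lemma lam_nonneg {a b c d : ℝ} (hab : a ≤ b) (hbc : b < c) (hcd : c ≤ d) : 0 ≤ lam a b c d := by
  rw [lam_eq hab hbc hcd]
  apply Real.log_nonneg
  have h1 : 0 ≤ b - a := by linarith
  have h2 : 0 ≤ d - c := by linarith
  have h3 : 0 < c - b := by linarith
  have h4 : 0 < d - a := by linarith
  have : 0 ≤ (b - a) * (d - c) / ((c - b) * (d - a)) := by positivity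
  linarith

lemma lam_add_left (a m b c d : ℝ) : lam a b c d = lam a m c d + lam m b c d := by
  unfold lam; ring

lemma lam_add_right (a b c m d : ℝ) : lam a b c d = lam a b c m + lam a b m d := by
  unfold lam; ring

lemma lam_mono {a b c d a' b' c' d' : ℝ} (h1 : a ≤ a') (h2 : a' ≤ b') (h3 : b' ≤ b)
    (h4 : b < c) (h5 : c ≤ c') (h6 : c' ≤ d') (h7 : d' ≤ d) :
    lam a' b' c' d' ≤ lam a b c d := by
  rw [lam_add_left a a' b, lam_add_left a' b' b, lam_add_right a' b' c c' d, lam_add_right a' b' c' d' d]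
  have k1 := lam_nonneg h1 (by linarith : a' < c) (by linarith : c ≤ d)
  have k2 := lam_nonneg h3 h4 (by linarith : c ≤ d)
  have k3 := lam_nonneg h2 (by linarith : b' < c) h5
  have k4 := lam_nonneg h2 (by linarith : b' < d') h7
  linarith

lemma lam_le_div {a b c d : ℝ} (hab : a ≤ b) (hbc : b < c) (hcd : c ≤ d) :
    lam a b c d ≤ (b - a) * (d - c) / ((c - b) * (d - a)) := by
  rw [lam_eq hab hbc hcd]
  have h1 : 0 ≤ b - a := by linarith
  have h2 : 0 ≤ d - c := by linarith
  have h3 : 0 < c - b := by linarith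
  have h4 : 0 < d - a := by linarith
  have : 0 ≤ (b - a) * (d - c) / ((c - b) * (d - a)) := by positivity
  have := Real.log_le_sub_one_of_pos (x := 1 + (b - a) * (d - c) / ((c - b) * (d - a)))
    (by linarith)
  linarith

/-- Data of a circle map lift `F` with critical set `crit`, satisfying the distortion estimates
of a multicritical circle map, together with a semiconjugacy `h` to the translation by `β`. -/
structure CData where
  F : ℝ → ℝ
  diff : Differentiable ℝ F
  mono : StrictMono F
  add_one : ∀ x, F (x + 1) = F x + 1
  N : ℕ
  N_pos : 0 < N
  crit : Fin N → ℝ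
  d1 : ∃ K, ∀ x y, x < y → y ≤ x + 1 → PairBound F K x y
  d2 : ∃ C δ, 0 < δ ∧ ∀ x y, x < y → y - x ≤ δ → (∀ i (k : ℤ), crit i + k ∉ Ioo x y) →
    PairBound F (Real.exp (C * (y - x) ^ 2)) x y
  d3 : ∃ κ δ, 0 < κ ∧ 0 < δ ∧ ∀ i x y, |x - crit i| ≤ δ → |y - crit i| < |x - crit i| →
    0 ≤ (x - crit i) * (y - crit i) →
    PairBound F (Real.exp (-(κ * ((y - x) / (x - crit i)) ^ 2))) x y
  d4 : ∀ ε > 0, ∃ Q δ, 1 < Q ∧ 0 < δ ∧ ∀ i x y, |x - crit i| ≤ δ →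
    Q * |y - crit i| ≤ |x - crit i| → 0 ≤ (x - crit i) * (y - crit i) → PairBound F ε x y
  d5 : ∃ C δ, 0 < δ ∧ ∀ i x y, |x - crit i| ≤ δ → |y - crit i| < |x - crit i| →
    0 ≤ (x - crit i) * (y - crit i) →
    |F y - F x| * |x - crit i| ≤ C * |y - x| * |F (crit i) - F x|
  h : ℝ → ℝ
  β : ℝ
  β_irr : Irrational β
  h_mono : Monotone h
  h_cont : Continuous h
  h_add_one : ∀ x, h (x + 1) = h x + 1
  h_F : ∀ x, h (F x) = h x + β

namespace CData

variable (D : CData)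

lemma iter_mono (n : ℕ) : StrictMono D.F^[n] := D.mono.iterate n

lemma iter_diff (n : ℕ) : Differentiable ℝ D.F^[n] := D.diff.iterate n

lemma add_int (x : ℝ) (k : ℤ) : D.F (x + k) = D.F x + k := by
  have hn : ∀ (n : ℕ) x, D.F (x + n) = D.F x + n := by
    intro n
    induction n with
    | zero => simp
    | succ n ih => intro x; push_cast; rw [← add_assoc, D.add_one, ih]; ring
  obtain ⟨n, rfl | rfl⟩ := k.eq_nat_or_neg
  · exact_mod_cast hn n x
  · have := hn n (x + (-(n : ℤ) : ℤ))
    push_cast at this ⊢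
    rw [show x + -(n : ℝ) + n = x by ring] at this
    linarith

lemma iter_add_int (n : ℕ) (x : ℝ) (k : ℤ) : D.F^[n] (x + k) = D.F^[n] x + k := by
  induction n generalizing x with
  | zero => simp
  | succ n ih => rw [Function.iterate_succ_apply, D.add_int, ih, Function.iterate_succ_apply]

lemma h_add_int (x : ℝ) (k : ℤ) : D.h (x + k) = D.h x + k := by
  have hn : ∀ (n : ℕ) x, D.h (x + n) = D.h x + n := by
    intro n
    induction n with
    | zero => simp
    | succ n ih => intro x; push_cast; rw [← add_assoc, D.h_add_one, ih]; ring
  obtain ⟨n, rfl | rfl⟩ := k.eq_nat_or_neg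
  · exact_mod_cast hn n x
  · have := hn n (x + (-(n : ℤ) : ℤ))
    push_cast at this ⊢
    rw [show x + -(n : ℝ) + n = x by ring] at this
    linarith

lemma h_iter (n : ℕ) (x : ℝ) : D.h (D.F^[n] x) = D.h x + n * D.β := by
  induction n with
  | zero => simp
  | succ n ih => rw [Function.iterate_succ_apply', D.h_F, ih]; push_cast; ring

lemma pair_iter {n : ℕ} {x y : ℝ} (hxy : x ≠ y) (e : ℕ → ℝ)
    (hP : ∀ i < n, PairBound D.F (Real.exp (e i)) (D.F^[i] x) (D.F^[i] y)) :
    PairBound D.F^[n] (Real.exp (∑ i ∈ Finset.range n, e i)) x y := by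
  induction n with
  | zero => simp [PairBound]
  | succ n ih =>
    rw [Function.iterate_succ', Finset.sum_range_succ, Real.exp_add]
    exact PairBound.comp (D.iter_diff n) D.diff D.mono.monotone (D.iter_mono n)
      hxy (ih fun i hi => hP i (by omega)) (hP n (by omega))

open Classical in
/-- Indicator that the translates of the `i`-th critical point meet `[x, y)`. -/
noncomputable def hit (i : Fin D.N) (x y : ℝ) : ℝ :=
  if ∃ k : ℤ, D.crit i + k ∈ Ico x y then 1 else 0

lemma hit_nonneg (i : Fin D.N) (x y : ℝ) : 0 ≤ D.hit i x y := by
  unfold hit; split_ifs <;> norm_num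

lemma hit_le_one (i : Fin D.N) (x y : ℝ) : D.hit i x y ≤ 1 := by
  unfold hit; split_ifs <;> norm_num

lemma hit_eq_one {i : Fin D.N} {x y : ℝ} {k : ℤ} (h : D.crit i + k ∈ Ico x y) :
    D.hit i x y = 1 := if_pos ⟨k, h⟩

lemma hit_cases (i : Fin D.N) (x y : ℝ) :
    (∃ k : ℤ, D.crit i + k ∈ Ico x y) ∨ D.hit i x y = 0 := by
  by_cases h : ∃ k : ℤ, D.crit i + k ∈ Ico x y
  · exact Or.inl h
  · exact Or.inr (if_neg h)

/-- Length plus the number of critical orbits (mod 1) meeting `[x, y)`. -/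
noncomputable def nu (x y : ℝ) : ℝ := (y - x) + ∑ i, D.hit i x y

lemma sub_le_nu (x y : ℝ) : y - x ≤ D.nu x y := by
  have : 0 ≤ ∑ i, D.hit i x y := Finset.sum_nonneg fun i _ => D.hit_nonneg i x y
  unfold nu; linarith

lemma nu_nonneg {x y : ℝ} (h : x ≤ y) : 0 ≤ D.nu x y := by
  linarith [D.sub_le_nu x y]

lemma nu_mono {x y x' y' : ℝ} (h1 : x ≤ x') (h2 : y' ≤ y) : D.nu x' y' ≤ D.nu x y := by
  have : ∑ i, D.hit i x' y' ≤ ∑ i, D.hit i x y := by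
    apply Finset.sum_le_sum; intro i _
    rcases D.hit_cases i x' y' with ⟨k, hk⟩ | h
    · rw [D.hit_eq_one hk, D.hit_eq_one (Ico_subset_Ico h1 h2 hk)]
    · rw [h]; exact D.hit_nonneg i x y
  unfold nu; linarith

lemma nu_subadd (x y z : ℝ) : D.nu x z ≤ D.nu x y + D.nu y z := by
  have : ∑ i, D.hit i x z ≤ ∑ i, D.hit i x y + ∑ i, D.hit i y z := by
    rw [← Finset.sum_add_distrib]
    apply Finset.sum_le_sum; intro i _
    have n1 := D.hit_nonneg i x y
    have n2 := D.hit_nonneg i y z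
    rcases D.hit_cases i x z with ⟨k, hk⟩ | h
    · rw [D.hit_eq_one hk]
      rcases lt_or_ge (D.crit i + k) y with h2 | h2
      · rw [D.hit_eq_one (⟨hk.1, h2⟩ : D.crit i + k ∈ Ico x y)]; linarith
      · rw [D.hit_eq_one (⟨h2, hk.2⟩ : D.crit i + k ∈ Ico y z)]; linarith
    · linarith
  unfold nu; linarith

lemma exists_pair_nu : ∃ C, 0 ≤ C ∧ ∀ x y, x < y → y ≤ x + 1 →
    PairBound D.F (Real.exp (C * D.nu x y)) x y := by
  obtain ⟨K, hK⟩ := D.d1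
  obtain ⟨C, δ, hδ, h2⟩ := D.d2
  set K' := max K 1
  have hK' : 0 ≤ Real.log K' := Real.log_nonneg (le_max_right _ _)
  refine ⟨max (max C 0 * 1) (Real.log K' * (1 + 1 / δ)), le_max_of_le_left (by positivity), ?_⟩
  intro x y hxy hy
  set B := max (max C 0 * 1) (Real.log K' * (1 + 1 / δ)) with hB
  have hB0 : 0 ≤ B := le_max_of_le_left (by positivity)
  have hBl : Real.log K' ≤ B := by
    refine le_trans ?_ (le_max_right _ _)
    have : 0 < 1 / δ := by positivity
    nlinarith
  have hBd : Real.log K' ≤ B * δ := by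
    have : Real.log K' * (1 + 1 / δ) * δ ≤ B * δ :=
      mul_le_mul_of_nonneg_right (le_max_right _ _) hδ.le
    have e : Real.log K' * (1 + 1 / δ) * δ = Real.log K' * δ + Real.log K' := by field_simp
    nlinarith
  have key : Real.log K' ≤ B * D.nu x y → PairBound D.F (Real.exp (B * D.nu x y)) x y := by
    intro hh
    refine (hK x y hxy hy).mono ((le_max_left K 1).trans ?_)
    rw [← Real.exp_log (lt_of_lt_of_le one_pos (le_max_right K 1))]
    exact Real.exp_le_exp.2 hh
  have hnn := D.sub_le_nu x y
  by_cases hc : ∀ i (k : ℤ), D.crit i + k ∉ Ioo x y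
  · by_cases hs : y - x ≤ δ
    · refine (h2 x y hxy hs hc).mono (Real.exp_le_exp.2 ?_)
      have hCB : C ≤ B := le_trans (by simp) (le_max_left _ _)
      have h1 : C * (y - x) ^ 2 ≤ B * (y - x) ^ 2 := mul_le_mul_of_nonneg_right hCB (sq_nonneg _)
      have h3 : B * (y - x) ^ 2 ≤ B * D.nu x y := by
        apply mul_le_mul_of_nonneg_left _ hB0
        nlinarith
      linarith
    · apply key
      refine hBd.trans (mul_le_mul_of_nonneg_left ?_ hB0)
      linarith
  · push Not at hc
    obtain ⟨i, k, hk⟩ := hc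
    apply key
    have : 1 ≤ D.nu x y := by
      have := Finset.single_le_sum (f := fun i => D.hit i x y)
        (fun i _ => D.hit_nonneg i x y) (Finset.mem_univ i)
      simp only [D.hit_eq_one (⟨hk.1.le, hk.2⟩ : D.crit i + k ∈ Ico x y)] at this
      unfold nu; linarith
    nlinarith

/-- The distortion constant. -/
noncomputable def C : ℝ := D.exists_pair_nu.choose

lemma C_nonneg : 0 ≤ D.C := D.exists_pair_nu.choose_spec.1

lemma pair_nu {x y : ℝ} (h : x < y) (h1 : y ≤ x + 1) :
    PairBound D.F (Real.exp (D.C * D.nu x y)) x y := D.exists_pair_nu.choose_spec.2 x y h h1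

lemma iter_le_add_one {x y : ℝ} (h1 : y ≤ x + 1) (i : ℕ) : D.F^[i] y ≤ D.F^[i] x + 1 := by
  have := (D.iter_mono i).monotone h1
  have e := D.iter_add_int i x 1
  push_cast at e
  linarith

lemma pair_iter_nu {n : ℕ} {a d x y S : ℝ} (hS : ∑ i ∈ Finset.range n,
    D.nu (D.F^[i] a) (D.F^[i] d) ≤ S) (hax : a ≤ x) (hxy : x < y) (hyd : y ≤ d) (hd : d ≤ a + 1) :
    PairBound D.F^[n] (Real.exp (D.C * S)) x y := by
  refine (D.pair_iter hxy.ne (fun i => D.C * D.nu (D.F^[i] x) (D.F^[i] y)) ?_).mono ?_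
  · intro i _
    exact D.pair_nu (D.iter_mono i hxy) (D.iter_le_add_one (by linarith) i)
  · apply Real.exp_le_exp.2
    rw [← Finset.mul_sum]
    apply mul_le_mul_of_nonneg_left _ D.C_nonneg
    refine le_trans (Finset.sum_le_sum fun i _ => ?_) hS
    exact D.nu_mono ((D.iter_mono i).monotone hax) ((D.iter_mono i).monotone hyd)

/-- Cross-ratio distortion along an orbit segment of bounded total size. -/
lemma cross_ratio {n : ℕ} {a b c d S : ℝ} (hS : ∑ i ∈ Finset.range n,
    D.nu (D.F^[i] a) (D.F^[i] d) ≤ S) (hab : a ≤ b) (hbc : b < c) (hcd : c ≤ d) (hd : d ≤ a + 1) :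
    lam (D.F^[n] a) (D.F^[n] b) (D.F^[n] c) (D.F^[n] d) ≤ Real.exp (D.C * S) * lam a b c d :=
  lam_le_of_pair (D.iter_diff n) (D.iter_mono n) hab hbc hcd fun x hx y hy =>
    D.pair_iter_nu hS hx.1 (by linarith [hx.2, hy.1]) hy.2 hd

end CData

lemma sum_len_le_one {n : ℕ} (a b : ℕ → ℝ) (hab : ∀ i < n, a i ≤ b i)
    (hd : ∀ i < n, ∀ j < n, ∀ k l : ℤ, (i, k) ≠ (j, l) →
      Disjoint (Ico (a i + k) (b i + k)) (Ico (a j + l) (b j + l))) :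
    ∑ i ∈ Finset.range n, (b i - a i) ≤ 1 := by
  obtain ⟨A, hA⟩ : ∃ A, ∀ i < n, A ≤ a i := by
    obtain ⟨A, hA⟩ := ((Finset.range n).image a).finite_toSet.bddBelow
    exact ⟨A, fun i hi => hA (by simpa using ⟨i, hi, rfl⟩)⟩
  obtain ⟨B, hB⟩ : ∃ B, ∀ i < n, b i ≤ B := by
    obtain ⟨A, hA⟩ := ((Finset.range n).image b).finite_toSet.bddAbove
    exact ⟨A, fun i hi => hA (by simpa using ⟨i, hi, rfl⟩)⟩
  set s := ∑ i ∈ Finset.range n, (b i - a i) with hs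
  have hs0 : 0 ≤ s := Finset.sum_nonneg fun i hi => by
    have := hab i (Finset.mem_range.1 hi); linarith
  have key : ∀ M : ℕ, 0 < n → (M : ℝ) * s ≤ max (B - A + M) 0 := by
    intro M _
    set I : Finset (ℕ × ℕ) := Finset.range n ×ˢ Finset.range M
    have h1 : volume (⋃ p ∈ I, Ico (a p.1 + ((p.2 : ℤ) : ℝ)) (b p.1 + ((p.2 : ℤ) : ℝ))) =
        ∑ p ∈ I, volume (Ico (a p.1 + ((p.2 : ℤ) : ℝ)) (b p.1 + ((p.2 : ℤ) : ℝ))) := by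
      apply measure_biUnion_finset
      · intro p hp r hr hpr
        simp only [I, Finset.coe_product, Finset.coe_range, mem_prod, mem_Iio] at hp hr
        refine hd p.1 hp.1 r.1 hr.1 p.2 r.2 ?_
        intro h
        apply hpr
        rw [Prod.mk.injEq] at h
        exact Prod.ext h.1 (by exact_mod_cast h.2)
      · intro p _; exact measurableSet_Ico
    have h2 : volume (⋃ p ∈ I, Ico (a p.1 + ((p.2 : ℤ) : ℝ)) (b p.1 + ((p.2 : ℤ) : ℝ))) ≤
        volume (Ico A (B + M)) := by
      apply measure_mono
      intro t ht
      simp only [mem_iUnion] at ht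
      obtain ⟨p, hp, ht⟩ := ht
      simp only [I, Finset.mem_product, Finset.mem_range] at hp
      have e1 := hA _ hp.1
      have e2 := hB _ hp.1
      have e3 : ((p.2 : ℤ) : ℝ) ≤ M := by exact_mod_cast hp.2.le
      have e4 : (0 : ℝ) ≤ ((p.2 : ℤ) : ℝ) := by positivity
      exact ⟨by linarith [ht.1], by linarith [ht.2]⟩
    rw [h1] at h2
    have h3 : ∑ p ∈ I, volume (Ico (a p.1 + ((p.2 : ℤ) : ℝ)) (b p.1 + ((p.2 : ℤ) : ℝ))) =
        ENNReal.ofReal (M * s) := by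
      have e : (M : ℝ) * s = ∑ p ∈ I, (b p.1 - a p.1) := by
        rw [Finset.sum_product, hs]
        simp only [Finset.sum_const, Finset.card_range, nsmul_eq_mul, Finset.mul_sum]
      rw [e, ENNReal.ofReal_sum_of_nonneg]
      · apply Finset.sum_congr rfl
        intro p _
        rw [Real.volume_Ico]; congr 1; ring
      · intro p hp
        simp only [I, Finset.mem_product, Finset.mem_range] at hp
        have := hab _ hp.1; linarith
    rw [h3, Real.volume_Ico] at h2
    have h4 := ENNReal.ofReal_le_ofReal_iff'.1 h2
    rcases h4 with h4 | h4
    · exact le_max_of_le_left (by linarith)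
    · exact le_max_of_le_right h4
  by_contra hcon
  push Not at hcon
  rcases Nat.eq_zero_or_pos n with rfl | hn
  · simp [hs] at hcon; linarith
  obtain ⟨M, hM⟩ := exists_nat_gt (max ((B - A) / (s - 1)) 0)
  have h5 := key M hn
  have hM1 : (B - A) / (s - 1) < M := lt_of_le_of_lt (le_max_left _ _) hM
  have hM0 : 0 < (M : ℝ) := lt_of_le_of_lt (le_max_right _ _) hM
  rw [div_lt_iff₀ (by linarith)] at hM1
  rcases le_max_iff.1 h5 with h6 | h6
  · nlinarith
  · nlinarith

/-! ### Rational approximation -/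

section Approx

variable {β : ℝ} {q : ℕ} {p : ℤ}

lemma approx_eq (hq : 0 < q) (i : ℕ) (k : ℤ) :
    (i : ℝ) * β - k = ((i * p - k * q : ℤ) : ℝ) / q + i * (q * β - p) / q := by
  have : (q : ℝ) ≠ 0 := by positivity
  push_cast
  field_simp
  ring

lemma approx_sep (hq : 0 < q) (hc : IsCoprime (q : ℤ) p) (h0 : 0 ≤ q * β - p)
    (h1 : q * β - p ≤ 1 / (2 * q)) {i : ℕ} (hi : 0 < i) (hiq : i < q) (k : ℤ) :
    1 / (2 * q) ≤ |(i : ℝ) * β - k| := by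
  have hq' : (0 : ℝ) < q := by positivity
  rw [approx_eq (p := p) hq i k]
  have hne : (i * p - k * q : ℤ) ≠ 0 := by
    intro h
    have hdvd : (q : ℤ) ∣ i * p := ⟨k, by linarith⟩
    have := hc.dvd_of_dvd_mul_right hdvd
    have := Int.le_of_dvd (by exact_mod_cast hi) this
    omega
  have h2 : (1 : ℝ) ≤ |((i * p - k * q : ℤ) : ℝ)| := by exact_mod_cast Int.one_le_abs hne
  have h3 : 1 / (q : ℝ) ≤ |((i * p - k * q : ℤ) : ℝ) / q| := by
    rw [abs_div, abs_of_pos hq']; gcongr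
  have h4 : |(i : ℝ) * (q * β - p) / q| ≤ 1 / (2 * q) := by
    rw [abs_of_nonneg (by positivity)]
    refine le_trans ?_ h1
    rw [div_le_iff₀ hq', mul_comm]
    have : (i : ℝ) ≤ q := by exact_mod_cast hiq.le
    gcongr
  have h5 := abs_sub_abs_le_abs_sub (((i * p - k * q : ℤ) : ℝ) / q) (-((i : ℝ) * (q * β - p) / q))
  rw [abs_neg, sub_neg_eq_add] at h5
  have h6 : 1 / (q : ℝ) = 1 / (2 * q) + 1 / (2 * q) := by field_simp; norm_num
  linarith

lemma approx_sep' (hq : 0 < q) (hc : IsCoprime (q : ℤ) p) (h0 : 0 < q * β - p)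
    (h1 : q * β - p ≤ 1 / (2 * q)) {i : ℕ} (hi : 0 < i) (hiq : i * (q * β - p) ≤ 1 / 2) (k : ℤ) :
    q * β - p ≤ |(i : ℝ) * β - k| := by
  have hq' : (0 : ℝ) < q := by positivity
  rw [approx_eq (p := p) hq i k]
  by_cases hne : (i * p - k * q : ℤ) = 0
  · have hdvd : (q : ℤ) ∣ i * p := ⟨k, by linarith⟩
    have := hc.dvd_of_dvd_mul_right hdvd
    have hle := Int.le_of_dvd (by exact_mod_cast hi) this
    have hle' : (q : ℝ) ≤ i := by exact_mod_cast hle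
    rw [hne]
    simp only [Int.cast_zero, zero_div, zero_add]
    rw [abs_of_pos (by positivity), le_div_iff₀ hq']
    nlinarith
  have h2 : (1 : ℝ) ≤ |((i * p - k * q : ℤ) : ℝ)| := by exact_mod_cast Int.one_le_abs hne
  have h3 : 1 / (q : ℝ) ≤ |((i * p - k * q : ℤ) : ℝ) / q| := by
    rw [abs_div, abs_of_pos hq']; gcongr
  have h4 : |(i : ℝ) * (q * β - p) / q| ≤ 1 / (2 * q) := by
    rw [abs_of_nonneg (by positivity), div_le_div_iff₀ hq' (by positivity)]
    nlinarith
  have h5 := abs_sub_abs_le_abs_sub (((i * p - k * q : ℤ) : ℝ) / q) (-((i : ℝ) * (q * β - p) / q))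
  rw [abs_neg, sub_neg_eq_add] at h5
  have h6 : 1 / (q : ℝ) = 1 / (2 * q) + 1 / (2 * q) := by field_simp; norm_num
  linarith

lemma approx_dense (hq : 0 < q) (hc : IsCoprime (q : ℤ) p) (h0 : 0 ≤ q * β - p)
    (h1 : q * β - p ≤ 1 / (2 * q)) (a : ℝ) :
    ∃ i < q, ∃ k : ℤ, (i : ℝ) * β + k ∈ Icc a (a + 2 / q) := by
  have hq' : (0 : ℝ) < q := by positivity
  set m : ℤ := ⌈q * a⌉ with hm
  obtain ⟨u, v, huv⟩ := hc
  have hqz : (0 : ℤ) < q := by exact_mod_cast hq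
  set i : ℤ := (m * v) % q with hi
  have hi0 : 0 ≤ i := Int.emod_nonneg _ hqz.ne'
  have hiq : i < q := Int.emod_lt_of_pos _ hqz
  have hdiv := Int.emod_add_mul_ediv (m * v) q
  set d := (m * v) / (q : ℤ)
  have e : i * p + (m * u + d * p) * q = m := by
    have : i = m * v - q * d := by omega
    rw [this]
    linear_combination m * huv
  refine ⟨i.toNat, by omega, m * u + d * p, ?_⟩
  have hcast : ((i.toNat : ℕ) : ℝ) = (i : ℝ) := by
    have : ((i.toNat : ℕ) : ℤ) = i := Int.toNat_of_nonneg hi0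
    exact_mod_cast this
  have e' : (i : ℝ) * p + ((m * u + d * p : ℤ) : ℝ) * q = m := by exact_mod_cast e
  have val : (i.toNat : ℝ) * β + ((m * u + d * p : ℤ) : ℝ) = m / q + i * (q * β - p) / q := by
    rw [hcast]
    field_simp
    linear_combination e'
  rw [val]
  have b1 : q * a ≤ m := Int.le_ceil _
  have b2 : (m : ℝ) < q * a + 1 := Int.ceil_lt_add_one _
  have hi0' : (0 : ℝ) ≤ i := by exact_mod_cast hi0
  have hiq' : (i : ℝ) ≤ q := by exact_mod_cast hiq.le
  have b3 : 0 ≤ (i : ℝ) * (q * β - p) / q := by positivity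
  have b4 : (i : ℝ) * (q * β - p) / q ≤ 1 / q := by
    rw [div_le_div_iff₀ hq' hq']
    rw [le_div_iff₀ (by positivity)] at h1
    nlinarith
  have b5 : a ≤ m / q := by rw [le_div_iff₀ hq']; linarith
  have b6 : (m : ℝ) / q ≤ a + 1 / q := by
    rw [div_le_iff₀ hq']; field_simp; linarith
  have b7 : (2 : ℝ) / q = 1 / q + 1 / q := by ring
  exact ⟨by linarith, by linarith⟩

end Approx

namespace CData

variable (D : CData)

lemma le_add_one_of_h {x y : ℝ} (h : D.h y - D.h x < 1) : y ≤ x + 1 := by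
  by_contra hc
  have := D.h_mono (not_le.1 hc).le
  rw [D.h_add_one] at this
  linarith

lemma sum_nu_le_one {n : ℕ} {η₀ η₁ x y : ℝ} (h1 : η₁ < η₀) (h0 : η₀ ≤ 1)
    (hsep : ∀ i, 0 < i → i < n → ∀ k : ℤ, η₀ ≤ |(i : ℝ) * D.β - k|) (hxy : x ≤ y)
    (hh : D.h y - D.h x ≤ η₁) :
    ∑ i ∈ Finset.range n, D.nu (D.F^[i] x) (D.F^[i] y) ≤ 1 + D.N := by
  have hy1 : y ≤ x + 1 := D.le_add_one_of_h (by linarith)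
  -- a point (mod 1) is visited at most once
  have hvis : ∀ i < n, ∀ j < n, i < j → ∀ (k l : ℤ) (t : ℝ), t + k ∈ Ico (D.F^[i] x) (D.F^[i] y) →
      t + l ∈ Ico (D.F^[j] x) (D.F^[j] y) → False := by
    intro i _ j hj hij k l t hk hl
    have a1 := D.h_mono hk.1
    have a2 := D.h_mono hk.2.le
    have a3 := D.h_mono hl.1
    have a4 := D.h_mono hl.2.le
    rw [D.h_iter, D.h_add_int] at a1 a2 a3 a4
    have hs := hsep (j - i) (by omega) (by omega) (l - k)
    rw [Nat.cast_sub hij.le] at hs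
    push_cast at hs
    rcases le_abs.1 hs with h | h <;> nlinarith
  unfold nu
  rw [Finset.sum_add_distrib]
  apply add_le_add
  · apply sum_len_le_one (fun i => D.F^[i] x) (fun i => D.F^[i] y)
    · intro i _; exact (D.iter_mono i).monotone hxy
    · intro i hi j hj k l hne
      rw [Set.disjoint_left]
      intro t ht1 ht2
      have m1 : t + ((-k : ℤ) : ℝ) ∈ Ico (D.F^[i] x) (D.F^[i] y) :=
        ⟨by push_cast; linarith [ht1.1], by push_cast; linarith [ht1.2]⟩
      have m2 : t + ((-l : ℤ) : ℝ) ∈ Ico (D.F^[j] x) (D.F^[j] y) :=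
        ⟨by push_cast; linarith [ht2.1], by push_cast; linarith [ht2.2]⟩
      rcases lt_trichotomy i j with h | h | h
      · exact hvis i hi j hj h _ _ t m1 m2
      · subst h
        have hb := D.iter_le_add_one hy1 i
        have c1 := ht1.1; have c2 := ht1.2; have c3 := ht2.1; have c4 := ht2.2
        have d1 : (k : ℝ) < l + 1 := by linarith
        have d2 : (l : ℝ) < k + 1 := by linarith
        have d3 : k < l + 1 := by exact_mod_cast d1
        have d4 : l < k + 1 := by exact_mod_cast d2
        exact hne (by rw [show k = l by omega])
      · exact hvis j hj i hi h _ _ t m2 m1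
  · rw [Finset.sum_comm]
    have : ∀ c : Fin D.N, ∑ i ∈ Finset.range n, D.hit c (D.F^[i] x) (D.F^[i] y) ≤ 1 := by
      intro c
      by_cases hex : ∃ i < n, ∃ k : ℤ, D.crit c + k ∈ Ico (D.F^[i] x) (D.F^[i] y)
      · obtain ⟨i, hi, k, hk⟩ := hex
        rw [Finset.sum_eq_single i]
        · exact D.hit_le_one _ _ _
        · intro j hj hji
          rcases D.hit_cases c (D.F^[j] x) (D.F^[j] y) with ⟨l, hl⟩ | h
          · exfalso
            rcases lt_or_gt_of_ne hji with h | h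
            · exact hvis j (Finset.mem_range.1 hj) i hi h _ _ _ hl hk
            · exact hvis i hi j (Finset.mem_range.1 hj) h _ _ _ hk hl
          · exact h
        · intro h; exact absurd (Finset.mem_range.2 hi) h
      · push Not at hex
        rw [Finset.sum_eq_zero]
        · norm_num
        · intro i hi
          rcases D.hit_cases c (D.F^[i] x) (D.F^[i] y) with ⟨l, hl⟩ | h
          · exact absurd hl (hex i (Finset.mem_range.1 hi) l)
          · exact h
    calc _ ≤ ∑ _c : Fin D.N, (1 : ℝ) := Finset.sum_le_sum fun c _ => this c
      _ = D.N := by simp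

lemma sum_nu_le {n : ℕ} {η₀ η₁ : ℝ} (hη : 0 < η₁) (h1 : η₁ < η₀) (h0 : η₀ ≤ 1)
    (hsep : ∀ i, 0 < i → i < n → ∀ k : ℤ, η₀ ≤ |(i : ℝ) * D.β - k|) (M m : ℕ) {x y : ℝ}
    (hxy : x ≤ y) (hh : D.h y - D.h x ≤ (M + 1) * η₁) :
    ∑ i ∈ Finset.range (m * n), D.nu (D.F^[i] x) (D.F^[i] y) ≤ m * ((M + 1) * (1 + D.N)) := by
  have hpos : (0 : ℝ) ≤ 1 + D.N := by positivity
  have piece : ∀ (M : ℕ) (x y : ℝ), x ≤ y → D.h y - D.h x ≤ (M + 1) * η₁ →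
      ∑ i ∈ Finset.range n, D.nu (D.F^[i] x) (D.F^[i] y) ≤ (M + 1) * (1 + D.N) := by
    intro M
    induction M with
    | zero =>
      intro x y hxy hh
      have := D.sum_nu_le_one h1 h0 hsep hxy (by simpa using hh)
      simpa using this
    | succ M ih =>
      intro x y hxy hh
      push_cast at hh ⊢
      by_cases hs : D.h y - D.h x ≤ η₁
      · have := D.sum_nu_le_one h1 h0 hsep hxy hs
        nlinarith [mul_nonneg (Nat.cast_nonneg M : (0 : ℝ) ≤ M) hpos]
      · push Not at hs
        obtain ⟨z, hz, hzv⟩ := intermediate_value_Icc hxy D.h_cont.continuousOn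
          (⟨by linarith, by linarith⟩ : D.h x + η₁ ∈ Icc (D.h x) (D.h y))
        have i1 := D.sum_nu_le_one h1 h0 hsep hz.1 (by linarith : D.h z - D.h x ≤ η₁)
        have i2 := ih z y hz.2 (by linarith)
        have i3 : ∑ i ∈ Finset.range n, D.nu (D.F^[i] x) (D.F^[i] y) ≤
            ∑ i ∈ Finset.range n, D.nu (D.F^[i] x) (D.F^[i] z) +
            ∑ i ∈ Finset.range n, D.nu (D.F^[i] z) (D.F^[i] y) := by
          rw [← Finset.sum_add_distrib]
          exact Finset.sum_le_sum fun i _ => D.nu_subadd _ _ _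
        linarith
  induction m with
  | zero => simp
  | succ m ih =>
    rw [Nat.succ_mul, Finset.sum_range_add]
    have := piece M (D.F^[m * n] x) (D.F^[m * n] y) ((D.iter_mono _).monotone hxy)
      (by rw [D.h_iter, D.h_iter]; linarith)
    have e : ∑ i ∈ Finset.range n, D.nu (D.F^[m * n + i] x) (D.F^[m * n + i] y) =
        ∑ i ∈ Finset.range n, D.nu (D.F^[i] (D.F^[m * n] x)) (D.F^[i] (D.F^[m * n] y)) := by
      apply Finset.sum_congr rfl
      intro i _
      rw [add_comm, Function.iterate_add_apply, Function.iterate_add_apply]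
    rw [e]
    push_cast
    linarith

end CData

namespace CData

variable (D : CData)

/-- A homeomorphism of the line commuting with `F` and the unit translation, moving points to the
right by a small amount. -/
structure IsShift (H : ℝ → ℝ) : Prop where
  mono : StrictMono H
  cont : Continuous H
  add_one : ∀ x, H (x + 1) = H x + 1
  lt : ∀ x, x < H x
  five : ∀ x, H^[5] x ≤ x + 1
  comm : ∀ x, H (D.F x) = D.F (H x)
  surj : Function.Surjective H

variable {D}

lemma IsShift.iter_comm {H : ℝ → ℝ} (hH : D.IsShift H) (n : ℕ) (x : ℝ) :
    D.F^[n] (H x) = H (D.F^[n] x) := by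
  induction n generalizing x with
  | zero => rfl
  | succ n ih =>
    rw [Function.iterate_succ_apply, Function.iterate_succ_apply, ← hH.comm, ih]

lemma add_int_of_add_one {H : ℝ → ℝ} (h : ∀ x, H (x + 1) = H x + 1) (x : ℝ) (k : ℤ) :
    H (x + k) = H x + k := by
  have hn : ∀ (n : ℕ) x, H (x + n) = H x + n := by
    intro n
    induction n with
    | zero => simp
    | succ n ih => intro x; push_cast; rw [← add_assoc, h, ih]; ring
  obtain ⟨n, rfl | rfl⟩ := k.eq_nat_or_neg
  · exact_mod_cast hn n x
  · have := hn n (x + (-(n : ℤ) : ℤ))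
    push_cast at this ⊢
    rw [show x + -(n : ℝ) + n = x by ring] at this
    linarith

lemma exists_min_of_periodic {u : ℝ → ℝ} (hc : Continuous u) (hp : ∀ x, u (x + 1) = u x) :
    ∃ z, ∀ x, u z ≤ u x := by
  obtain ⟨z, _, hz⟩ := isCompact_Icc.exists_isMinOn (nonempty_Icc.2 (zero_le_one' ℝ))
    hc.continuousOn
  refine ⟨z, fun x => ?_⟩
  have hper : Function.Periodic u 1 := hp
  obtain ⟨y, hy, hxy⟩ := hper.exists_mem_Ico₀ one_pos x
  rw [hxy]
  exact hz (Ico_subset_Icc_self hy)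

lemma lam_ge_of_middle_short {a b c d : ℝ} (hbc : b < c) (h1 : c - b ≤ b - a)
    (h2 : c - b ≤ d - c) : Real.log (4 / 3) ≤ lam a b c d := by
  rw [lam_eq (by linarith) hbc (by linarith)]
  apply Real.log_le_log (by norm_num)
  have hm : 0 < c - b := by linarith
  have : (1 : ℝ) / 3 ≤ (b - a) * (d - c) / ((c - b) * (d - a)) := by
    rw [div_le_div_iff₀ (by norm_num) (by nlinarith)]
    nlinarith [mul_nonneg (sub_nonneg.2 h1) (sub_nonneg.2 h2),
      mul_nonneg hm.le (sub_nonneg.2 h1), mul_nonneg hm.le (sub_nonneg.2 h2)]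
  linarith

/-- The comparison constant attached to a distortion sum `S`. -/
noncomputable def symK (D : CData) (S : ℝ) : ℝ := Real.exp (D.C * S) / Real.log (4 / 3)

lemma symK_pos (S : ℝ) : 0 < symK D S :=
  div_pos (Real.exp_pos _) (Real.log_pos (by norm_num))

lemma IsShift.middle {H : ℝ → ℝ} (hH : D.IsShift H) {n : ℕ} {S : ℝ}
    (hdens : ∀ z x, ∃ i < n, ∃ k : ℤ, D.F^[i] x + k ∈ Icc z (H z))
    (hS : ∀ w, ∑ i ∈ Finset.range n, D.nu (D.F^[i] w) (D.F^[i] (H^[5] w)) ≤ S) (w : ℝ) :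
    H^[3] w - H^[2] w ≤ symK D S * (H^[2] w - w) ∧
    H^[3] w - H^[2] w ≤ symK D S * (H^[5] w - H^[3] w) := by
  obtain ⟨z, hz⟩ := exists_min_of_periodic (u := fun x => H (H x) - x)
    ((hH.cont.comp hH.cont).sub continuous_id) (fun x => by simp only [hH.add_one]; ring)
  obtain ⟨i, hi, k, hk⟩ := hdens z (H^[2] w)
  have e2 : H^[2] w = H (H w) := rfl
  have e3 : H^[3] w = H (H (H w)) := rfl
  have e5 : H^[5] w = H (H (H (H (H w)))) := rfl
  set y := D.F^[i] w + k with hy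
  have ci : ∀ x, D.F^[i] (H x) + k = H (D.F^[i] x + k) := fun x => by
    rw [hH.iter_comm, add_int_of_add_one hH.add_one]
  rw [e2, ci, ci] at hk
  have l1 := hH.lt w
  have l2 := hH.lt (H w)
  have l3 := hH.lt (H (H w))
  have l4 := hH.lt (H (H (H w)))
  have l5 := hH.lt (H (H (H (H w))))
  have hM : H (H (H y)) - H (H y) ≤ H (H z) - z := by
    have := hH.mono.monotone hk.2
    linarith [hk.1]
  have hlow : Real.log (4 / 3) ≤ lam y (H (H y)) (H (H (H y))) (H (H (H (H (H y))))) := by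
    apply lam_ge_of_middle_short (hH.lt _)
    · linarith [hz y]
    · linarith [hz (H (H (H y)))]
  have htr : lam y (H (H y)) (H (H (H y))) (H (H (H (H (H y))))) =
      lam (D.F^[i] w) (D.F^[i] (H (H w))) (D.F^[i] (H (H (H w))))
        (D.F^[i] (H (H (H (H (H w)))))) := by
    rw [hy, ← ci, ← ci, ← ci, ← ci, ← ci]
    unfold lam
    congr 1
    · congr 1
      · congr 1 <;> congr 1 <;> ring
      · congr 1; ring
    · congr 1; ring
  have hS' : ∑ j ∈ Finset.range i, D.nu (D.F^[j] w) (D.F^[j] (H (H (H (H (H w)))))) ≤ S := by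
    refine le_trans (Finset.sum_le_sum_of_subset_of_nonneg (Finset.range_mono hi.le) ?_) (hS w)
    intro j _ _
    exact D.nu_nonneg ((D.iter_mono j).monotone (by rw [← e5]; linarith))
  have hcr := D.cross_ratio hS' (by linarith : w ≤ H (H w)) l3 (by linarith) (hH.five w)
  rw [← htr] at hcr
  have hlog : 0 < Real.log (4 / 3) := Real.log_pos (by norm_num)
  have hub := lam_le_div (by linarith : w ≤ H (H w)) l3
    (by linarith : H (H (H w)) ≤ H (H (H (H (H w)))))
  set A := H (H w) - w
  set M := H (H (H w)) - H (H w)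
  set B := H (H (H (H (H w)))) - H (H (H w))
  have hA : 0 < A := by simp only [A]; linarith
  have hM0 : 0 < M := by simp only [M]; linarith
  have hB : 0 < B := by simp only [B]; linarith
  have hsum : H (H (H (H (H w)))) - w = A + M + B := by simp only [A, M, B]; ring
  rw [hsum] at hub
  have hE := Real.exp_pos (D.C * S)
  have hub1 : A * B / (M * (A + M + B)) ≤ A / M := by
    rw [div_le_div_iff₀ (by positivity) hM0]
    nlinarith [mul_pos hA hM0, mul_pos hM0 hB]
  have hub2 : A * B / (M * (A + M + B)) ≤ B / M := by
    rw [div_le_div_iff₀ (by positivity) hM0]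
    nlinarith [mul_pos hA hM0, mul_pos hM0 hB, mul_pos (mul_pos hM0 hB) hM0, mul_pos (mul_pos hM0 hB) hB]
  have fin : ∀ X, 0 < X → A * B / (M * (A + M + B)) ≤ X / M → M ≤ symK D S * X := by
    intro X hX h
    have : Real.log (4 / 3) ≤ Real.exp (D.C * S) * (X / M) :=
      hlow.trans (hcr.trans (mul_le_mul_of_nonneg_left (hub.trans h) hE.le))
    unfold symK
    rw [div_mul_eq_mul_div, le_div_iff₀ hlog]
    rw [← mul_div_assoc, le_div_iff₀ hM0] at this
    linarith
  exact ⟨fin A hA hub1, fin B hB hub2⟩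

/-- Comparability of adjacent double steps. -/
lemma IsShift.comparable {H : ℝ → ℝ} (hH : D.IsShift H) {n : ℕ} {S : ℝ}
    (hdens : ∀ z x, ∃ i < n, ∃ k : ℤ, D.F^[i] x + k ∈ Icc z (H z))
    (hS : ∀ w, ∑ i ∈ Finset.range n, D.nu (D.F^[i] w) (D.F^[i] (H^[5] w)) ≤ S) (x : ℝ) :
    H (H (H x)) - H x ≤ (1 + symK D S) * (H (H x) - x) ∧
    H (H x) - x ≤ (1 + symK D S) * (H (H (H x)) - H x) := by
  have l1 := hH.lt x
  have l2 := hH.lt (H x)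
  have l3 := hH.lt (H (H x))
  have hK : 0 < symK D S := symK_pos S
  constructor
  · have := (hH.middle hdens hS x).1
    simp only [Function.iterate_succ, Function.iterate_zero, Function.comp, id] at this
    linarith
  · obtain ⟨y, rfl⟩ := hH.surj x
    obtain ⟨w, rfl⟩ := hH.surj y
    have := (hH.middle hdens hS w).2
    simp only [Function.iterate_succ, Function.iterate_zero, Function.comp, id] at this
    linarith

lemma surj_of_add_one {H : ℝ → ℝ} (hc : Continuous H) (h : ∀ x, H (x + 1) = H x + 1) :
    Function.Surjective H := by
  intro y
  obtain ⟨k, hk⟩ := exists_int_gt (y - H 0)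
  obtain ⟨l, hl⟩ := exists_int_lt (y - H 0)
  have e1 := add_int_of_add_one h 0 k
  have e2 := add_int_of_add_one h 0 l
  rw [zero_add] at e1 e2
  have hlk : (l : ℝ) ≤ k := by linarith
  obtain ⟨x, _, hx⟩ := intermediate_value_Icc hlk hc.continuousOn
    (⟨by linarith, by linarith⟩ : y ∈ Icc (H l) (H k))
  exact ⟨x, hx⟩

variable (D)

/-- The first return map `x ↦ F^q x - p`. -/
noncomputable def T (q : ℕ) (p : ℤ) (x : ℝ) : ℝ := D.F^[q] x - p

variable {D} {q : ℕ} {p : ℤ}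

lemma T_mono : StrictMono (D.T q p) := fun _ _ h => sub_lt_sub_right (D.iter_mono q h) _

lemma T_cont : Continuous (D.T q p) := (D.iter_diff q).continuous.sub continuous_const

lemma T_add_one (x : ℝ) : D.T q p (x + 1) = D.T q p x + 1 := by
  have := D.iter_add_int q x 1
  push_cast at this
  unfold T; rw [this]; ring

lemma T_comm (x : ℝ) : D.T q p (D.F x) = D.F (D.T q p x) := by
  have := D.add_int (D.F^[q] x) (-p)
  push_cast at this
  unfold T
  rw [sub_eq_add_neg, sub_eq_add_neg, this, ← Function.iterate_succ_apply D.F q x,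
    ← Function.iterate_succ_apply' D.F q x]

lemma h_T (x : ℝ) : D.h (D.T q p x) = D.h x + (q * D.β - p) := by
  have := D.h_add_int (D.F^[q] x) (-p)
  push_cast at this
  unfold T
  rw [sub_eq_add_neg, this, D.h_iter]; ring

lemma h_T_iter (j : ℕ) (x : ℝ) : D.h ((D.T q p)^[j] x) = D.h x + j * (q * D.β - p) := by
  induction j with
  | zero => simp
  | succ j ih => rw [Function.iterate_succ_apply', h_T, ih]; push_cast; ring

lemma T_iter_eq (j : ℕ) (x : ℝ) : (D.T q p)^[j] x = D.F^[j * q] x - ((j * p : ℤ) : ℝ) := by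
  induction j with
  | zero => simp
  | succ j ih =>
    rw [Function.iterate_succ_apply', ih]
    unfold T
    have := D.iter_add_int q (D.F^[j * q] x) (-(j * p))
    rw [show (j + 1) * q = q + j * q by ring, Function.iterate_add_apply]
    push_cast at this ⊢
    rw [sub_eq_add_neg (D.F^[j * q] x), this]; ring

lemma lt_T (h0 : 0 < q * D.β - p) (x : ℝ) : x < D.T q p x := by
  by_contra hc
  have := D.h_mono (not_lt.1 hc)
  rw [h_T] at this
  linarith

lemma T_isShift (h0 : 0 < q * D.β - p) (h1 : q * D.β - p < 1 / 5) : D.IsShift (D.T q p) where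
  mono := T_mono
  cont := T_cont
  add_one := T_add_one
  lt := lt_T h0
  five := fun x => by
    apply D.le_add_one_of_h
    rw [h_T_iter]; push_cast; linarith
  comm := T_comm
  surj := surj_of_add_one T_cont T_add_one

/-- The universal comparison constant for the return maps. -/
noncomputable def K₀ (D : CData) : ℝ := 1 + symK D (170 * (1 + D.N))

lemma K₀_pos : 0 < D.K₀ := by
  have : 0 < symK D (170 * (1 + D.N)) := symK_pos _
  unfold K₀; linarith

lemma one_le_K₀ : 1 ≤ D.K₀ := by
  have : 0 < symK D (170 * (1 + D.N)) := symK_pos _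
  unfold K₀; linarith

lemma T_comparable (hq : 0 < q) (hc : IsCoprime (q : ℤ) p) (h0 : 0 < q * D.β - p)
    (h1 : q * D.β - p ≤ 1 / (2 * q)) (h2 : q * D.β - p ≤ 1 / 8) (x : ℝ) :
    D.T q p (D.T q p (D.T q p x)) - D.T q p x ≤ D.K₀ * (D.T q p (D.T q p x) - x) ∧
    D.T q p (D.T q p x) - x ≤ D.K₀ * (D.T q p (D.T q p (D.T q p x)) - D.T q p x) := by
  set θ := q * D.β - p with hθ
  have hq' : (0 : ℝ) < q := by positivity
  set n := ⌊1 / (2 * θ)⌋₊ with hn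
  have hn1 : (n : ℝ) ≤ 1 / (2 * θ) := Nat.floor_le (by positivity)
  have hn2 : 1 / (2 * θ) < n + 1 := Nat.lt_floor_add_one _
  rw [le_div_iff₀ (by positivity)] at hn1
  rw [div_lt_iff₀ (by positivity)] at hn2
  have hqθ : q * θ ≤ 1 / 2 := by
    rw [le_div_iff₀ (by positivity)] at h1; linarith
  refine (T_isShift h0 (by linarith)).comparable (n := 17 * n) (S := 170 * (1 + D.N)) ?_ ?_ x
  · intro z x
    obtain ⟨i, hi, k, hk⟩ := approx_dense hq hc h0.le h1 (D.h z - 2 / q - θ - D.h x)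
    set w := D.F^[i] x + k with hw
    have hwv : D.h w = D.h x + (i * D.β + k) := by
      rw [hw, D.h_add_int, D.h_iter]; ring
    have hwz : w < z := by
      by_contra hcon
      have := D.h_mono (not_lt.1 hcon)
      rw [hwv] at this
      linarith [hk.2]
    have hex : ∃ j, z ≤ (D.T q p)^[j] w := by
      obtain ⟨j, hj⟩ := exists_nat_gt ((D.h z - D.h w) / θ)
      refine ⟨j, ?_⟩
      by_contra hcon
      have := D.h_mono (not_le.1 hcon).le
      rw [h_T_iter] at this
      rw [div_lt_iff₀ h0] at hj
      linarith
    classical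
    set j := Nat.find hex with hj
    have hjs := Nat.find_spec hex
    rw [← hj] at hjs
    have hj0 : j ≠ 0 := by
      intro h; rw [h] at hjs; simp at hjs; linarith
    obtain ⟨j', hj'⟩ := Nat.exists_eq_succ_of_ne_zero hj0
    have hlt : (D.T q p)^[j'] w < z := by
      have := Nat.find_min hex (m := j') (by omega)
      exact not_le.1 this
    have hjb : j' * θ ≤ 2 / q + θ := by
      have := D.h_mono hlt.le
      rw [h_T_iter, hwv] at this
      linarith [hk.1]
    have hTw : (D.T q p)^[j] w = D.F^[i + j * q] x + ((k - j * p : ℤ) : ℝ) := by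
      rw [T_iter_eq, hw, D.iter_add_int, ← Function.iterate_add_apply, add_comm (j * q) i]
      push_cast; ring
    refine ⟨i + j * q, ?_, k - j * p, ?_⟩
    · have c1 : (i : ℝ) ≤ q := by exact_mod_cast hi.le
      have c2 : (j' * q : ℝ) * θ ≤ 2 + q * θ := by
        have := mul_le_mul_of_nonneg_left hjb hq'.le
        rw [mul_add, mul_div_cancel₀ _ hq'.ne'] at this
        linarith
      have c3 : ((i + j * q : ℕ) : ℝ) < ((17 * n : ℕ) : ℝ) := by
        rw [hj']
        push_cast
        have : ((i : ℝ) + (j' + 1) * q) * θ < 17 * n * θ := by nlinarith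
        exact lt_of_mul_lt_mul_right this h0.le
      exact_mod_cast c3
    · rw [← hTw]
      refine ⟨hjs, ?_⟩
      rw [hj', Function.iterate_succ_apply']
      exact (T_mono hlt).le
  · intro w
    have hm : w ≤ (D.T q p)^[5] w :=
      ((T_mono (D := D) (q := q) (p := p)).strictMono_iterate_of_lt_map (lt_T h0 w)).monotone (Nat.zero_le 5)
    have := D.sum_nu_le (η₀ := θ) (η₁ := θ / 2) (n := n) (by positivity) (by linarith)
      (by linarith) (fun i hi hin k => approx_sep' hq hc h0 h1 hi ?_ k) 9 17 hm ?_
    · refine this.trans (le_of_eq ?_)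
      push_cast; ring
    · have : (i : ℝ) ≤ n := by exact_mod_cast hin.le
      nlinarith
    · rw [h_T_iter]; push_cast; linarith

/-- One-sided approximability of the rotation number. -/
def PosApprox (D : CData) : Prop :=
  ∀ ε > 0, ∃ (q : ℕ) (p : ℤ), 0 < q ∧ IsCoprime (q : ℤ) p ∧ 0 < q * D.β - p ∧ q * D.β - p < ε / q

/-- The semiconjugacy is a conjugacy (no wandering intervals). -/
lemma h_strictMono (hA : D.PosApprox) : StrictMono D.h := by
  refine D.h_mono.strictMono_of_injective ?_
  by_contra hinj
  have : ∃ a b, a < b ∧ D.h a = D.h b := by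
    unfold Function.Injective at hinj
    push Not at hinj
    obtain ⟨a, b, h1, h2⟩ := hinj
    rcases lt_or_gt_of_ne h2 with h | h
    · exact ⟨a, b, h, h1⟩
    · exact ⟨b, a, h, h1.symm⟩
  obtain ⟨a₁, b, hab, he⟩ := this
  -- leftmost point of the plateau
  set P := {t | D.h a₁ ≤ D.h t} with hP
  have hPc : IsClosed P := isClosed_le continuous_const D.h_cont
  have hPb : BddBelow P := by
    refine ⟨a₁ - 1, fun t ht => ?_⟩
    by_contra hcon
    have h1 := D.h_mono (not_le.1 hcon).le
    have h2 := D.h_add_one (a₁ - 1)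
    rw [sub_add_cancel] at h2
    have : D.h a₁ ≤ D.h t := ht
    linarith
  set a := sInf P with ha
  have haP : a ∈ P := hPc.csInf_mem ⟨a₁, (le_rfl : D.h a₁ ≤ D.h a₁)⟩ hPb
  have haa : a ≤ a₁ := csInf_le hPb (le_rfl : D.h a₁ ≤ D.h a₁)
  have hha : D.h a = D.h b := by
    apply le_antisymm (D.h_mono (by linarith))
    rw [← he]; exact haP
  have hleft : ∀ t < a, D.h t < D.h a := by
    intro t ht
    by_contra hcon
    have : t ∈ P := by
      have : D.h a₁ ≤ D.h a := haP
      exact this.trans (not_lt.1 hcon)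
    linarith [csInf_le hPb this]
  have hK := K₀_pos (D := D)
  set t := a - (b - a) / (2 * D.K₀) with ht
  have hba : 0 < b - a := by linarith
  have hta : t < a := by
    have : 0 < (b - a) / (2 * D.K₀) := by positivity
    linarith
  have hgap := hleft t hta
  obtain ⟨q, p, hq, hc, h0, h1⟩ := hA (min (1 / 8) ((D.h a - D.h t) / 2))
    (lt_min (by norm_num) (by linarith))
  have hq1 : (1 : ℝ) ≤ q := by exact_mod_cast hq
  have h1' : q * D.β - p < min (1 / 8) ((D.h a - D.h t) / 2) :=
    h1.trans_le (div_le_self (le_min (by norm_num) (by linarith)) hq1)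
  have h2 : q * D.β - p ≤ 1 / (2 * q) := by
    refine h1.le.trans ?_
    rw [div_le_div_iff₀ (by positivity) (by positivity)]
    have := min_le_left (1 / 8) ((D.h a - D.h t) / 2)
    nlinarith
  have h3 := (h1'.trans_le (min_le_left _ _)).le
  have h4 := h1'.trans_le (min_le_right _ _)
  have hsur := surj_of_add_one (T_cont (D := D) (q := q) (p := p)) T_add_one
  obtain ⟨y, hy⟩ := hsur a
  obtain ⟨x, hx⟩ := hsur y
  have hcmp := (T_comparable hq hc h0 h2 h3 x).1
  rw [hx, hy] at hcmp
  have hxt : t < x := by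
    by_contra hcon
    have := D.h_mono (not_lt.1 hcon)
    have e : D.h a = D.h x + 2 * (q * D.β - p) := by rw [← hy, ← hx, h_T, h_T]; ring
    linarith
  have hTb : b ≤ D.T q p a := by
    by_contra hcon
    have := D.h_mono (not_le.1 hcon).le
    rw [h_T] at this
    linarith
  have hya : y ≤ a := by rw [← hy]; exact (lt_T h0 y).le
  have : D.K₀ * (a - x) < D.K₀ * ((b - a) / (2 * D.K₀)) :=
    mul_lt_mul_of_pos_left (by linarith) hK
  have e : D.K₀ * ((b - a) / (2 * D.K₀)) = (b - a) / 2 := by field_simp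
  linarith

end CData

namespace CData

variable (D : CData)

lemma h_surj : Function.Surjective D.h := surj_of_add_one D.h_cont D.h_add_one

/-- The inverse of the conjugacy `h`. -/
noncomputable def g : ℝ → ℝ := Function.surjInv D.h_surj

variable {D}

lemma h_g (s : ℝ) : D.h (D.g s) = s := Function.surjInv_eq D.h_surj s

lemma g_h (hs : StrictMono D.h) (x : ℝ) : D.g (D.h x) = x := hs.injective (h_g _)

lemma g_mono (hs : StrictMono D.h) : StrictMono D.g := by
  intro s t hst
  rw [← hs.lt_iff_lt, h_g, h_g]; exact hst

lemma g_cont (hs : StrictMono D.h) : Continuous D.g :=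
  (g_mono hs).monotone.continuous_of_surjective fun x => ⟨D.h x, g_h hs x⟩

lemma g_add_one (hs : StrictMono D.h) (s : ℝ) : D.g (s + 1) = D.g s + 1 := by
  apply hs.injective; rw [h_g, D.h_add_one, h_g]

lemma iter_g (hs : StrictMono D.h) (i : ℕ) (s : ℝ) : D.F^[i] (D.g s) = D.g (s + i * D.β) := by
  apply hs.injective; rw [h_g, D.h_iter, h_g]

lemma T_g (hs : StrictMono D.h) {q : ℕ} {p : ℤ} (s : ℝ) :
    D.T q p (D.g s) = D.g (s + (q * D.β - p)) := by
  apply hs.injective; rw [h_g, h_T, h_g]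

/-- Uniform smallness of `g`-images of short intervals. -/
lemma g_small (hs : StrictMono D.h) {ε : ℝ} (hε : 0 < ε) :
    ∃ δ > 0, ∀ s t, s ≤ t → t - s ≤ δ → D.g t - D.g s ≤ ε := by
  have huc : UniformContinuousOn D.g (Icc (-1) 2) :=
    isCompact_Icc.uniformContinuousOn_of_continuous (g_cont hs).continuousOn
  rw [Metric.uniformContinuousOn_iff] at huc
  obtain ⟨δ, hδ, h⟩ := huc ε hε
  refine ⟨min (δ / 2) 1, by positivity, fun s t hst hd => ?_⟩
  have e : ∀ x, D.g (x + ((-⌊s⌋ : ℤ) : ℝ)) = D.g x + ((-⌊s⌋ : ℤ) : ℝ) :=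
    fun x => add_int_of_add_one (g_add_one hs) x _
  have f1 := Int.floor_le s
  have f2 := Int.lt_floor_add_one s
  have hd1 := hd.trans (min_le_left _ _)
  have hd2 := hd.trans (min_le_right _ _)
  have := h (s + ((-⌊s⌋ : ℤ) : ℝ)) ⟨by push_cast; linarith, by push_cast; linarith⟩
    (t + ((-⌊s⌋ : ℤ) : ℝ)) ⟨by push_cast; linarith, by push_cast; linarith⟩
    (by rw [Real.dist_eq, abs_lt]; constructor <;> linarith)
  rw [e, e, Real.dist_eq, abs_lt] at this
  linarith [this.1]

/-- Adjacent double steps of size `η` have comparable `g`-images. -/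
def Cmp (D : CData) (η : ℝ) : Prop := ∀ s,
  D.g (s + 3 * η) - D.g (s + η) ≤ D.K₀ * (D.g (s + 2 * η) - D.g s) ∧
  D.g (s + 2 * η) - D.g s ≤ D.K₀ * (D.g (s + 3 * η) - D.g (s + η))

lemma Cmp.adj {η : ℝ} (h : D.Cmp η) (s : ℝ) :
    D.g (s + 4 * η) - D.g (s + 2 * η) ≤ D.K₀ ^ 2 * (D.g (s + 2 * η) - D.g s) ∧
    D.g (s + 2 * η) - D.g s ≤ D.K₀ ^ 2 * (D.g (s + 4 * η) - D.g (s + 2 * η)) := by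
  have h1 := h s
  have h2 := h (s + η)
  rw [show s + η + 3 * η = s + 4 * η by ring, show s + η + η = s + 2 * η by ring,
    show s + η + 2 * η = s + 3 * η by ring] at h2
  have hK := K₀_pos (D := D)
  constructor
  · calc _ ≤ _ := h2.1
      _ ≤ D.K₀ * (D.K₀ * (D.g (s + 2 * η) - D.g s)) := mul_le_mul_of_nonneg_left h1.1 hK.le
      _ = _ := by ring
  · calc _ ≤ _ := h1.2
      _ ≤ D.K₀ * (D.K₀ * (D.g (s + 4 * η) - D.g (s + 2 * η))) :=
        mul_le_mul_of_nonneg_left h2.2 hK.le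
      _ = _ := by ring

lemma Cmp.adj' {η : ℝ} (h : D.Cmp η) {a b c : ℝ} (hb : b = a + 2 * η) (hc : c = b + 2 * η) :
    D.g c - D.g b ≤ D.K₀ ^ 2 * (D.g b - D.g a) ∧ D.g b - D.g a ≤ D.K₀ ^ 2 * (D.g c - D.g b) := by
  have := h.adj a
  rw [show a + 4 * η = c by rw [hc, hb]; ring, ← hb] at this
  exact this

variable {q : ℕ} {p : ℤ}

lemma cmp_T (hs : StrictMono D.h) (hq : 0 < q) (hc : IsCoprime (q : ℤ) p) (h0 : 0 < q * D.β - p)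
    (h1 : q * D.β - p ≤ 1 / (2 * q)) (h2 : q * D.β - p ≤ 1 / 8) : D.Cmp (q * D.β - p) := by
  intro s
  have := T_comparable hq hc h0 h1 h2 (D.g s)
  simp only [T_g hs] at this
  convert this using 4 <;> ring_nf

lemma sum_nu_le_q (hq : 0 < q) (hc : IsCoprime (q : ℤ) p) (h0 : 0 < q * D.β - p)
    (h1 : q * D.β - p ≤ 1 / (2 * q)) (M : ℕ) {x y : ℝ} (hxy : x ≤ y)
    (hh : D.h y - D.h x ≤ (M + 1) * (1 / (4 * q))) :
    ∑ i ∈ Finset.range q, D.nu (D.F^[i] x) (D.F^[i] y) ≤ (M + 1) * (1 + D.N) := by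
  have hq' : (1 : ℝ) ≤ q := by exact_mod_cast hq
  have := D.sum_nu_le (η₀ := 1 / (2 * q)) (η₁ := 1 / (4 * q)) (n := q) (by positivity)
    (by apply one_div_lt_one_div_of_lt <;> linarith)
    (by rw [div_le_one (by positivity)]; linarith)
    (fun i hi hin k => approx_sep hq hc h0.le h1 hi hin k) M 1 hxy hh
  simpa using this

lemma cmp_q (hs : StrictMono D.h) (hq : 12 < q) (hc : IsCoprime (q : ℤ) p)
    (h0 : 0 < q * D.β - p) (h1 : q * D.β - p ≤ 1 / (2 * q)) : D.Cmp (2 / q) := by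
  have hq0 : 0 < q := by omega
  have hq' : (12 : ℝ) < q := by exact_mod_cast hq
  set η : ℝ := 2 / q with hη
  have hη0 : 0 < η := by positivity
  have iter : ∀ (j : ℕ) x, (fun x => D.g (D.h x + η))^[j] x = D.g (D.h x + j * η) := by
    intro j
    induction j with
    | zero => intro x; simp [g_h hs]
    | succ j ih =>
      intro x
      rw [Function.iterate_succ_apply', ih, h_g]; push_cast; ring_nf
  have hH : D.IsShift (fun x => D.g (D.h x + η)) :=
    { mono := fun a b hab => g_mono hs (by linarith [hs hab])
      cont := (g_cont hs).comp (D.h_cont.add continuous_const)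
      add_one := fun x => by
        rw [D.h_add_one, ← g_add_one hs]; congr 1; ring
      lt := fun x => by
        rw [← hs.lt_iff_lt, h_g]; linarith
      five := fun x => by
        apply D.le_add_one_of_h
        rw [iter, h_g]
        have : (5 : ℕ) * η < 1 := by
          rw [hη]; push_cast; rw [← mul_div_assoc, div_lt_one (by linarith)]; linarith
        linarith
      comm := fun x => by
        apply hs.injective
        rw [D.h_F, h_g, D.h_F, h_g]; ring
      surj := fun y => ⟨D.g (D.h y - η), by simp only [h_g, sub_add_cancel, g_h hs]⟩ }
  intro s
  have := hH.comparable (n := q) (S := 170 * (1 + D.N)) ?_ ?_ (D.g s)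
  · simp only [h_g] at this
    unfold K₀
    convert this using 4 <;> ring_nf
  · intro z x
    obtain ⟨i, hi, k, hk⟩ := approx_dense hq0 hc h0.le h1 (D.h z - D.h x)
    refine ⟨i, hi, k, ?_⟩
    have hv : D.h (D.F^[i] x + k) = D.h x + (i * D.β + k) := by
      rw [D.h_add_int, D.h_iter]; ring
    constructor
    · rw [← hs.le_iff_le, hv]; linarith [hk.1]
    · rw [← hs.le_iff_le, hv, h_g]; linarith [hk.2]
  · intro w
    rw [iter]
    have := sum_nu_le_q hq0 hc h0 h1 39 (x := w) (y := D.g (D.h w + (5 : ℕ) * η))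
      (by rw [← hs.le_iff_le, h_g]; push_cast; linarith)
      (by rw [h_g, hη]; push_cast; apply le_of_eq; field_simp; norm_num)
    refine this.trans ?_
    have : (0 : ℝ) ≤ 1 + D.N := by positivity
    push_cast; linarith

lemma lam_window {K x₀ u v x₁ x₂ x₃ : ℝ} (hK : 1 ≤ K) (h01 : x₀ ≤ u) (huv : u ≤ v) (hv1 : v ≤ x₁)
    (hX : x₀ < x₁) (hG : x₁ < x₂) (hR : x₂ < x₃) (c1 : x₂ - x₁ ≤ K * (x₁ - x₀))
    (c2 : x₁ - x₀ ≤ K * (x₂ - x₁)) (c3 : x₃ - x₂ ≤ K * (x₂ - x₁)) (c4 : x₂ - x₁ ≤ K * (x₃ - x₂)) :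
    (v - u) / (x₁ - x₀) ≤ K ^ 2 * (1 + K) ^ 2 * (1 + K + K ^ 2) * lam u v x₂ x₃ ∧
    lam u v x₂ x₃ ≤ K * ((v - u) / (x₁ - x₀)) := by
  set S := v - u with hS
  set X := x₁ - x₀ with hXd
  set G := x₂ - x₁ with hGd
  set R := x₃ - x₂ with hRd
  have X0 : 0 < X := by linarith
  have G0 : 0 < G := by linarith
  have R0 : 0 < R := by linarith
  have S0 : 0 ≤ S := by linarith
  have K0 : 0 < K := by linarith
  have a1 : G ≤ x₂ - v := by linarith
  have a2 : R ≤ x₃ - u := by linarith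
  have a3 : x₂ - v ≤ (1 + K) * X := by linarith
  have a4 : x₃ - u ≤ (1 + K + K ^ 2) * X := by nlinarith
  have P0 : 0 < (x₂ - v) * (x₃ - u) := by apply mul_pos <;> linarith
  set w := S * R / ((x₂ - v) * (x₃ - u)) with hw
  have w0 : 0 ≤ w := by positivity
  have hwub : w ≤ K * (S / X) := by
    rw [hw, ← mul_div_assoc, div_le_div_iff₀ P0 X0]
    have b1 : G * R ≤ (x₂ - v) * (x₃ - u) := mul_le_mul a1 a2 R0.le (by linarith)
    calc S * R * X ≤ S * R * (K * G) := by gcongr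
      _ = K * S * (G * R) := by ring
      _ ≤ _ := by gcongr
  have hSX : S / X ≤ 1 := by rw [div_le_one X0]; linarith
  have hwK : w ≤ K := hwub.trans (by nlinarith)
  have hwlb : S / X ≤ K ^ 2 * (1 + K) * (1 + K + K ^ 2) * w := by
    rw [hw, ← mul_div_assoc, div_le_div_iff₀ X0 P0]
    have b1 : (x₂ - v) * (x₃ - u) ≤ ((1 + K) * X) * ((1 + K + K ^ 2) * X) :=
      mul_le_mul a3 a4 (by linarith) (by positivity)
    have b2 : X ≤ K ^ 2 * R := by nlinarith
    calc S * ((x₂ - v) * (x₃ - u)) ≤ S * (((1 + K) * X) * ((1 + K + K ^ 2) * X)) := by gcongr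
      _ = S * (1 + K) * (1 + K + K ^ 2) * X * X := by ring
      _ ≤ S * (1 + K) * (1 + K + K ^ 2) * X * (K ^ 2 * R) := by gcongr
      _ = _ := by ring
  have hlam : lam u v x₂ x₃ = Real.log (1 + w) :=
    lam_eq huv (by linarith) (by linarith)
  refine ⟨?_, ?_⟩
  · have hl : w / (1 + K) ≤ lam u v x₂ x₃ := by
      rw [hlam]
      have h1 := Real.one_sub_inv_le_log_of_pos (x := 1 + w) (by linarith)
      refine le_trans ?_ h1
      rw [div_le_iff₀ (by linarith)]
      have : 1 - (1 + w)⁻¹ = w / (1 + w) := by field_simp; ring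
      rw [this, div_mul_eq_mul_div, le_div_iff₀ (by linarith)]
      nlinarith
    rw [div_le_iff₀ (by linarith)] at hl
    refine hwlb.trans ?_
    calc _ ≤ K ^ 2 * (1 + K) * (1 + K + K ^ 2) * (lam u v x₂ x₃ * (1 + K)) := by gcongr
      _ = _ := by ring
  · rw [hlam]
    have := Real.log_le_sub_one_of_pos (x := 1 + w) (by linarith)
    linarith

/-- The transport constant. -/
noncomputable def KT (D : CData) : ℝ :=
  (D.K₀ ^ 2) ^ 2 * (1 + D.K₀ ^ 2) ^ 2 * (1 + D.K₀ ^ 2 + (D.K₀ ^ 2) ^ 2) *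
    (Real.exp (D.C * (48 * (1 + D.N))) * D.K₀ ^ 2)

lemma KT_pos : 0 < D.KT := by
  have := K₀_pos (D := D)
  unfold KT; positivity

/-- Relative sizes of subintervals of a window are transported forward with bounded distortion. -/
lemma transport (hs : StrictMono D.h) (hq : 12 < q) (hc : IsCoprime (q : ℤ) p)
    (h0 : 0 < q * D.β - p) (h1 : q * D.β - p ≤ 1 / (2 * q)) {σ u v : ℝ}
    (hu : σ - 4 / q ≤ u) (huv : u ≤ v) (hv : v ≤ σ) {i j : ℕ} (hij : i ≤ j) (hjq : j ≤ q) :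
    (D.g (v + j * D.β) - D.g (u + j * D.β)) /
      (D.g (σ + j * D.β) - D.g (σ - 4 / q + j * D.β)) ≤
    D.KT * ((D.g (v + i * D.β) - D.g (u + i * D.β)) /
      (D.g (σ + i * D.β) - D.g (σ - 4 / q + i * D.β))) := by
  have hq0 : 0 < q := by omega
  have hq' : (12 : ℝ) < q := by exact_mod_cast hq
  have hcmp := cmp_q hs hq hc h0 h1
  have gm := g_mono hs
  have hη : (0 : ℝ) < 4 / q := by positivity
  have win : ∀ k : ℕ, _ := fun k : ℕ =>
    lam_window (K := D.K₀ ^ 2) (x₀ := D.g (σ - 4 / q + k * D.β)) (u := D.g (u + k * D.β))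
      (v := D.g (v + k * D.β)) (x₁ := D.g (σ + k * D.β)) (x₂ := D.g (σ + 4 / q + k * D.β))
      (x₃ := D.g (σ + 8 / q + k * D.β)) (one_le_pow₀ one_le_K₀) (gm.monotone (by linarith))
      (gm.monotone (by linarith)) (gm.monotone (by linarith)) (gm (by linarith)) (gm (by linarith))
      (gm (by have : (8 : ℝ) / q = 4 / q + 4 / q := by ring
              linarith))
      (hcmp.adj' (a := σ - 4 / q + k * D.β) (b := σ + k * D.β) (c := σ + 4 / q + k * D.β)
        (by ring) (by ring)).1
      (hcmp.adj' (a := σ - 4 / q + k * D.β) (b := σ + k * D.β) (c := σ + 4 / q + k * D.β)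
        (by ring) (by ring)).2
      (hcmp.adj' (a := σ + k * D.β) (b := σ + 4 / q + k * D.β) (c := σ + 8 / q + k * D.β)
        (by ring) (by ring)).1
      (hcmp.adj' (a := σ + k * D.β) (b := σ + 4 / q + k * D.β) (c := σ + 8 / q + k * D.β)
        (by ring) (by ring)).2
  have e8 : (8 : ℝ) / q = 4 / q + 4 / q := by ring
  have hcr : lam (D.g (u + j * D.β)) (D.g (v + j * D.β)) (D.g (σ + 4 / q + j * D.β))
      (D.g (σ + 8 / q + j * D.β)) ≤ Real.exp (D.C * (48 * (1 + D.N))) *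
      lam (D.g (u + i * D.β)) (D.g (v + i * D.β)) (D.g (σ + 4 / q + i * D.β))
      (D.g (σ + 8 / q + i * D.β)) := by
    have e : ∀ s, D.g (s + j * D.β) = D.F^[j - i] (D.g (s + i * D.β)) := by
      intro s
      rw [iter_g hs, Nat.cast_sub hij]; congr 1; ring
    rw [e, e, e, e]
    apply D.cross_ratio
    · have := sum_nu_le_q hq0 hc h0 h1 47 (x := D.g (u + i * D.β))
        (y := D.g (σ + 8 / q + i * D.β)) (gm.monotone (by linarith)) (by
          rw [h_g, h_g]
          have : ((47 : ℕ) + 1 : ℝ) * (1 / (4 * q)) = 4 / q + 4 / q + 4 / q := by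
            push_cast; field_simp; norm_num
          rw [this]; linarith)
      refine le_trans (Finset.sum_le_sum_of_subset_of_nonneg
        (Finset.range_mono (by omega : j - i ≤ q)) ?_) (this.trans (le_of_eq ?_))
      · intro k _ _
        exact D.nu_nonneg ((D.iter_mono k).monotone (gm.monotone (by linarith)))
      · push_cast; ring
    · exact gm.monotone (by linarith)
    · exact gm (by linarith)
    · exact gm.monotone (by linarith)
    · apply D.le_add_one_of_h
      rw [h_g, h_g]
      have : (12 : ℝ) / q = 4 / q + 4 / q + 4 / q := by ring
      have : (12 : ℝ) / q < 1 := by rw [div_lt_iff₀ (by linarith)]; linarith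
      linarith
  have K0 := K₀_pos (D := D)
  refine (win j).1.trans ?_
  unfold KT
  rw [mul_assoc ((D.K₀ ^ 2) ^ 2 * (1 + D.K₀ ^ 2) ^ 2 * (1 + D.K₀ ^ 2 + (D.K₀ ^ 2) ^ 2))]
  apply mul_le_mul_of_nonneg_left _ (by positivity)
  refine hcr.trans ?_
  rw [mul_assoc]
  exact mul_le_mul_of_nonneg_left (win i).2 (Real.exp_pos _).le

end CData

namespace CData

variable {D : CData} {q : ℕ} {p : ℤ}

/-- Some critical point has no critical orbit in a definite one-sided window during time `q`. -/
lemma exists_free_window (hq : 0 < q) (h0 : 0 < q * D.β - p)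
    (h1 : D.N * (q * D.β - p) ≤ 1 / (4 * q)) :
    ∃ s : Fin D.N, ∀ i < q, ∀ t (k : ℤ), D.h (D.crit t) + k ∉
      Ioo (D.h (D.crit s) - 1 / (8 * (D.N + 1) * q) + i * D.β)
        (D.h (D.crit s) - (q * D.β - p) + i * D.β) := by
  by_contra hcon
  push Not at hcon
  choose it hit nx kt hk using hcon
  set θ := q * D.β - p with hθ
  set ℓ : ℝ := 1 / (8 * (D.N + 1) * q) with hℓ
  have hq' : (0 : ℝ) < q := by positivity
  have s0 : Fin D.N := ⟨0, D.N_pos⟩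
  set orb : ℕ → Fin D.N := fun j => nx^[j] s0 with horb
  have hstep : ∀ j, orb (j + 1) = nx (orb j) := fun j => Function.iterate_succ_apply' _ _ _
  obtain ⟨a, b, hab, hbN, hoab⟩ : ∃ a b, a < b ∧ b ≤ D.N ∧ orb a = orb b := by
    obtain ⟨x, y, hxy, hf⟩ := Fintype.exists_ne_map_eq_of_card_lt
      (fun j : Fin (D.N + 1) => orb j) (by simp)
    rcases lt_or_gt_of_ne hxy with h | h
    · exact ⟨x, y, h, by omega, hf⟩
    · exact ⟨y, x, h, by omega, hf.symm⟩
  -- sum along the cycle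
  have key : ∀ r : ℕ, ∃ (I : ℕ) (K : ℤ), I ≤ r * (q - 1) ∧
      r * θ ≤ D.h (D.crit (orb a)) - D.h (D.crit (orb (a + r))) + I * D.β - K ∧
      D.h (D.crit (orb a)) - D.h (D.crit (orb (a + r))) + I * D.β - K ≤ r * ℓ ∧
      (0 < r → r * θ < D.h (D.crit (orb a)) - D.h (D.crit (orb (a + r))) + I * D.β - K) := by
    intro r
    induction r with
    | zero => exact ⟨0, 0, by simp⟩
    | succ r ih =>
      obtain ⟨I, K, hI, hl, hu, _⟩ := ih
      have hk1 := (hk (orb (a + r))).1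
      have hk2 := (hk (orb (a + r))).2
      have hi := hit (orb (a + r))
      rw [← hstep] at hk1 hk2
      refine ⟨I + it (orb (a + r)), K + kt (orb (a + r)), ?_, ?_, ?_, fun _ => ?_⟩
      · rw [Nat.succ_mul]; omega
      · push_cast; rw [← add_assoc a r 1]; nlinarith
      · push_cast; rw [← add_assoc a r 1]; nlinarith
      · push_cast; rw [← add_assoc a r 1]; nlinarith
  obtain ⟨I, K, hI, -, hu, hl⟩ := key (b - a)
  have hl := hl (by omega)
  rw [show a + (b - a) = b by omega, ← hoab, sub_self, zero_add] at hu hl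
  have hr : ((b - a : ℕ) : ℝ) ≤ D.N := by exact_mod_cast (by omega : b - a ≤ D.N)
  have hr0 : (0 : ℝ) < ((b - a : ℕ) : ℝ) := by exact_mod_cast (by omega : 0 < b - a)
  have hIq : (I : ℝ) < ((b - a : ℕ) : ℝ) * q := by
    have h2 : I < (b - a) * q := lt_of_le_of_lt hI
      (Nat.mul_lt_mul_of_pos_left (by omega) (by omega))
    exact_mod_cast h2
  rw [approx_eq (p := p) hq I K, ← hθ] at hu hl
  have hIθ : (I : ℝ) * θ / q < ((b - a : ℕ) : ℝ) * θ := by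
    rw [div_lt_iff₀ hq']; nlinarith
  have hIθ0 : 0 ≤ (I : ℝ) * θ / q := by positivity
  have hNℓ : ((b - a : ℕ) : ℝ) * ℓ < 1 / (4 * q) := by
    rw [hℓ, mul_one_div, div_lt_div_iff₀ (by positivity) (by positivity)]
    nlinarith
  have hrθ : ((b - a : ℕ) : ℝ) * θ ≤ 1 / (4 * q) := le_trans (by gcongr) h1
  have hm : (I * p - K * q : ℤ) = 0 := by
    have m1 : ((I * p - K * q : ℤ) : ℝ) / q < 1 / q := by
      have : (1 : ℝ) / (4 * q) = 1 / q / 4 := by field_simp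
      have : (0 : ℝ) < 1 / q := by positivity
      linarith
    have m2 : 0 < ((I * p - K * q : ℤ) : ℝ) / q := by linarith
    rw [div_lt_div_iff_of_pos_right hq'] at m1
    have m2 := (div_pos_iff_of_pos_right hq').1 m2
    have m1' : (I * p - K * q : ℤ) < 1 := by exact_mod_cast m1
    have m2' : 0 < (I * p - K * q : ℤ) := by exact_mod_cast m2
    omega
  rw [hm] at hl
  simp at hl
  linarith

lemma log_one_add_mul_ge {c u : ℝ} (hc0 : 0 ≤ c) (hc1 : c ≤ 1) (hu : 0 ≤ u) :
    c * Real.log (1 + u) ≤ Real.log (1 + c * u) := by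
  rw [← Real.log_rpow (by linarith)]
  apply Real.log_le_log (Real.rpow_pos_of_pos (by linarith) _)
  exact _root_.rpow_one_add_le_one_add_mul_self (by linarith) hc0 hc1

lemma lam_T (a b c d : ℝ) : lam (D.T q p a) (D.T q p b) (D.T q p c) (D.T q p d) =
    lam (D.F^[q] a) (D.F^[q] b) (D.F^[q] c) (D.F^[q] d) := by
  unfold lam T; simp only [sub_sub_sub_cancel_right]

set_option maxHeartbeats 1600000 in
/-- The window next to a critical point is comparable to a return interval at that point. -/
lemma exists_flat_bound (hs : StrictMono D.h) : ∃ Q > 0, ∃ q₀ : ℕ, ∀ (q : ℕ) (p : ℤ), q₀ ≤ q →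
    IsCoprime (q : ℤ) p → 0 < q * D.β - p → ∀ (s : Fin D.N) (ℓ : ℝ), 16 * (q * D.β - p) ≤ ℓ →
    ℓ ≤ 1 / (8 * q) →
    D.g (D.h (D.crit s)) - D.g (D.h (D.crit s) - ℓ) ≤
      Q * (D.g (D.h (D.crit s)) - D.g (D.h (D.crit s) - 2 * (q * D.β - p))) := by
  have K0 := K₀_pos (D := D)
  have K1 := one_le_K₀ (D := D)
  have gm := g_mono hs
  set K := D.K₀ ^ 2 with hKd
  have hK1 : 1 ≤ K := one_le_pow₀ K1
  have hK0 : 0 < K := by linarith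
  set c₀ : ℝ := 1 / (D.K₀ ^ 2 * (1 + K) ^ 2) with hc₀
  have hc₀0 : 0 < c₀ := by positivity
  have hc₀1 : c₀ ≤ 1 := by
    rw [hc₀, div_le_one (by positivity)]
    have : 1 ≤ (1 + K) ^ 2 := one_le_pow₀ (by linarith)
    nlinarith
  set E := Real.exp (D.C * (1 + D.N)) with hE
  have E0 : 0 < E := Real.exp_pos _
  obtain ⟨Q, δ, hQ, hδ, hd4⟩ := D.d4 (c₀ / (2 * E)) (by positivity)
  obtain ⟨δ', hδ', hsm⟩ := g_small hs hδ
  obtain ⟨q₀, hq₀⟩ := exists_nat_gt (1 / δ')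
  refine ⟨Q, by linarith, q₀ + 2, fun q p hqq hc h0 s ℓ hℓ hℓq => ?_⟩
  have hq : 0 < q := by omega
  have hq' : (0 : ℝ) < q := by positivity
  have hq2 : (2 : ℝ) ≤ q := by exact_mod_cast (by omega : 2 ≤ q)
  have hqi : 1 / (q : ℝ) ≤ δ' := by
    rw [div_le_iff₀ hq']; rw [div_lt_iff₀ hδ'] at hq₀
    have : (q₀ : ℝ) ≤ q := by exact_mod_cast (by omega : q₀ ≤ q)
    nlinarith
  have e8 : (1 : ℝ) / (8 * q) = 1 / q / 8 := by field_simp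
  have e4 : (1 : ℝ) / (4 * q) = 1 / q / 4 := by field_simp
  have e2 : (1 : ℝ) / (2 * q) = 1 / q / 2 := by field_simp
  have hi0 : (0 : ℝ) < 1 / q := by positivity
  have hi1 : 1 / (q : ℝ) ≤ 1 / 2 := one_div_le_one_div_of_le (by norm_num) hq2
  set θ := q * D.β - p with hθ
  have hθ1 : θ ≤ 1 / (2 * q) := by linarith
  have hcmp : D.Cmp θ := cmp_T hs hq hc h0 hθ1 (by linarith)
  set σ := D.h (D.crit s) with hσ
  have gσ : D.g σ = D.crit s := g_h hs _
  by_contra hcon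
  push Not at hcon
  -- the two intervals
  have hpair : ∀ x ∈ Icc (D.g (σ - ℓ - 2 * θ)) (D.g (σ - ℓ)), ∀ y ∈ Icc (D.g (σ - 2 * θ)) (D.g σ),
      PairBound D.F^[q] (c₀ / (2 * E) * E) x y := by
    intro x hx y hy
    have hxy : x < y := lt_of_le_of_lt hx.2 (lt_of_lt_of_le (gm (by linarith)) hy.1)
    have b1 : D.g σ - D.g (σ - ℓ - 2 * θ) ≤ δ := hsm _ _ (by linarith) (by linarith)
    have b2 : D.crit s - x ≤ δ := by rw [← gσ]; linarith [hx.1]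
    have b3 : 0 ≤ D.crit s - y := by rw [← gσ]; linarith [hy.2]
    have step1 : PairBound D.F (c₀ / (2 * E)) x y := by
      apply hd4 s x y
      · rw [abs_sub_comm, abs_of_nonneg (by linarith)]; exact b2
      · rw [abs_sub_comm y, abs_sub_comm x, abs_of_nonneg b3, abs_of_nonneg (by linarith), ← gσ]
        have := mul_le_mul_of_nonneg_left (by linarith [hy.1] : D.g σ - y ≤ D.g σ - D.g (σ - 2 * θ))
          (by linarith : (0 : ℝ) ≤ Q)
        linarith [hx.2]
      · nlinarith
    obtain ⟨q', rfl⟩ : ∃ q', q = q' + 1 := ⟨q - 1, by omega⟩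
    have hFx : D.F x < D.F y := D.mono hxy
    have hhd : D.h (D.F y) - D.h (D.F x) ≤ 1 / (4 * ((q' + 1 : ℕ) : ℝ)) := by
      rw [D.h_F, D.h_F]
      have k1 := D.h_mono hx.1
      have k2 := D.h_mono hy.2
      rw [h_g] at k1 k2
      linarith
    have step2 : PairBound D.F^[q'] E (D.F x) (D.F y) := by
      refine D.pair_iter_nu (a := D.F x) (d := D.F y) ?_ le_rfl hFx le_rfl
        (D.le_add_one_of_h (by linarith))
      have := sum_nu_le_q hq hc h0 hθ1 0 hFx.le (by simpa using hhd)
      refine le_trans (Finset.sum_le_sum_of_subset_of_nonneg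
        (Finset.range_mono (Nat.le_succ q')) ?_) (this.trans (le_of_eq (by push_cast; ring)))
      intro k _ _
      exact D.nu_nonneg ((D.iter_mono k).monotone hFx.le)
    rw [Function.iterate_succ]
    exact step1.comp D.diff (D.iter_diff q') (D.iter_mono q').monotone D.mono hxy.ne step2
  have up := lam_le_of_pair (D.iter_diff q) (D.iter_mono q)
    (gm.monotone (by linarith) : D.g (σ - ℓ - 2 * θ) ≤ D.g (σ - ℓ))
    (gm (by linarith) : D.g (σ - ℓ) < D.g (σ - 2 * θ))
    (gm.monotone (by linarith) : D.g (σ - 2 * θ) ≤ D.g σ) hpair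
  rw [← lam_T (p := p), T_g hs, T_g hs, T_g hs, T_g hs, ← hθ] at up
  rw [lam_eq (gm.monotone (by linarith)) (gm (by linarith)) (gm.monotone (by linarith)),
    lam_eq (gm.monotone (by linarith)) (gm (by linarith)) (gm.monotone (by linarith))] at up
  -- comparability
  set A := D.g (σ - ℓ) - D.g (σ - ℓ - 2 * θ) with hA
  set B := D.g σ - D.g (σ - 2 * θ) with hB
  set G := D.g (σ - 2 * θ) - D.g (σ - ℓ) with hG
  set A' := D.g (σ - ℓ + θ) - D.g (σ - ℓ - 2 * θ + θ) with hA'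
  set B' := D.g (σ + θ) - D.g (σ - 2 * θ + θ) with hB'
  set G' := D.g (σ - 2 * θ + θ) - D.g (σ - ℓ + θ) with hG'
  set W := D.g σ - D.g (σ - ℓ - 2 * θ) with hW
  set W' := D.g (σ + θ) - D.g (σ - ℓ - 2 * θ + θ) with hW'
  have A0 : 0 < A := sub_pos.2 (gm (by linarith))
  have B0 : 0 < B := sub_pos.2 (gm (by linarith))
  have G0 : 0 < G := sub_pos.2 (gm (by linarith))
  have A0' : 0 < A' := sub_pos.2 (gm (by linarith))
  have B0' : 0 < B' := sub_pos.2 (gm (by linarith))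
  have G0' : 0 < G' := sub_pos.2 (gm (by linarith))
  have W0 : 0 < W := sub_pos.2 (gm (by linarith))
  have W0' : 0 < W' := sub_pos.2 (gm (by linarith))
  have cA : A ≤ D.K₀ * A' := by
    have := (hcmp (σ - ℓ - 2 * θ)).2
    rwa [show σ - ℓ - 2 * θ + 2 * θ = σ - ℓ by ring,
      show σ - ℓ - 2 * θ + 3 * θ = σ - ℓ + θ by ring] at this
  have cB : B ≤ D.K₀ * B' := by
    have := (hcmp (σ - 2 * θ)).2
    rwa [show σ - 2 * θ + 2 * θ = σ by ring, show σ - 2 * θ + 3 * θ = σ + θ by ring] at this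
  have cG : G' ≤ (1 + K) * G := by
    have k1 := (hcmp.adj' (a := σ - 4 * θ) (b := σ - 2 * θ) (c := σ) (by ring) (by ring)).1
    have k2 := gm.monotone (by linarith : σ - ℓ ≤ σ - 4 * θ)
    have k3 := gm.monotone (by linarith : σ - 2 * θ + θ ≤ σ)
    have k4 := gm.monotone (by linarith : σ - ℓ ≤ σ - ℓ + θ)
    have k5 : K * (D.g (σ - 2 * θ) - D.g (σ - 4 * θ)) ≤ K * G :=
      mul_le_mul_of_nonneg_left (by linarith) hK0.le
    linarith
  have cW : W' ≤ (1 + K) * W := by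
    have k1 := (hcmp.adj' (a := σ - 2 * θ) (b := σ) (c := σ + 2 * θ) (by ring) (by ring)).1
    have k2 := gm.monotone (by linarith : σ - ℓ - 2 * θ ≤ σ - 2 * θ)
    have k3 := gm.monotone (by linarith : σ + θ ≤ σ + 2 * θ)
    have k4 := gm.monotone (by linarith : σ - ℓ - 2 * θ ≤ σ - ℓ - 2 * θ + θ)
    have k5 : K * (D.g σ - D.g (σ - 2 * θ)) ≤ K * W :=
      mul_le_mul_of_nonneg_left (by linarith) hK0.le
    linarith
  set w := A * B / (G * W) with hw
  have w0 : 0 < w := by positivity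
  have hlow : c₀ * w ≤ A' * B' / (G' * W') := by
    rw [hc₀, hw, div_mul_div_comm, one_mul, div_le_div_iff₀ (by positivity) (by positivity)]
    have m1 : A * B ≤ (D.K₀ * A') * (D.K₀ * B') := mul_le_mul cA cB B0.le (by positivity)
    have m2 : G' * W' ≤ ((1 + K) * G) * ((1 + K) * W) := mul_le_mul cG cW W0'.le (by positivity)
    calc A * B * (G' * W') ≤ ((D.K₀ * A') * (D.K₀ * B')) * (((1 + K) * G) * ((1 + K) * W)) :=
          mul_le_mul m1 m2 (by positivity) (by positivity)
      _ = _ := by ring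
  have l1 := log_one_add_mul_ge hc₀0.le hc₀1 w0.le
  have l2 : Real.log (1 + c₀ * w) ≤ Real.log (1 + A' * B' / (G' * W')) :=
    Real.log_le_log (by positivity) (by linarith)
  have l3 : 0 < Real.log (1 + w) := Real.log_pos (by linarith)
  have e : c₀ / (2 * E) * E = c₀ / 2 := by field_simp
  rw [e] at up
  have l4 := mul_pos hc₀0 l3
  clear_value A B G A' B' G' W W' w
  clear cA cB cG cW hcmp hpair hlow hsm hd4
  linarith

end CData

namespace CData

variable {D : CData}

set_option maxHeartbeats 1600000 in
/-- If the window next to a critical point avoids critical points during time `q`, then the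
first return is contracting for the cross-ratio kernel there. -/
lemma exists_contracting (hs : StrictMono D.h) : ∃ q₀ : ℕ, ∀ (q : ℕ) (p : ℤ), q₀ ≤ q →
    IsCoprime (q : ℤ) p → 0 < q * D.β - p → q * D.β - p ≤ 1 / (2 * q) →
    ∀ (s : Fin D.N) (ℓ θ : ℝ), 0 < θ → ℓ ≤ 1 / q →
    (∀ i < q, ∀ t (k : ℤ), D.h (D.crit t) + k ∉
      Ioo (D.h (D.crit s) - ℓ + i * D.β) (D.h (D.crit s) - θ + i * D.β)) →
    ∀ x y, D.g (D.h (D.crit s) - ℓ) ≤ x → x < y → y ≤ D.g (D.h (D.crit s) - θ) →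
      PairBound D.F^[q] 1 x y := by
  have gm := g_mono hs
  obtain ⟨C₂, δ₂, hδ₂, hd2⟩ := D.d2
  obtain ⟨κ, δ₃, hκ, hδ₃, hd3⟩ := D.d3
  obtain ⟨C₅, δ₅, hδ₅, hd5⟩ := D.d5
  have KT0 := KT_pos (D := D)
  set B : ℝ := max C₂ 0 * (D.KT * max C₅ 0) ^ 2 with hB
  have B0 : 0 ≤ B := by positivity
  set V : ℝ := 16 * (1 + D.N) with hV
  have V0 : 0 < V := by positivity
  obtain ⟨δa, hδa, hsa⟩ := g_small hs (show (0 : ℝ) < min δ₂ (min δ₃ δ₅) by positivity)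
  obtain ⟨δb, hδb, hsb⟩ := g_small hs (show (0 : ℝ) < κ / ((1 + B) * V) by positivity)
  obtain ⟨q₀, hq₀⟩ := exists_nat_gt (4 / min δa δb)
  refine ⟨q₀ + 13, fun q p hqq hc h0 h1 s ℓ θ hθ hℓq hfree x y hx hxy hy => ?_⟩
  have hq : 0 < q := by omega
  have hq12 : 12 < q := by omega
  have hq' : (0 : ℝ) < q := by positivity
  have h4q : 4 / (q : ℝ) ≤ min δa δb := by
    rw [div_le_iff₀ hq']; rw [div_lt_iff₀ (by positivity)] at hq₀
    have : (q₀ : ℝ) ≤ q := by exact_mod_cast (by omega : q₀ ≤ q)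
    have : 0 < min δa δb := by positivity
    nlinarith
  have e4 : 4 / (q : ℝ) = 4 * (1 / q) := by ring
  have hi0 : (0 : ℝ) < 1 / q := by positivity
  have h4a := h4q.trans (min_le_left _ _)
  have h4b := h4q.trans (min_le_right _ _)
  set σ := D.h (D.crit s) with hσ
  have gσ : D.g σ = D.crit s := g_h hs _
  set u := D.h x with hu
  set v := D.h y with hv
  have gu : D.g u = x := g_h hs _
  have gv : D.g v = y := g_h hs _
  have huv : u < v := hs hxy
  have hul : σ - ℓ ≤ u := by
    have := D.h_mono hx; rwa [h_g] at this
  have hvl : v ≤ σ - θ := by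
    have := D.h_mono hy; rwa [h_g] at this
  have hxc : x < D.crit s := by rw [← gσ, ← gu]; exact gm (by linarith)
  have hyc : y < D.crit s := by rw [← gσ, ← gv]; exact gm (by linarith)
  set ρ := (y - x) / (x - D.crit s) with hρ
  have ax : |x - D.crit s| = D.crit s - x := by rw [abs_sub_comm, abs_of_pos (by linarith)]
  have ay : |y - D.crit s| = D.crit s - y := by rw [abs_sub_comm, abs_of_pos (by linarith)]
  have hsx : D.crit s - x ≤ min δ₂ (min δ₃ δ₅) := by
    rw [← gσ, ← gu]; exact hsa _ _ (by linarith) (by linarith)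
  have hx3 : |x - D.crit s| ≤ δ₃ := by
    rw [ax]; exact hsx.trans ((min_le_right _ _).trans (min_le_left _ _))
  have hx5 : |x - D.crit s| ≤ δ₅ := by
    rw [ax]; exact hsx.trans ((min_le_right _ _).trans (min_le_right _ _))
  have hlt : |y - D.crit s| < |x - D.crit s| := by rw [ax, ay]; linarith
  have hsg : 0 ≤ (x - D.crit s) * (y - D.crit s) := by nlinarith
  have P0 := hd3 s x y hx3 hlt hsg
  have P5 := hd5 s x y hx5 hlt hsg
  have hFxy : D.F x < D.F y := D.mono hxy
  have hFxc : D.F x < D.F (D.crit s) := D.mono hxc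
  rw [ax, abs_of_pos (sub_pos.2 hFxy), abs_of_pos (sub_pos.2 hxy),
    abs_of_pos (sub_pos.2 hFxc)] at P5
  have hρ' : |ρ| = (y - x) / (D.crit s - x) := by
    rw [hρ, abs_div, ax, abs_of_pos (sub_pos.2 hxy)]
  have P5' : (D.F y - D.F x) / (D.F (D.crit s) - D.F x) ≤ max C₅ 0 * |ρ| := by
    rw [hρ', ← mul_div_assoc, div_le_div_iff₀ (by linarith) (by linarith)]
    refine P5.trans ?_
    apply mul_le_mul_of_nonneg_right _ (by linarith)
    exact mul_le_mul_of_nonneg_right (le_max_left _ _) (by linarith)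
  -- the windows
  set X : ℕ → ℝ := fun i => D.g (σ + i * D.β) - D.g (σ - 4 / q + i * D.β) with hX
  have X0 : ∀ i, 0 < X i := fun i => sub_pos.2 (gm (by linarith))
  have ix : ∀ i : ℕ, D.F^[i] x = D.g (u + i * D.β) := fun i => by rw [hu, ← iter_g hs, gu]
  have iy : ∀ i : ℕ, D.F^[i] y = D.g (v + i * D.β) := fun i => by rw [hv, ← iter_g hs, gv]
  have len : ∀ i, 1 ≤ i → i ≤ q → D.F^[i] y - D.F^[i] x ≤ D.KT * max C₅ 0 * |ρ| * X i := by
    intro i hi1 hiq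
    have tr := transport hs hq12 hc h0 h1 (σ := σ) (by linarith) huv.le (by linarith) hi1 hiq
    rw [← ix, ← iy, ← ix, ← iy] at tr
    rw [← div_le_iff₀ (X0 i)]
    refine tr.trans ?_
    rw [mul_assoc]
    apply mul_le_mul_of_nonneg_left _ KT0.le
    refine le_trans ?_ P5'
    simp only [Function.iterate_one]
    apply div_le_div_of_nonneg_left (by linarith) (by linarith)
    have z1 : D.g (σ + (1 : ℕ) * D.β) = D.F (D.crit s) := by
      rw [← iter_g hs, gσ, Function.iterate_one]
    have z2 : D.g (σ - 4 / q + (1 : ℕ) * D.β) ≤ D.F x := by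
      have := ix 1
      rw [Function.iterate_one] at this
      rw [this]; exact gm.monotone (by linarith)
    rw [← z1]; exact sub_le_sub_left z2 _
  have Xs : ∑ i ∈ Finset.range q, X i ≤ V := by
    have := sum_nu_le_q hq hc h0 h1 15 (x := D.g (σ - 4 / q)) (y := D.g σ)
      (gm.monotone (by linarith)) (by
        rw [h_g, h_g]; push_cast; apply le_of_eq; field_simp; norm_num)
    refine le_trans (Finset.sum_le_sum fun i _ => ?_) (this.trans (le_of_eq ?_))
    · refine le_trans (le_of_eq ?_) (D.sub_le_nu _ _)
      rw [iter_g hs, iter_g hs]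
    · rw [hV]; push_cast; ring
  have Xm : ∀ i, X i ≤ κ / ((1 + B) * V) := fun i => hsb _ _ (by linarith) (by linarith)
  have X2 : ∑ i ∈ Finset.range q, X i ^ 2 ≤ κ / (1 + B) := by
    calc ∑ i ∈ Finset.range q, X i ^ 2 ≤ ∑ i ∈ Finset.range q, κ / ((1 + B) * V) * X i := by
          apply Finset.sum_le_sum; intro i _
          rw [sq]; exact mul_le_mul_of_nonneg_right (Xm i) (X0 i).le
      _ = κ / ((1 + B) * V) * ∑ i ∈ Finset.range q, X i := by rw [Finset.mul_sum]
      _ ≤ κ / ((1 + B) * V) * V := by gcongr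
      _ = κ / (1 + B) := by field_simp
  set e : ℕ → ℝ := fun i => if i = 0 then -(κ * ρ ^ 2) else B * ρ ^ 2 * X i ^ 2 with he
  have main := D.pair_iter (n := q) hxy.ne e ?_
  · refine main.mono ?_
    rw [Real.exp_le_one_iff]
    have : ∑ i ∈ Finset.range q, e i ≤ -(κ * ρ ^ 2) + ∑ i ∈ Finset.range q, B * ρ ^ 2 * X i ^ 2 := by
      obtain ⟨q', rfl⟩ : ∃ q', q = q' + 1 := ⟨q - 1, by omega⟩
      rw [Finset.sum_range_succ', Finset.sum_range_succ']
      have : 0 ≤ B * ρ ^ 2 * X 0 ^ 2 := by positivity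
      simp only [he, Nat.add_eq_zero_iff, one_ne_zero, and_false, if_false, if_true]
      linarith
    rw [← Finset.mul_sum] at this
    have k1 := mul_le_mul_of_nonneg_left X2 (show 0 ≤ B * ρ ^ 2 by positivity)
    have k2 : B * ρ ^ 2 * (κ / (1 + B)) ≤ κ * ρ ^ 2 := by
      rw [← mul_div_assoc, div_le_iff₀ (by linarith)]
      have : 0 ≤ κ * ρ ^ 2 := by positivity
      nlinarith
    linarith
  · intro i hi
    rcases Nat.eq_zero_or_pos i with rfl | hi0'
    · simpa [he] using P0
    · have hlen : D.F^[i] y - D.F^[i] x ≤ min δ₂ (min δ₃ δ₅) := by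
        rw [ix, iy]; exact hsa _ _ (by linarith) (by linarith)
      have hpos := D.iter_mono i hxy
      refine (hd2 _ _ hpos (hlen.trans (min_le_left _ _)) ?_).mono ?_
      · rintro t k ⟨m1, m2⟩
        apply hfree i hi t k
        rw [← hs.lt_iff_lt, D.h_iter, D.h_add_int] at m1
        rw [← hs.lt_iff_lt, D.h_iter, D.h_add_int] at m2
        exact ⟨by linarith, by linarith⟩
      · apply Real.exp_le_exp.2
        simp only [he, hi0'.ne', if_false]
        have l1 := len i hi0' hi.le
        have l2 : (D.F^[i] y - D.F^[i] x) ^ 2 ≤ (D.KT * max C₅ 0 * |ρ| * X i) ^ 2 :=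
          pow_le_pow_left₀ (by linarith) l1 2
        calc C₂ * (D.F^[i] y - D.F^[i] x) ^ 2 ≤ max C₂ 0 * (D.F^[i] y - D.F^[i] x) ^ 2 := by
              gcongr; exact le_max_left _ _
          _ ≤ max C₂ 0 * (D.KT * max C₅ 0 * |ρ| * X i) ^ 2 := by gcongr
          _ = B * ρ ^ 2 * X i ^ 2 := by rw [hB, mul_pow, mul_pow _ |ρ|, sq_abs]; ring

end CData

lemma half_le_log_one_add {u : ℝ} (h0 : 0 ≤ u) (h1 : u ≤ 1) : u / 2 ≤ Real.log (1 + u) := by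
  have h := Real.one_sub_inv_le_log_of_pos (x := 1 + u) (by linarith)
  refine le_trans ?_ h
  have : 1 - (1 + u)⁻¹ = u / (1 + u) := by field_simp; ring
  rw [this, div_le_div_iff₀ (by norm_num) (by linarith)]
  nlinarith

/-- Summing cross-ratios over many translates forces one of two long pieces to be short. -/
lemma exists_short_piece {G : ℝ → ℝ} (hG : StrictMono G) {θ s₀ c : ℝ} (hθ : 0 < θ) {J : ℕ}
    (hJ : 1 ≤ J) (hc : 0 < c) (hR : c * (G s₀ - G (s₀ - 8 * J * θ)) ≤ G s₀ - G (s₀ - 2 * θ))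
    (hstep : ∀ a b c d, s₀ - 8 * J * θ ≤ a → a ≤ b → b < c → c ≤ d → d + θ ≤ s₀ →
      lam (G (a + θ)) (G (b + θ)) (G (c + θ)) (G (d + θ)) ≤ lam (G a) (G b) (G c) (G d)) :
    ∃ a, s₀ - 6 * J * θ ≤ a ∧ a ≤ s₀ - 4 * J * θ ∧
      G (a + 2 * J * θ) - G a ≤
        (2 / c + 2) * (Real.log (1 + J) / J) * (G s₀ - G (s₀ - 8 * J * θ)) := by
  have J1 : (1 : ℝ) ≤ J := by exact_mod_cast hJ
  have J0 : (0 : ℝ) < J := by linarith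
  have Jθ : 0 < J * θ := by positivity
  have Jθ' : θ ≤ J * θ := by nlinarith
  have iter : ∀ n : ℕ, ∀ a b c d, s₀ - 8 * J * θ ≤ a → a ≤ b → b < c → c ≤ d →
      d + n * θ ≤ s₀ → lam (G (a + n * θ)) (G (b + n * θ)) (G (c + n * θ)) (G (d + n * θ)) ≤
        lam (G a) (G b) (G c) (G d) := by
    intro n
    induction n with
    | zero => intro a b c d _ _ _ _ _; simp
    | succ n ih =>
      intro a b c d h1 h2 h3 h4 h5
      push_cast at h5 ⊢
      have hn : (0 : ℝ) ≤ n * θ := by positivity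
      have k1 := ih a b c d h1 h2 h3 h4 (by linarith)
      have k2 := hstep (a + n * θ) (b + n * θ) (c + n * θ) (d + n * θ) (by linarith) (by linarith)
        (by linarith) (by linarith) (by linarith)
      have e : ∀ x : ℝ, x + (n + 1) * θ = x + n * θ + θ := fun x => by ring
      rw [e, e, e, e]
      linarith
  set Y := G s₀ - G (s₀ - 8 * J * θ) with hY
  set L := G (s₀ - 4 * J * θ) - G (s₀ - 6 * J * θ) with hL
  set M := G (s₀ - 2 * J * θ) - G (s₀ - 4 * J * θ) with hM
  set R := G s₀ - G (s₀ - 2 * θ) with hRd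
  have Y0 : 0 < Y := sub_pos.2 (hG (by linarith))
  have L0 : 0 < L := sub_pos.2 (hG (by linarith))
  have M0 : 0 < M := sub_pos.2 (hG (by linarith))
  have R0 : 0 < R := sub_pos.2 (hG (by linarith))
  set Λ : ℝ := lam (G (s₀ - 6 * J * θ)) (G (s₀ - 4 * J * θ)) (G (s₀ - 2 * θ)) (G s₀) with hΛ
  have sum : ∀ n : ℕ, n ≤ J → n * Λ ≤ lam (G (s₀ - 8 * J * θ)) (G (s₀ - 4 * J * θ))
      (G (s₀ - 2 * n * θ)) (G s₀) := by
    intro n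
    induction n with
    | zero => intro _; simp [lam]
    | succ n ih =>
      intro hn
      have ih := ih (by omega)
      have hn' : (n : ℝ) + 1 ≤ J := by exact_mod_cast hn
      have hnθ : (0 : ℝ) ≤ n * θ := by positivity
      have hnθ' : n * θ + θ ≤ J * θ := by nlinarith
      rw [lam_add_right _ _ _ (G (s₀ - 2 * n * θ))]
      have k := iter (2 * n) (s₀ - 6 * J * θ - (2 * n : ℕ) * θ) (s₀ - 4 * J * θ - (2 * n : ℕ) * θ)
        (s₀ - 2 * θ - (2 * n : ℕ) * θ) (s₀ - (2 * n : ℕ) * θ) (by push_cast; linarith)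
        (by linarith) (by linarith) (by linarith) (by linarith)
      simp only [sub_add_cancel] at k
      rw [← hΛ] at k
      have k' : lam (G (s₀ - 6 * J * θ - (2 * n : ℕ) * θ)) (G (s₀ - 4 * J * θ - (2 * n : ℕ) * θ))
          (G (s₀ - 2 * θ - (2 * n : ℕ) * θ)) (G (s₀ - (2 * n : ℕ) * θ)) ≤
          lam (G (s₀ - 8 * J * θ)) (G (s₀ - 4 * J * θ)) (G (s₀ - 2 * ((n + 1 : ℕ) : ℝ) * θ))
            (G (s₀ - 2 * n * θ)) := by
        apply lam_mono
        · exact hG.monotone (by push_cast; linarith)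
        · exact hG.monotone (by linarith)
        · exact hG.monotone (by push_cast; linarith)
        · exact hG (by push_cast; linarith)
        · exact hG.monotone (by push_cast; linarith)
        · exact hG.monotone (by linarith)
        · exact hG.monotone (by push_cast; linarith)
      push_cast at k' ⊢
      push_cast at k
      linarith
  have hsum := sum J le_rfl
  have up : lam (G (s₀ - 8 * J * θ)) (G (s₀ - 4 * J * θ)) (G (s₀ - 2 * J * θ)) (G s₀) ≤
      Real.log (1 + Y / M) := by
    rw [lam_eq (hG.monotone (by linarith)) (hG (by linarith)) (hG.monotone (by linarith)), ← hM,
      ← hY]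
    have a1 : 0 < G (s₀ - 4 * J * θ) - G (s₀ - 8 * J * θ) := sub_pos.2 (hG (by linarith))
    have a2 : 0 < G s₀ - G (s₀ - 2 * J * θ) := sub_pos.2 (hG (by linarith))
    have a3 : G (s₀ - 4 * J * θ) ≤ G s₀ := hG.monotone (by linarith)
    have a4 : G (s₀ - 8 * J * θ) ≤ G (s₀ - 2 * J * θ) := hG.monotone (by linarith)
    apply Real.log_le_log (by positivity)
    rw [add_le_add_iff_left, div_le_div_iff₀ (by positivity) M0]
    have : (G (s₀ - 4 * J * θ) - G (s₀ - 8 * J * θ)) * (G s₀ - G (s₀ - 2 * J * θ)) ≤ Y * Y :=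
      mul_le_mul (by linarith) (by linarith) a2.le Y0.le
    nlinarith
  have low : c * (L / Y) / 2 ≤ Λ := by
    have b1 : L * R / (Y * Y) ≤ 1 := by
      rw [div_le_one (by positivity)]
      have a3 : G (s₀ - 4 * J * θ) ≤ G s₀ := hG.monotone (by linarith)
      have a4 : G (s₀ - 8 * J * θ) ≤ G (s₀ - 2 * θ) := hG.monotone (by linarith)
      have a5 : G (s₀ - 8 * J * θ) ≤ G (s₀ - 6 * J * θ) := hG.monotone (by linarith)
      exact mul_le_mul (by linarith) (by linarith) R0.le Y0.le
    have b2 := half_le_log_one_add (u := L * R / (Y * Y)) (by positivity) b1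
    have b3 : c * (L / Y) ≤ L * R / (Y * Y) := by
      rw [← mul_div_assoc, div_le_div_iff₀ Y0 (by positivity)]
      have := mul_le_mul_of_nonneg_left hR (by positivity : 0 ≤ L * Y)
      nlinarith
    have b4 : Real.log (1 + L * R / (Y * Y)) ≤ Λ := by
      rw [hΛ, lam_eq (hG.monotone (by linarith)) (hG (by linarith)) (hG.monotone (by linarith)),
        ← hL, ← hRd]
      have a1 : 0 < G (s₀ - 2 * θ) - G (s₀ - 4 * J * θ) := sub_pos.2 (hG (by linarith))
      have a2 : 0 < G s₀ - G (s₀ - 6 * J * θ) := sub_pos.2 (hG (by linarith))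
      have a3 : G (s₀ - 2 * θ) ≤ G s₀ := hG.monotone (by linarith)
      have a4 : G (s₀ - 8 * J * θ) ≤ G (s₀ - 4 * J * θ) := hG.monotone (by linarith)
      have a5 : G (s₀ - 8 * J * θ) ≤ G (s₀ - 6 * J * θ) := hG.monotone (by linarith)
      apply Real.log_le_log (by positivity)
      rw [add_le_add_iff_left]
      apply div_le_div_of_nonneg_left (by positivity) (by positivity)
      exact mul_le_mul (by linarith) (by linarith) a2.le Y0.le
    linarith
  have tot : J * (c * (L / Y) / 2) ≤ Real.log (1 + Y / M) :=
    le_trans (mul_le_mul_of_nonneg_left low J0.le) (hsum.trans up)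
  have lg : (1 : ℝ) / 2 ≤ Real.log (1 + J) := by
    have := half_le_log_one_add (u := 1) (by norm_num) le_rfl
    exact this.trans (Real.log_le_log (by norm_num) (by linarith))
  by_cases hcase : Y / M ≤ J
  · refine ⟨s₀ - 6 * J * θ, le_rfl, by linarith, ?_⟩
    rw [show s₀ - 6 * J * θ + 2 * J * θ = s₀ - 4 * J * θ by ring, ← hL]
    have t2 : Real.log (1 + Y / M) ≤ Real.log (1 + J) :=
      Real.log_le_log (by positivity) (by linarith)
    have t3 : L ≤ 2 / c * (Real.log (1 + J) / J) * Y := by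
      have t4 : J * (c * (L / Y) / 2) ≤ Real.log (1 + J) := tot.trans t2
      have : J * (c * (L / Y) / 2) * (2 / c / J * Y) ≤ Real.log (1 + J) * (2 / c / J * Y) :=
        mul_le_mul_of_nonneg_right t4 (by positivity)
      calc L = J * (c * (L / Y) / 2) * (2 / c / J * Y) := by field_simp
        _ ≤ _ := this
        _ = _ := by ring
    have : 0 ≤ 2 * (Real.log (1 + J) / J) * Y := by positivity
    nlinarith
  · push Not at hcase
    refine ⟨s₀ - 4 * J * θ, by linarith, le_rfl, ?_⟩
    rw [show s₀ - 4 * J * θ + 2 * J * θ = s₀ - 2 * J * θ by ring, ← hM]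
    rw [lt_div_iff₀ M0] at hcase
    have t1 : M ≤ 1 / J * Y := by
      rw [one_div, inv_mul_eq_div, le_div_iff₀ J0]; linarith
    have t2 : 1 / J * Y ≤ 2 * (Real.log (1 + J) / J) * Y := by
      apply mul_le_mul_of_nonneg_right _ Y0.le
      rw [← mul_div_assoc, div_le_div_iff_of_pos_right J0]; linarith
    have : 0 ≤ 2 / c * (Real.log (1 + J) / J) * Y := by positivity
    nlinarith

namespace CData

variable {D : CData}

set_option maxHeartbeats 1600000 in
/-- The main estimate: when `β` is very close to `p / q`, a family of `q` disjoint arcs carrying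
a definite proportion of the invariant measure has small total length. -/
lemma exists_small_arcs (hs : StrictMono D.h) : ∃ C : ℝ, ∃ q₀ : ℕ, 0 ≤ C ∧
    ∀ (q : ℕ) (p : ℤ), q₀ ≤ q → IsCoprime (q : ℤ) p → 0 < q * D.β - p →
    q * D.β - p ≤ 1 / (128 * (D.N + 1)) / q →
    ∃ a b, a ≤ b ∧ 1 / (128 * (D.N + 1)) / q ≤ D.h b - D.h a ∧ D.h b - D.h a ≤ 1 / (4 * q) ∧
      ∑ i ∈ Finset.range q, (D.F^[i] b - D.F^[i] a) ≤
        C * (q * (q * D.β - p) * Real.log (1 + 1 / (q * (q * D.β - p)))) := by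
  have gm := g_mono hs
  obtain ⟨q₁, hcon⟩ := exists_contracting hs
  obtain ⟨Q, hQ, q₂, hflat⟩ := exists_flat_bound hs
  have K0 := K₀_pos (D := D)
  have KT0 := KT_pos (D := D)
  set c : ℝ := 1 / (Q * D.K₀) with hcd
  have c0 : 0 < c := by positivity
  set N1 : ℝ := D.N + 1 with hN1
  have N11 : 1 ≤ N1 := by rw [hN1]; linarith [(Nat.cast_nonneg D.N : (0 : ℝ) ≤ D.N)]
  refine ⟨D.KT * (16 * N1) * (2 / c + 2) * (256 * N1), q₁ + q₂ + 13, by positivity,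
    fun q p hqq hc h0 hθ1 => ?_⟩
  have hq : 0 < q := by omega
  have hq12 : 12 < q := by omega
  have hq' : (12 : ℝ) < q := by exact_mod_cast hq12
  have hq0 : (0 : ℝ) < q := by linarith
  set θ := q * D.β - p with hθ
  have hi0 : (0 : ℝ) < 1 / q := by positivity
  have hi1 : (1 : ℝ) / q ≤ 1 / 12 := one_div_le_one_div_of_le (by norm_num) hq'.le
  have e8 : (1 : ℝ) / (8 * q) = 1 / q / 8 := by field_simp
  have e4 : (1 : ℝ) / (4 * q) = 1 / q / 4 := by field_simp
  have e2 : (1 : ℝ) / (2 * q) = 1 / q / 2 := by field_simp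
  set ℓ : ℝ := 1 / (8 * N1 * q) with hℓ
  have ℓ0 : 0 < ℓ := by positivity
  have hℓθ : 16 * θ ≤ ℓ := by
    have : 1 / (128 * N1) / (q : ℝ) = ℓ / 16 := by rw [hℓ]; field_simp; norm_num
    linarith
  have hℓN : N1 * ℓ = 1 / q / 8 := by rw [hℓ]; field_simp
  have hℓ8 : ℓ ≤ 1 / q / 8 := by nlinarith
  have hθ2 : θ ≤ 1 / (2 * q) := by linarith
  have hNθ : N1 * θ ≤ 1 / (4 * q) := by nlinarith
  obtain ⟨s, hfree⟩ := exists_free_window hq h0 (by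
    refine le_trans ?_ hNθ
    apply mul_le_mul_of_nonneg_right _ h0.le
    rw [hN1]; linarith)
  rw [← hN1, ← hθ, ← hℓ] at hfree
  have hpair := hcon q p (by omega) hc h0 hθ2 s ℓ θ h0 (by linarith) hfree
  set σ := D.h (D.crit s) with hσ
  have hfl := hflat q p (by omega) hc h0 s ℓ hℓθ (by linarith)
  rw [← hσ, ← hθ] at hfl
  have hcmp : D.Cmp θ := cmp_T hs hq hc h0 hθ2 (by linarith)
  -- the number of steps
  set J : ℕ := ⌊ℓ / (16 * θ)⌋₊ with hJ
  have hJle : (J : ℝ) * (16 * θ) ≤ ℓ := by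
    rw [← le_div_iff₀ (by positivity)]; exact Nat.floor_le (by positivity)
  have hJ1 : 1 ≤ J := by
    apply Nat.le_floor; rw [Nat.cast_one, le_div_iff₀ (by positivity)]; linarith
  have J1 : (1 : ℝ) ≤ J := by exact_mod_cast hJ1
  have J0 : (0 : ℝ) < J := by linarith
  have hJge : ℓ ≤ J * (32 * θ) := by
    have : ℓ / (16 * θ) < J + 1 := Nat.lt_floor_add_one _
    rw [div_lt_iff₀ (by positivity)] at this
    nlinarith
  have hJθ : 0 < J * θ := by positivity
  have hJθ' : θ ≤ J * θ := by nlinarith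
  have hYσ : D.g (σ - ℓ) ≤ D.g (σ - θ - 8 * J * θ) := gm.monotone (by linarith)
  have hY1 : D.g (σ - θ) ≤ D.g σ := gm.monotone (by linarith)
  obtain ⟨a, ha1, ha2, hS⟩ := exists_short_piece gm (s₀ := σ - θ) h0 hJ1 c0 (by
    have k1 := (hcmp (σ - 3 * θ)).1
    rw [show σ - 3 * θ + 3 * θ = σ by ring, show σ - 3 * θ + θ = σ - 2 * θ by ring,
      show σ - 3 * θ + 2 * θ = σ - θ by ring] at k1
    rw [show σ - θ - 2 * θ = σ - 3 * θ by ring, hcd, div_mul_eq_mul_div, one_mul,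
      div_le_iff₀ (by positivity)]
    have k2 := mul_le_mul_of_nonneg_left k1 hQ.le
    calc _ ≤ D.g σ - D.g (σ - ℓ) := by linarith
      _ ≤ _ := hfl
      _ ≤ _ := k2
      _ = _ := by ring) (by
    intro a b c d h1 h2 h3 h4 h5
    have := lam_le_of_pair (D.iter_diff q) (D.iter_mono q) (gm.monotone h2) (gm h3)
      (gm.monotone h4) (K := 1) (fun x hx y hy => hpair x y
        (le_trans (gm.monotone (by linarith)) hx.1) (lt_of_le_of_lt hx.2 (lt_of_lt_of_le (gm h3) hy.1))
        (hy.2.trans (gm.monotone (by linarith))))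
    rw [← lam_T (p := p), T_g hs, T_g hs, T_g hs, T_g hs, ← hθ] at this
    linarith)
  set Y := D.g (σ - θ) - D.g (σ - θ - 8 * J * θ) with hY
  have e44 : 4 / (q : ℝ) = 4 * (1 / q) := by ring
  refine ⟨D.g a, D.g (a + 2 * J * θ), gm.monotone (by linarith), ?_, ?_, ?_⟩
  · rw [h_g, h_g]
    have : 1 / (128 * N1) / (q : ℝ) = ℓ / 16 := by rw [hℓ]; field_simp; norm_num
    linarith
  · rw [h_g, h_g]; linarith
  set X : ℕ → ℝ := fun i => D.g (σ + i * D.β) - D.g (σ - 4 / q + i * D.β) with hX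
  have X0 : ∀ i, 0 < X i := fun i => sub_pos.2 (gm (by linarith))
  have Xs : ∑ i ∈ Finset.range q, X i ≤ 16 * N1 := by
    have := sum_nu_le_q hq hc h0 hθ2 15 (x := D.g (σ - 4 / q)) (y := D.g σ)
      (gm.monotone (by linarith)) (by
        rw [h_g, h_g]; push_cast; apply le_of_eq; field_simp; norm_num)
    refine le_trans (Finset.sum_le_sum fun i _ => ?_) (this.trans (le_of_eq ?_))
    · refine le_trans (le_of_eq ?_) (D.sub_le_nu _ _)
      rw [iter_g hs, iter_g hs]
    · rw [hN1]; push_cast; ring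
  set r : ℝ := (2 / c + 2) * (Real.log (1 + J) / J) with hr
  have lg0 : 0 ≤ Real.log (1 + J) := Real.log_nonneg (by linarith)
  have r0 : 0 ≤ r := by positivity
  have each : ∀ i ∈ Finset.range q, D.F^[i] (D.g (a + 2 * J * θ)) - D.F^[i] (D.g a) ≤
      D.KT * r * X i := by
    intro i hi
    have tr := transport hs hq12 hc h0 hθ2 (σ := σ) (u := a) (v := a + 2 * J * θ) (by linarith)
      (by linarith) (by linarith) (Nat.zero_le i) (Finset.mem_range.1 hi).le
    rw [← iter_g hs i (a + 2 * J * θ), ← iter_g hs i a] at tr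
    rw [← div_le_iff₀ (X0 i)]
    refine tr.trans ?_
    apply mul_le_mul_of_nonneg_left _ KT0.le
    simp only [Nat.cast_zero, zero_mul, add_zero]
    have hY0 : Y ≤ D.g σ - D.g (σ - 4 / q) := by
      have : D.g (σ - 4 / q) ≤ D.g (σ - θ - 8 * J * θ) := gm.monotone (by linarith)
      linarith
    rw [div_le_iff₀ (sub_pos.2 (gm (by linarith)))]
    exact hS.trans (mul_le_mul_of_nonneg_left hY0 r0)
  refine (Finset.sum_le_sum each).trans ?_
  rw [← Finset.mul_sum]
  have hqθ : 0 < q * θ := by positivity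
  have f1 : 1 / (J : ℝ) ≤ 256 * N1 * (q * θ) := by
    rw [div_le_iff₀ J0]
    have : ℓ * (8 * N1 * q) = 1 := by rw [hℓ]; field_simp
    have k := mul_le_mul_of_nonneg_right hJge (show 0 ≤ 8 * N1 * (q : ℝ) by positivity)
    rw [this] at k
    linarith
  have f2 : Real.log (1 + J) ≤ Real.log (1 + 1 / (q * θ)) := by
    apply Real.log_le_log (by linarith)
    rw [add_le_add_iff_left, le_div_iff₀ hqθ]
    have : ℓ * q ≤ 1 := by
      have := mul_le_mul_of_nonneg_right hℓ8 hq0.le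
      have h2 : 1 / (q : ℝ) / 8 * q = 1 / 8 := by field_simp
      linarith
    have k := mul_le_mul_of_nonneg_right hJle hq0.le
    have k2 : 0 ≤ J * (q * θ) := by positivity
    have k3 : (J : ℝ) * (16 * θ) * q = 16 * (J * (q * θ)) := by ring
    rw [k3] at k
    linarith
  have f3 : Real.log (1 + J) / J ≤ 256 * N1 * (q * θ * Real.log (1 + 1 / (q * θ))) := by
    calc Real.log (1 + J) / J = 1 / J * Real.log (1 + J) := by ring
      _ ≤ 256 * N1 * (q * θ) * Real.log (1 + 1 / (q * θ)) := by gcongr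
      _ = _ := by ring
  calc D.KT * r * ∑ i ∈ Finset.range q, X i ≤ D.KT * r * (16 * N1) := by gcongr
    _ = D.KT * (16 * N1) * (2 / c + 2) * (Real.log (1 + J) / J) := by rw [hr]; ring
    _ ≤ D.KT * (16 * N1) * (2 / c + 2) *
        (256 * N1 * (q * θ * Real.log (1 + 1 / (q * θ)))) := by gcongr
    _ = _ := by ring

end CData

lemma nonneg_of_deriv_nonneg {f f' : ℝ → ℝ} (hf : ∀ t, 0 ≤ t → HasDerivAt f (f' t) t)
    (h' : ∀ t, 0 ≤ t → 0 ≤ f' t) (h0 : f 0 = 0) {t : ℝ} (ht : 0 ≤ t) : 0 ≤ f t := by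
  have hm : MonotoneOn f (Ici 0) :=
    monotoneOn_of_hasDerivWithinAt_nonneg (convex_Ici 0)
      (fun x hx => (hf x hx).continuousAt.continuousWithinAt)
      (fun x hx => (hf x (interior_subset hx)).hasDerivWithinAt)
      (fun x hx => h' x (interior_subset hx))
  have := hm (mem_Ici.2 le_rfl) ht ht
  rwa [h0] at this

lemma sinh_le_mul_cosh {t : ℝ} (ht : 0 ≤ t) : Real.sinh t ≤ t * Real.cosh t := by
  have := nonneg_of_deriv_nonneg (f := fun t => t * Real.cosh t - Real.sinh t)
    (f' := fun t => t * Real.sinh t) (fun t _ => by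
      refine (((hasDerivAt_id t).mul (Real.hasDerivAt_cosh t)).sub
        (Real.hasDerivAt_sinh t)).congr_deriv ?_
      simp) (fun t ht => mul_nonneg ht (Real.sinh_nonneg_iff.2 ht)) (by simp) ht
  linarith

lemma sinh_cube_le {t : ℝ} (ht : 0 ≤ t) :
    Real.sinh t * Real.cosh t ^ 2 + Real.sinh t ^ 3 / 3 ≤ t * Real.cosh t ^ 3 := by
  have := nonneg_of_deriv_nonneg
    (f := fun t => t * Real.cosh t ^ 3 - Real.sinh t * Real.cosh t ^ 2 - Real.sinh t ^ 3 / 3)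
    (f' := fun t => 3 * (Real.cosh t * Real.sinh t * (t * Real.cosh t - Real.sinh t))) (fun t _ => by
      refine ((((hasDerivAt_id t).mul ((Real.hasDerivAt_cosh t).pow 3)).sub
        ((Real.hasDerivAt_sinh t).mul ((Real.hasDerivAt_cosh t).pow 2))).sub
        (((Real.hasDerivAt_sinh t).pow 3).div_const 3)).congr_deriv ?_
      simp; ring) (fun t ht => by
        have h1 := Real.sinh_nonneg_iff.2 ht
        have h2 := Real.cosh_pos t
        have h3 := sinh_le_mul_cosh ht
        have : 0 ≤ t * Real.cosh t - Real.sinh t := by linarith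
        positivity) (by simp) ht
  linarith

lemma cosh_tangent {x y : ℝ} (hx : 0 ≤ x) (hy : 0 ≤ y) :
    Real.cosh x + y * Real.sinh x ≤ Real.cosh (x + y) := by
  rw [Real.cosh_add]
  have h1 := Real.one_le_cosh y
  have h2 := Real.self_le_sinh_iff.2 hy
  have h3 := Real.sinh_nonneg_iff.2 hx
  have h4 := Real.cosh_pos x
  nlinarith

lemma sinh_mul_ge {p t : ℝ} (hp : 1 ≤ p) (ht : 0 ≤ t) :
    p * Real.sinh t + p * (p - 1) * (t * Real.cosh t - Real.sinh t) ≤ Real.sinh (p * t) := by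
  have := nonneg_of_deriv_nonneg
    (f := fun t => Real.sinh (p * t) - p * Real.sinh t -
      p * (p - 1) * (t * Real.cosh t - Real.sinh t))
    (f' := fun t => p * (Real.cosh (p * t) - Real.cosh t - (p - 1) * t * Real.sinh t)) (fun t _ => by
      have e : HasDerivAt (fun t => Real.sinh (p * t)) (Real.cosh (p * t) * p) t := by
        have := ((hasDerivAt_id t).const_mul p).sinh
        simpa using this
      refine ((e.sub ((Real.hasDerivAt_sinh t).const_mul p)).sub
        ((((hasDerivAt_id t).mul (Real.hasDerivAt_cosh t)).sub
        (Real.hasDerivAt_sinh t)).const_mul (p * (p - 1)))).congr_deriv ?_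
      simp; ring) (fun t ht => by
        have h1 := cosh_tangent ht (mul_nonneg (by linarith : 0 ≤ p - 1) ht)
        rw [show t + (p - 1) * t = p * t by ring] at h1
        apply mul_nonneg (by linarith) (by linarith)) (by simp) ht
  linarith

lemma sinh_sq_ge {p t : ℝ} (hp : 1 ≤ p) (ht : 0 ≤ t) :
    p ^ 2 * Real.sinh t ^ 2 * (1 + (p - 1) / 6 * (1 - Real.exp (-(2 * t))) ^ 2) ≤
      Real.sinh (p * t) ^ 2 := by
  have h1 := Real.sinh_nonneg_iff.2 ht
  have h2 := Real.cosh_pos t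
  set T := Real.sinh t / Real.cosh t with hT
  have T0 : 0 ≤ T := by positivity
  have hr : 1 - Real.exp (-(2 * t)) ≤ 2 * T := by
    have e1 : 1 - Real.exp (-(2 * t)) = 2 * Real.sinh t * Real.exp (-t) := by
      rw [Real.sinh_eq, show -(2 * t) = -t + -t by ring, Real.exp_add]
      have : Real.exp t * Real.exp (-t) = 1 := by rw [← Real.exp_add]; simp
      linear_combination -this
    have e2 : Real.exp (-t) * Real.cosh t ≤ 1 := by
      rw [Real.cosh_eq]
      have : Real.exp t * Real.exp (-t) = 1 := by rw [← Real.exp_add]; simp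
      have h3 : Real.exp (-t) ≤ 1 := Real.exp_le_one_iff.2 (by linarith)
      have h4 := Real.exp_pos (-t)
      nlinarith
    rw [e1, hT, mul_assoc, mul_comm (Real.sinh t)]
    rw [← mul_div_assoc 2, le_div_iff₀ h2]
    nlinarith
  have hr0 : 0 ≤ 1 - Real.exp (-(2 * t)) := by
    have : Real.exp (-(2 * t)) ≤ 1 := Real.exp_le_one_iff.2 (by linarith)
    linarith
  have hr2 : (1 - Real.exp (-(2 * t))) ^ 2 ≤ 4 * T ^ 2 := by nlinarith
  have hc : Real.sinh t * T ^ 2 / 3 ≤ t * Real.cosh t - Real.sinh t := by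
    have := sinh_cube_le ht
    rw [hT, div_pow, ← mul_div_assoc, div_div, div_le_iff₀ (by positivity)]
    nlinarith
  have hs := sinh_mul_ge hp ht
  have hlow : p * Real.sinh t * (1 + (p - 1) / 3 * T ^ 2) ≤ Real.sinh (p * t) := by
    have := mul_le_mul_of_nonneg_left hc (mul_nonneg (by linarith : 0 ≤ p) (by linarith : 0 ≤ p - 1))
    nlinarith
  have hp1 : 0 ≤ p - 1 := by linarith
  have hp0 : 0 ≤ p := by linarith
  have hsq := pow_le_pow_left₀ (by positivity) hlow 2
  refine le_trans ?_ hsq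
  rw [mul_pow, mul_pow]
  apply mul_le_mul_of_nonneg_left _ (by positivity)
  have : (p - 1) / 6 * (1 - Real.exp (-(2 * t))) ^ 2 ≤ (p - 1) / 6 * (4 * T ^ 2) := by gcongr
  have : 0 ≤ ((p - 1) / 3 * T ^ 2) ^ 2 := by positivity
  nlinarith

/-- The power map contracts the cross-ratio kernel on each side of `0`. -/
lemma rpow_pair {p a b : ℝ} (hp : 1 < p) (hb : 0 ≤ b) (hab : b ≤ a) (ha : 0 < a) :
    p ^ 2 * (a ^ (p - 1) * b ^ (p - 1)) * (a - b) ^ 2 * (1 + (p - 1) / 6 * ((a - b) / a) ^ 2) ≤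
      (a ^ p - b ^ p) ^ 2 := by
  rcases hb.eq_or_lt with rfl | hb
  · rw [Real.zero_rpow (by linarith)]
    simp only [mul_zero, zero_mul]; positivity
  set t := (Real.log a - Real.log b) / 2 with ht
  set m := (Real.log a + Real.log b) / 2 with hm
  have t0 : 0 ≤ t := by
    have := Real.log_le_log hb hab
    rw [ht]; linarith
  have ea : a = Real.exp (m + t) := by
    rw [show m + t = Real.log a by rw [hm, ht]; ring, Real.exp_log ha]
  have eb : b = Real.exp (m - t) := by
    rw [show m - t = Real.log b by rw [hm, ht]; ring, Real.exp_log hb]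
  have e1 : a - b = 2 * Real.exp m * Real.sinh t := by
    rw [ea, eb, Real.sinh_eq, Real.exp_add, sub_eq_add_neg m, Real.exp_add]; ring
  have e2 : a ^ p - b ^ p = 2 * Real.exp (m * p) * Real.sinh (p * t) := by
    rw [ea, eb, ← Real.exp_mul, ← Real.exp_mul, Real.sinh_eq, add_mul, sub_mul, Real.exp_add,
      sub_eq_add_neg (m * p), Real.exp_add, mul_comm t p]; ring
  have e3 : a ^ (p - 1) * b ^ (p - 1) = Real.exp (m * p) ^ 2 / Real.exp m ^ 2 := by
    rw [ea, eb, ← Real.exp_mul, ← Real.exp_mul, ← Real.exp_add, ← Real.exp_nat_mul,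
      ← Real.exp_nat_mul, ← Real.exp_sub]
    congr 1; push_cast; ring
  have e4 : (a - b) / a = 1 - Real.exp (-(2 * t)) := by
    rw [sub_div, div_self ha.ne', ea, eb, ← Real.exp_sub]; congr 2; ring
  rw [e4, e1, e2, e3]
  have := sinh_sq_ge hp.le t0
  have h0 := Real.exp_pos m
  have k := mul_le_mul_of_nonneg_left this (show 0 ≤ 4 * Real.exp (m * p) ^ 2 by positivity)
  calc _ = 4 * Real.exp (m * p) ^ 2 * (p ^ 2 * Real.sinh t ^ 2 *
        (1 + (p - 1) / 6 * (1 - Real.exp (-(2 * t))) ^ 2)) := by field_simp; ring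
    _ ≤ _ := k
    _ = _ := by ring

lemma rpow_sub_one_mul {p a : ℝ} (ha : 0 < a) : a ^ (p - 1) * a = a ^ p := by
  conv_lhs => rw [← Real.rpow_one a, ← Real.rpow_mul ha.le, one_mul]
  rw [← Real.rpow_add ha]; congr 1; ring

lemma rpow_pair_far {p a b : ℝ} (hp : 1 < p) (hb : 0 ≤ b) (hab : 2 * b ≤ a) (ha : 0 < a) :
    p ^ 2 * (a ^ (p - 1) * b ^ (p - 1)) * (a - b) ^ 2 ≤
      4 * p ^ 2 * (b / a) ^ (p - 1) * (a ^ p - b ^ p) ^ 2 := by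
  have hpow : 0 < a ^ p := Real.rpow_pos_of_pos ha p
  have h1 : b ^ p ≤ a ^ p / 2 := by
    calc b ^ p ≤ (a / 2) ^ p := Real.rpow_le_rpow hb (by linarith) (by linarith)
      _ = a ^ p / 2 ^ p := Real.div_rpow ha.le (by norm_num) p
      _ ≤ a ^ p / 2 := by
        apply div_le_div_of_nonneg_left hpow.le (by norm_num)
        calc (2 : ℝ) = 2 ^ (1 : ℝ) := by simp
          _ ≤ 2 ^ p := Real.rpow_le_rpow_of_exponent_le (by norm_num) hp.le
  have h2 : (a ^ p) ^ 2 ≤ 4 * (a ^ p - b ^ p) ^ 2 := by nlinarith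
  have h3 : (a - b) ^ 2 ≤ a ^ 2 := by nlinarith
  have hap : 0 < a ^ (p - 1) := Real.rpow_pos_of_pos ha _
  have hbp : 0 ≤ b ^ (p - 1) := Real.rpow_nonneg hb _
  have h4 : a ^ (p - 1) * b ^ (p - 1) * a ^ 2 = (b / a) ^ (p - 1) * (a ^ p) ^ 2 := by
    have e := rpow_sub_one_mul (p := p) ha
    rw [Real.div_rpow hb ha.le, ← e]; field_simp
  have h5 : 0 ≤ (b / a) ^ (p - 1) := Real.rpow_nonneg (by positivity) _
  calc _ ≤ p ^ 2 * (a ^ (p - 1) * b ^ (p - 1)) * a ^ 2 := by gcongr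
    _ = p ^ 2 * (a ^ (p - 1) * b ^ (p - 1) * a ^ 2) := by ring
    _ = p ^ 2 * ((b / a) ^ (p - 1) * (a ^ p) ^ 2) := by rw [h4]
    _ ≤ p ^ 2 * ((b / a) ^ (p - 1) * (4 * (a ^ p - b ^ p) ^ 2)) := by gcongr
    _ = _ := by ring

lemma rpow_pair_cross {p a b : ℝ} (hp : 1 < p) (hb : 0 ≤ b) (hab : b ≤ a) :
    p ^ 2 * (a ^ (p - 1) * b ^ (p - 1)) * (a + b) ^ 2 ≤ 4 * p ^ 2 * (a ^ p + b ^ p) ^ 2 := by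
  rcases (hb.trans hab).eq_or_lt with rfl | ha
  · have : b = 0 := le_antisymm hab hb
    subst this
    simp only [add_zero]; rw [zero_pow two_ne_zero, mul_zero]; positivity
  have hap : 0 < a ^ (p - 1) := Real.rpow_pos_of_pos ha _
  have hbp : 0 ≤ b ^ (p - 1) := Real.rpow_nonneg hb _
  have h1 : b ^ (p - 1) ≤ a ^ (p - 1) := Real.rpow_le_rpow hb hab (by linarith)
  have h2 : (a + b) ^ 2 ≤ 4 * a ^ 2 := by nlinarith
  have h3 : 0 ≤ b ^ p := Real.rpow_nonneg hb _
  have h4 : 0 < a ^ p := Real.rpow_pos_of_pos ha p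
  calc _ ≤ p ^ 2 * (a ^ (p - 1) * a ^ (p - 1)) * (4 * a ^ 2) := by gcongr
    _ = 4 * p ^ 2 * (a ^ (p - 1) * a) ^ 2 := by ring
    _ = 4 * p ^ 2 * (a ^ p) ^ 2 := by rw [rpow_sub_one_mul ha]
    _ ≤ _ := by gcongr; linarith

lemma rpow_sub_le {p a b : ℝ} (hp : 1 < p) (hb : 0 ≤ b) (ha : 0 < a) :
    a ^ p - b ^ p ≤ p * a ^ (p - 1) * (a - b) := by
  have h := one_add_mul_self_le_rpow_one_add (s := b / a - 1) (p := p)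
    (by have : 0 ≤ b / a := by positivity
        linarith) hp.le
  rw [show 1 + (b / a - 1) = b / a by ring, Real.div_rpow hb ha.le,
    le_div_iff₀ (Real.rpow_pos_of_pos ha p)] at h
  have e : p * (b / a - 1) * a ^ p = p * a ^ (p - 1) * (b - a) := by
    rw [← rpow_sub_one_mul ha]; field_simp
  nlinarith

/-- The odd power map. -/
noncomputable def opow (p t : ℝ) : ℝ := t * |t| ^ (p - 1)

lemma opow_of_nonneg {p t : ℝ} (ht : 0 ≤ t) (hp : 1 < p) : opow p t = t ^ p := by
  unfold opow
  rcases ht.eq_or_lt with rfl | h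
  · rw [Real.zero_rpow (by linarith)]; simp
  · rw [abs_of_pos h, mul_comm, rpow_sub_one_mul h]

lemma opow_neg (p t : ℝ) : opow p (-t) = -opow p t := by
  unfold opow; rw [abs_neg]; ring

lemma hasDerivAt_opow {p : ℝ} (hp : 1 < p) (t : ℝ) :
    HasDerivAt (opow p) (p * |t| ^ (p - 1)) t := by
  have pos : ∀ t : ℝ, 0 < t → HasDerivAt (opow p) (p * |t| ^ (p - 1)) t := by
    intro t ht
    have := Real.hasDerivAt_rpow_const (x := t) (p := p) (Or.inl ht.ne')
    rw [abs_of_pos ht]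
    refine this.congr_of_eventuallyEq ?_
    filter_upwards [eventually_gt_nhds ht] with x hx
    exact opow_of_nonneg hx.le hp
  rcases lt_trichotomy t 0 with h | rfl | h
  · have h1 := (pos (-t) (by linarith)).scomp t (hasDerivAt_neg t)
    have h2 := h1.neg
    rw [abs_neg] at h2
    refine (h2.congr_deriv (by simp)).congr_of_eventuallyEq (Eventually.of_forall fun x => ?_)
    simp [opow_neg]
  · rw [abs_zero, Real.zero_rpow (by linarith), mul_zero, hasDerivAt_iff_tendsto_slope]
    have hc : Continuous fun x : ℝ => |x| ^ (p - 1) :=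
      continuous_abs.rpow_const fun x => Or.inr (by linarith)
    have h0 : Tendsto (fun x : ℝ => |x| ^ (p - 1)) (nhdsWithin 0 {0}ᶜ) (nhds 0) := by
      have := hc.tendsto 0
      rw [abs_zero, Real.zero_rpow (by linarith)] at this
      exact this.mono_left nhdsWithin_le_nhds
    refine h0.congr' ?_
    filter_upwards [self_mem_nhdsWithin] with x hx
    have hx : x ≠ 0 := hx
    simp only [slope, opow, vsub_eq_sub, sub_zero, smul_eq_mul, zero_mul]
    field_simp
  · exact pos t h

/-- A map with third-order control has almost trivial cross-ratio kernel. -/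
lemma pair_of_third {g k l j : ℝ → ℝ} {m M B x y : ℝ} (hxy : x < y) (hm : 0 < m)
    (hg : ∀ t ∈ Icc x y, HasDerivAt g (k t) t) (hk : ∀ t ∈ Icc x y, HasDerivAt k (l t) t)
    (hl : ∀ t ∈ Icc x y, HasDerivAt l (j t) t) (hkm : ∀ t ∈ Icc x y, m ≤ k t)
    (hkM : ∀ t ∈ Icc x y, k t ≤ M) (hlB : ∀ t ∈ Icc x y, |l t| ≤ B)
    (hjB : ∀ t ∈ Icc x y, |j t| ≤ B) :
    m * (y - x) ≤ g y - g x ∧ g y - g x ≤ M * (y - x) ∧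
    k x * k y * (y - x) ^ 2 ≤ Real.exp ((2 * B * M + B ^ 2) / m ^ 2 * (y - x) ^ 2) * (g y - g x) ^ 2 ∧
    (g y - g x) ^ 2 ≤ Real.exp ((2 * B * M + B ^ 2) / m ^ 2 * (y - x) ^ 2) *
      (k x * k y * (y - x) ^ 2) := by
  have hx : x ∈ Icc x y := left_mem_Icc.2 hxy.le
  have hy : y ∈ Icc x y := right_mem_Icc.2 hxy.le
  have B0 : 0 ≤ B := (abs_nonneg _).trans (hlB x hx)
  have M0 : 0 < M := hm.trans_le ((hkm x hx).trans (hkM x hx))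
  set s := y - x with hs
  have s0 : 0 < s := by linarith
  have hkd : ∀ t ∈ Icc x y, |k t - k x - l t * (t - x)| ≤ B * (t - x) ^ 2 := by
    intro t ht
    rcases ht.1.eq_or_lt with h | h
    · rw [← h]; simp
    obtain ⟨ξ, hξ, e⟩ := exists_hasDerivAt_eq_slope k l h
      (fun z hz => (hk z ⟨hz.1, hz.2.trans ht.2⟩).continuousAt.continuousWithinAt)
      (fun z hz => hk z ⟨hz.1.le, hz.2.le.trans ht.2⟩)
    obtain ⟨ζ, hζ, e'⟩ := exists_hasDerivAt_eq_slope l j hξ.2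
      (fun z hz => (hl z ⟨hξ.1.le.trans hz.1, hz.2.trans ht.2⟩).continuousAt.continuousWithinAt)
      (fun z hz => hl z ⟨hξ.1.le.trans hz.1.le, hz.2.le.trans ht.2⟩)
    have hj := hjB ζ ⟨hξ.1.le.trans hζ.1.le, hζ.2.le.trans ht.2⟩
    have tx : 0 < t - x := by linarith
    have tξ : 0 < t - ξ := by linarith [hξ.2]
    rw [eq_div_iff tx.ne'] at e
    rw [eq_div_iff tξ.ne'] at e'
    rw [← e, ← sub_mul, show l ξ - l t = -(j ζ * (t - ξ)) by rw [e']; ring, neg_mul, abs_neg,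
      abs_mul, abs_mul, abs_of_pos tx, abs_of_pos tξ, sq, ← mul_assoc]
    apply mul_le_mul_of_nonneg_right _ tx.le
    exact mul_le_mul hj (by linarith [hξ.1]) tξ.le B0
  have trap : |g y - g x - s * ((k x + k y) / 2)| ≤ B * s ^ 2 / 2 * s := by
    have hder : ∀ t ∈ Icc x y, HasDerivWithinAt
        (fun t => g t - g x - (t - x) * ((k x + k t) / 2))
        ((k t - k x - l t * (t - x)) / 2) (Icc x y) t := by
      intro t ht
      have e1 := ((hasDerivAt_id t).sub_const x).mul (((hk t ht).const_add (k x)).div_const 2)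
      refine ((((hg t ht).sub_const (g x)).sub e1).congr_deriv ?_).hasDerivWithinAt
      simp; ring
    have := (convex_Icc x y).norm_image_sub_le_of_norm_hasDerivWithin_le (C := B * s ^ 2 / 2)
      hder (fun t ht => ?_) hx hy
    · simpa [Real.norm_eq_abs, abs_of_pos s0, ← hs] using this
    · rw [Real.norm_eq_abs, abs_div, abs_two]
      have := hkd t ht
      have h2 : (t - x) ^ 2 ≤ s ^ 2 := pow_le_pow_left₀ (by linarith [ht.1]) (by linarith [ht.2]) 2
      have := mul_le_mul_of_nonneg_left h2 B0
      linarith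
  obtain ⟨ξ, hξ, e⟩ := exists_hasDerivAt_eq_slope g k hxy
    (fun z hz => (hg z hz).continuousAt.continuousWithinAt)
    (fun z hz => hg z ⟨hz.1.le, hz.2.le⟩)
  have hξ' : ξ ∈ Icc x y := ⟨hξ.1.le, hξ.2.le⟩
  rw [← hs, eq_div_iff s0.ne'] at e
  set A := k ξ with hA
  have Am := hkm ξ hξ'
  have AM := hkM ξ hξ'
  have kkd : |k y - k x| ≤ B * s := by
    have := (convex_Icc x y).norm_image_sub_le_of_norm_hasDerivWithin_le (C := B)
      (fun t ht => (hk t ht).hasDerivWithinAt) (fun t ht => hlB t ht) hx hy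
    simpa [Real.norm_eq_abs, abs_of_pos s0, ← hs] using this
  have kxm := hkm x hx
  have kym := hkm y hy
  have kxM := hkM x hx
  have kyM := hkM y hy
  rw [← e, show A * s - s * ((k x + k y) / 2) = (A - (k x + k y) / 2) * s by ring, abs_mul,
    abs_of_pos s0] at trap
  have trap := le_of_mul_le_mul_right trap s0
  have diff : |k x * k y - A ^ 2| ≤ (2 * B * M + B ^ 2) * s ^ 2 := by
    have e2 : k x * k y - A ^ 2 =
        -((A - (k x + k y) / 2) * (A + (k x + k y) / 2)) - (k y - k x) ^ 2 / 4 := by ring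
    have p1 : |(A - (k x + k y) / 2) * (A + (k x + k y) / 2)| ≤ B * s ^ 2 / 2 * (2 * M) := by
      rw [abs_mul]
      apply mul_le_mul trap _ (abs_nonneg _) (by positivity)
      rw [abs_of_pos (by linarith)]; linarith
    have p2 : (k y - k x) ^ 2 ≤ (B * s) ^ 2 := by
      rw [← sq_abs]; exact pow_le_pow_left₀ (abs_nonneg _) kkd 2
    have p3 := abs_le.1 p1
    have : 0 ≤ B * s ^ 2 * M := by positivity
    have : 0 ≤ (B * s) ^ 2 := by positivity
    rw [e2, abs_le]
    constructor <;> nlinarith [sq_nonneg (k y - k x)]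
  set C := (2 * B * M + B ^ 2) / m ^ 2 with hC
  have C0 : 0 ≤ C := by positivity
  have hCm : (2 * B * M + B ^ 2) * s ^ 2 = C * s ^ 2 * m ^ 2 := by rw [hC]; field_simp
  have hexp : 1 + C * s ^ 2 ≤ Real.exp (C * s ^ 2) := by
    have := Real.add_one_le_exp (C * s ^ 2); linarith
  have hCs : 0 ≤ C * s ^ 2 := by positivity
  have d := abs_le.1 diff
  have q1 : m ^ 2 ≤ A ^ 2 := pow_le_pow_left₀ hm.le Am 2
  have q2 : m ^ 2 ≤ k x * k y := by rw [sq]; exact mul_le_mul kxm kym hm.le (by linarith)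
  have r1 := mul_le_mul_of_nonneg_left q1 hCs
  have r2 := mul_le_mul_of_nonneg_left q2 hCs
  have r3 := mul_le_mul_of_nonneg_right hexp (sq_nonneg A)
  have r4 := mul_le_mul_of_nonneg_right hexp (le_trans (sq_nonneg m) q2)
  refine ⟨?_, ?_, ?_, ?_⟩
  · rw [← e]; exact mul_le_mul_of_nonneg_right Am s0.le
  · rw [← e]; exact mul_le_mul_of_nonneg_right AM s0.le
  · rw [← e, mul_pow, ← mul_assoc]
    apply mul_le_mul_of_nonneg_right _ (sq_nonneg s)
    linarith
  · rw [← e, mul_pow, ← mul_assoc]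
    apply mul_le_mul_of_nonneg_right _ (sq_nonneg s)
    linarith

/-- Uniform third-order control of a local diffeomorphism near a point. -/
def ThirdCtrl (v : ℝ → ℝ) (c δ m M C : ℝ) : Prop :=
  ∀ x y, |x - c| ≤ δ → |y - c| ≤ δ → x < y →
    m * (y - x) ≤ v y - v x ∧ v y - v x ≤ M * (y - x) ∧
    deriv v x * deriv v y * (y - x) ^ 2 ≤ Real.exp (C * (y - x) ^ 2) * (v y - v x) ^ 2 ∧
    (v y - v x) ^ 2 ≤ Real.exp (C * (y - x) ^ 2) * (deriv v x * deriv v y * (y - x) ^ 2)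

lemma exists_thirdCtrl_of_pos {u : ℝ → ℝ} {U : Set ℝ} {c : ℝ} (hU : IsOpen U) (hc : c ∈ U)
    (hu : ContDiffOn ℝ 3 u U) (hd : 0 < deriv u c) :
    ∃ δ m M C, 0 < δ ∧ 0 < m ∧ 0 < M ∧ 0 ≤ C ∧
      (∀ x, |x - c| ≤ δ → x ∈ U ∧ DifferentiableAt ℝ u x ∧ 0 < deriv u x) ∧
      ThirdCtrl u c δ m M C := by
  have h1 : DifferentiableOn ℝ u U ∧ ContDiffOn ℝ 2 (deriv u) U := by
    have := (contDiffOn_succ_iff_deriv_of_isOpen (n := 2) hU).1 (by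
      rw [show ((2 : WithTop ℕ∞) + 1) = 3 by norm_num]; exact hu)
    exact ⟨this.1, this.2.2⟩
  have h2 : DifferentiableOn ℝ (deriv u) U ∧ ContDiffOn ℝ 1 (deriv (deriv u)) U := by
    have := (contDiffOn_succ_iff_deriv_of_isOpen (n := 1) hU).1 (by
      rw [show ((1 : WithTop ℕ∞) + 1) = 2 by norm_num]; exact h1.2)
    exact ⟨this.1, this.2.2⟩
  have h3 : DifferentiableOn ℝ (deriv (deriv u)) U ∧
      ContDiffOn ℝ 0 (deriv (deriv (deriv u))) U := by
    have := (contDiffOn_succ_iff_deriv_of_isOpen (n := 0) hU).1 (by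
      rw [zero_add]; exact h2.2)
    exact ⟨this.1, this.2.2⟩
  have hn := hU.mem_nhds hc
  have c1 : ContinuousAt (deriv u) c := h1.2.continuousOn.continuousAt hn
  have c2 : ContinuousAt (deriv (deriv u)) c := h2.2.continuousOn.continuousAt hn
  have c3 : ContinuousAt (deriv (deriv (deriv u))) c := h3.2.continuousOn.continuousAt hn
  set d := deriv u c with hdd
  set B := max (|deriv (deriv u) c| + 1) (|deriv (deriv (deriv u)) c| + 1) with hB
  have B0 : 0 < B := lt_of_lt_of_le (by positivity) (le_max_left _ _)
  have e1 := c1.eventually (eventually_gt_nhds (show d / 2 < deriv u c by linarith))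
  have e2 := c1.eventually (eventually_lt_nhds (show deriv u c < 2 * d by linarith))
  have e3 := c2.abs.eventually (eventually_lt_nhds
    (show |deriv (deriv u) c| < B from lt_of_lt_of_le (by linarith) (le_max_left _ _)))
  have e4 := c3.abs.eventually (eventually_lt_nhds
    (show |deriv (deriv (deriv u)) c| < B from lt_of_lt_of_le (by linarith) (le_max_right _ _)))
  have e5 := hU.eventually_mem hc
  obtain ⟨δ, δ0, hδ⟩ := Metric.nhds_basis_closedBall.eventually_iff.1
    (e1.and (e2.and (e3.and (e4.and e5))))
  have hin : ∀ x, |x - c| ≤ δ → _ := fun x hx => hδ (x := x) (by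
    rw [Metric.mem_closedBall, Real.dist_eq]; exact hx)
  refine ⟨δ, d / 2, 2 * d, (2 * B * (2 * d) + B ^ 2) / (d / 2) ^ 2, δ0, by linarith, by linarith,
    by positivity, ?_, ?_⟩
  · intro x hx
    obtain ⟨a1, -, -, -, a5⟩ := hin x hx
    exact ⟨a5, (h1.1 x a5).differentiableAt (hU.mem_nhds a5), by linarith⟩
  · intro x y hx hy hxy
    have hI : ∀ t ∈ Icc x y, |t - c| ≤ δ := fun t ht => by
      rw [abs_le] at *
      constructor <;> linarith [ht.1, ht.2]
    have hb : ∀ t ∈ Icc x y, _ := fun t ht => hin t (hI t ht)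
    exact pair_of_third (g := u) (k := deriv u) (l := deriv (deriv u))
      (j := deriv (deriv (deriv u))) (B := B) (m := d / 2) (M := 2 * d) hxy (by linarith)
      (fun t ht => ((h1.1 t (hb t ht).2.2.2.2).differentiableAt
        (hU.mem_nhds (hb t ht).2.2.2.2)).hasDerivAt)
      (fun t ht => ((h2.1 t (hb t ht).2.2.2.2).differentiableAt
        (hU.mem_nhds (hb t ht).2.2.2.2)).hasDerivAt)
      (fun t ht => ((h3.1 t (hb t ht).2.2.2.2).differentiableAt
        (hU.mem_nhds (hb t ht).2.2.2.2)).hasDerivAt)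
      (fun t ht => (hb t ht).1.le) (fun t ht => (hb t ht).2.1.le)
      (fun t ht => (hb t ht).2.2.1.le) (fun t ht => (hb t ht).2.2.2.1.le)

lemma exists_thirdCtrl {u : ℝ → ℝ} {U : Set ℝ} {c : ℝ} (hU : IsOpen U) (hc : c ∈ U)
    (hu : ContDiffOn ℝ 3 u U) (hd : deriv u c ≠ 0) :
    ∃ s : ℝ, (s = 1 ∨ s = -1) ∧ ∃ δ m M C, 0 < δ ∧ 0 < m ∧ 0 < M ∧ 0 ≤ C ∧
      (∀ x, |x - c| ≤ δ → x ∈ U ∧ DifferentiableAt ℝ (fun t => s * u t) x ∧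
        0 < deriv (fun t => s * u t) x) ∧
      ThirdCtrl (fun t => s * u t) c δ m M C := by
  rcases hd.lt_or_gt with h | h
  · exact ⟨-1, Or.inr rfl, exists_thirdCtrl_of_pos hU hc (contDiffOn_const.mul hu) (by
      rw [deriv_const_mul_field]; linarith)⟩
  · exact ⟨1, Or.inl rfl, exists_thirdCtrl_of_pos hU hc (contDiffOn_const.mul hu) (by
      rw [deriv_const_mul_field]; linarith)⟩

/-- Normal form of `F` near a power-law critical point `c`: `φ` is the coordinate. -/
def CritChart (F : ℝ → ℝ) (c p δ m M C : ℝ) (φ : ℝ → ℝ) : Prop :=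
  φ c = 0 ∧ ∀ x y, |x - c| ≤ δ → |y - c| ≤ δ → x < y →
    m * (y - x) ≤ φ y - φ x ∧ φ y - φ x ≤ M * (y - x) ∧
    (∀ k, 0 ≤ k → p ^ 2 * (|φ x| ^ (p - 1) * |φ y| ^ (p - 1)) * (φ y - φ x) ^ 2 ≤
        k * (opow p (φ y) - opow p (φ x)) ^ 2 →
      PairBound F (k * Real.exp (C * (y - x) ^ 2)) x y) ∧
    F y - F x ≤ M * (opow p (φ y) - opow p (φ x)) ∧
    opow p (φ y) - opow p (φ x) ≤ M * (F y - F x)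

lemma opow_strictMono {p : ℝ} (hp : 1 < p) : StrictMono (opow p) := by
  have h1 : StrictMonoOn (opow p) (Ici 0) := fun x hx y hy h => by
    rw [opow_of_nonneg hx hp, opow_of_nonneg hy hp]
    exact Real.rpow_lt_rpow hx h (by linarith)
  have h2 : StrictMonoOn (opow p) (Iic 0) := fun x hx y hy h => by
    have := h1 (a := -y) (b := -x) (by simpa using hy) (by simpa using hx) (by linarith)
    rw [opow_neg, opow_neg] at this; linarith
  exact StrictMonoOn.Iic_union_Ici h2 h1

set_option maxHeartbeats 800000 in
lemma exists_critChart {H : CircleHomeo} {c p : ℝ} (hp : 1 < p) (hF : ContDiff ℝ 3 H.lift)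
    (h : IsPowerLawCritPt H c p) :
    ∃ φ δ m M C, 0 < δ ∧ 0 < m ∧ 0 < M ∧ 0 ≤ C ∧ CritChart H.lift c p δ m M C φ := by
  obtain ⟨U, V, U', V', φ, ψ, hcU, hcU', -, -, hφ, hψ, hφc, hψc, -, hconj⟩ := h
  obtain ⟨s, hs, δ₁, m₁, M₁, C₁, δ₁0, m₁0, M₁0, C₁0, hA, hB⟩ :=
    exists_thirdCtrl hφ.1 hcU hφ.2.2.1 (hφ.2.2.2.2 c hcU)
  obtain ⟨s', hs', δ₂, m₂, M₂, C₂, δ₂0, m₂0, M₂0, C₂0, hA', hB'⟩ :=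
    exists_thirdCtrl hψ.1 hcU' hψ.2.2.1 (hψ.2.2.2.2 _ hcU')
  set F := H.lift with hFdef
  have hFm : StrictMono F := H.lift_strictMono
  have hFd : Differentiable ℝ F := hF.differentiable (by norm_num)
  have hF1 : Continuous (deriv F) := hF.continuous_deriv (by norm_num)
  set L := |deriv F c| + 1 with hL
  have L0 : 0 < L := by positivity
  have ev1 : ∀ᶠ x in nhds c, |F x - F c| < δ₂ := by
    have : ContinuousAt (fun x => |F x - F c|) c := by
      have := hFd.continuous
      fun_prop
    exact this.eventually (eventually_lt_nhds (by simpa using δ₂0))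
  have ev2 : ∀ᶠ x in nhds c, |deriv F x| < L :=
    hF1.continuousAt.abs.eventually (eventually_lt_nhds (by linarith))
  obtain ⟨δ₃, δ₃0, hδ₃⟩ := Metric.nhds_basis_closedBall.eventually_iff.1 (ev1.and ev2)
  have hin : ∀ x, |x - c| ≤ δ₃ → _ := fun x hx => hδ₃ (x := x) (by
    rw [Metric.mem_closedBall, Real.dist_eq]; exact hx)
  set Φ : ℝ → ℝ := fun t => s * φ t with hΦ
  set Ψ : ℝ → ℝ := fun t => s' * ψ t with hΨ
  have hsgn : ∃ r : ℝ, (r = 1 ∨ r = -1) ∧ ∀ x ∈ U, Ψ (F x) = r * opow p (Φ x) := by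
    refine ⟨s' * s, by rcases hs with rfl | rfl <;> rcases hs' with rfl | rfl <;> norm_num, ?_⟩
    intro x hx
    have := hconj x hx
    simp only [hΨ, hΦ, ← hFdef] at *
    rw [this]
    rcases hs with rfl | rfl
    · simp [opow]
    · rw [neg_one_mul, opow_neg]; simp [opow]
  obtain ⟨r, hr, hΨF⟩ := hsgn
  have r2 : r ^ 2 = 1 := by rcases hr with rfl | rfl <;> norm_num
  have δ0 : 0 < min δ₁ δ₃ := lt_min δ₁0 δ₃0
  refine ⟨Φ, min δ₁ δ₃, m₁, max M₁ (max M₂ (1 / m₂)), C₁ + C₂ * L ^ 2, δ0, m₁0,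
    lt_max_of_lt_left M₁0, by positivity, by simp [hΦ, hφc], ?_⟩
  intro x y hx hy hxy
  have hx1 := hx.trans (min_le_left _ _)
  have hy1 := hy.trans (min_le_left _ _)
  have hx3 := hin x (hx.trans (min_le_right _ _))
  have hy3 := hin y (hy.trans (min_le_right _ _))
  obtain ⟨b1, b2, b3, b4⟩ := hB x y hx1 hy1 hxy
  obtain ⟨xU, xd, xp⟩ := hA x hx1
  obtain ⟨yU, yd, yp⟩ := hA y hy1
  have hFxy := hFm hxy
  obtain ⟨c1, c2, c3, c4⟩ := hB' (F x) (F y) hx3.1.le hy3.1.le hFxy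
  obtain ⟨xU', xd', xp'⟩ := hA' (F x) hx3.1.le
  obtain ⟨yU', yd', yp'⟩ := hA' (F y) hy3.1.le
  have hxy0 : 0 < y - x := by linarith
  have hΦxy : Φ x < Φ y := by
    have : 0 < m₁ * (y - x) := by positivity
    linarith
  have hPxy := opow_strictMono hp hΦxy
  have hΨxy : Ψ (F x) < Ψ (F y) := by
    have : 0 < m₂ * (F y - F x) := mul_pos m₂0 (by linarith)
    linarith
  have er : Ψ (F y) - Ψ (F x) = opow p (Φ y) - opow p (Φ x) := by
    rw [hΨF x xU, hΨF y yU] at hΨxy ⊢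
    rcases hr with rfl | rfl
    · ring
    · linarith
  have chain : ∀ t, t ∈ U → DifferentiableAt ℝ Φ t → DifferentiableAt ℝ Ψ (F t) →
      deriv Ψ (F t) * deriv F t = r * (p * |Φ t| ^ (p - 1) * deriv Φ t) := by
    intro t ht h1 h2
    have d1 := h2.hasDerivAt.comp t (hFd t).hasDerivAt
    have d2 := ((hasDerivAt_opow hp (Φ t)).comp t h1.hasDerivAt).const_mul r
    refine d1.unique (d2.congr_of_eventuallyEq ?_)
    filter_upwards [hφ.1.mem_nhds ht] with z hz
    exact hΨF z hz
  refine ⟨b1, b2.trans ?_, ?_, ?_, ?_⟩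
  · gcongr; exact le_max_left _ _
  · intro k hk hP
    have ex := chain x xU xd xd'
    have ey := chain y yU yd yd'
    unfold PairBound
    have hFL : F y - F x ≤ L * (y - x) := by
      have := (convex_Icc x y).norm_image_sub_le_of_norm_deriv_le (f := F) (C := L)
        (fun t _ => hFd t) (fun t ht => ?_) (left_mem_Icc.2 hxy.le) (right_mem_Icc.2 hxy.le)
      · rw [Real.norm_eq_abs, Real.norm_eq_abs, abs_of_pos hxy0, abs_of_pos (by linarith)] at this
        exact this
      · refine (hin t ?_).2.le
        have h1 := abs_le.1 (hx.trans (min_le_right _ _))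
        have h2 := abs_le.1 (hy.trans (min_le_right _ _))
        rw [abs_le]
        constructor <;> linarith [ht.1, ht.2]
    have hE : Real.exp (C₁ * (y - x) ^ 2) * Real.exp (C₂ * (F y - F x) ^ 2) ≤
        Real.exp ((C₁ + C₂ * L ^ 2) * (y - x) ^ 2) := by
      rw [← Real.exp_add, Real.exp_le_exp]
      have : (F y - F x) ^ 2 ≤ (L * (y - x)) ^ 2 := pow_le_pow_left₀ (by linarith) hFL 2
      linear_combination mul_le_mul_of_nonneg_left this C₂0
    set E1 := Real.exp (C₁ * (y - x) ^ 2) with hE1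
    set E2 := Real.exp (C₂ * (F y - F x) ^ 2) with hE2
    have E10 : 0 < E1 := Real.exp_pos _
    have E20 : 0 < E2 := Real.exp_pos _
    have pa : 0 ≤ |Φ x| ^ (p - 1) := Real.rpow_nonneg (abs_nonneg _) _
    have pb : 0 ≤ |Φ y| ^ (p - 1) := Real.rpow_nonneg (abs_nonneg _) _
    rw [er] at c4
    have hpp := mul_pos xp' yp'
    refine le_of_mul_le_mul_left ?_ hpp
    calc deriv Ψ (F x) * deriv Ψ (F y) * (deriv F x * deriv F y * (y - x) ^ 2)
        = (deriv Ψ (F x) * deriv F x) * (deriv Ψ (F y) * deriv F y) * (y - x) ^ 2 := by ring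
      _ = r ^ 2 * (p ^ 2 * (|Φ x| ^ (p - 1) * |Φ y| ^ (p - 1))) *
          (deriv Φ x * deriv Φ y * (y - x) ^ 2) := by rw [ex, ey]; ring
      _ = (p ^ 2 * (|Φ x| ^ (p - 1) * |Φ y| ^ (p - 1))) *
          (deriv Φ x * deriv Φ y * (y - x) ^ 2) := by rw [r2, one_mul]
      _ ≤ (p ^ 2 * (|Φ x| ^ (p - 1) * |Φ y| ^ (p - 1))) * (E1 * (Φ y - Φ x) ^ 2) := by gcongr
      _ = E1 * (p ^ 2 * (|Φ x| ^ (p - 1) * |Φ y| ^ (p - 1)) * (Φ y - Φ x) ^ 2) := by ring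
      _ ≤ E1 * (k * (opow p (Φ y) - opow p (Φ x)) ^ 2) := by gcongr
      _ ≤ E1 * (k * (E2 * (deriv Ψ (F x) * deriv Ψ (F y) * (F y - F x) ^ 2))) := by gcongr
      _ = (E1 * E2) * (k * (deriv Ψ (F x) * deriv Ψ (F y) * (F y - F x) ^ 2)) := by ring
      _ ≤ Real.exp ((C₁ + C₂ * L ^ 2) * (y - x) ^ 2) *
          (k * (deriv Ψ (F x) * deriv Ψ (F y) * (F y - F x) ^ 2)) := by
        apply mul_le_mul_of_nonneg_right hE; positivity
      _ = _ := by ring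
  · rw [← er]
    have : F y - F x ≤ 1 / m₂ * (Ψ (F y) - Ψ (F x)) := by
      rw [one_div, ← div_eq_inv_mul, le_div_iff₀ m₂0]; linarith
    refine this.trans ?_
    apply mul_le_mul_of_nonneg_right _ (by linarith)
    exact (le_max_right _ _).trans (le_max_right _ _)
  · rw [← er]
    refine c2.trans ?_
    apply mul_le_mul_of_nonneg_right _ (by linarith)
    exact (le_max_left _ _).trans (le_max_right _ _)

lemma pairBound_self {F : ℝ → ℝ} {k x : ℝ} : PairBound F k x x := by
  unfold PairBound; simp

/-- Comparison data for two points `x, y` on one side of a critical point, with `a, b` the moduli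
of their coordinates. -/
structure SideData (F : ℝ → ℝ) (c p m M C x y a b : ℝ) : Prop where
  b_nonneg : 0 ≤ b
  b_le : b ≤ a
  a_pos : 0 < a
  a_ge : m * |x - c| ≤ a
  a_le : a ≤ M * |x - c|
  b_le' : b ≤ M * |y - c|
  sub_ge : m * |y - x| ≤ a - b
  sub_le : a - b ≤ M * |y - x|
  F_le : |F y - F x| ≤ M * (a ^ p - b ^ p)
  pow_le : a ^ p ≤ M * |F c - F x|
  pair : ∀ k, 0 ≤ k → p ^ 2 * (a ^ (p - 1) * b ^ (p - 1)) * (a - b) ^ 2 ≤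
    k * (a ^ p - b ^ p) ^ 2 → PairBound F (k * Real.exp (C * (y - x) ^ 2)) x y

namespace CritChart

variable {F : ℝ → ℝ} {c p δ m M C : ℝ} {φ : ℝ → ℝ}

lemma coord_pos (h : CritChart F c p δ m M C φ) (hm : 0 < m) (hδ : 0 ≤ δ) {x : ℝ}
    (hx : |x - c| ≤ δ) (hc : c < x) : 0 < φ x := by
  obtain ⟨h1, -⟩ := h.2 c x (by simpa using hδ) hx hc
  rw [h.1] at h1
  have : 0 < m * (x - c) := mul_pos hm (by linarith)
  linarith

lemma coord_neg (h : CritChart F c p δ m M C φ) (hm : 0 < m) (hδ : 0 ≤ δ) {x : ℝ}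
    (hx : |x - c| ≤ δ) (hc : x < c) : φ x < 0 := by
  obtain ⟨h1, -⟩ := h.2 x c hx (by simpa using hδ) hc
  rw [h.1] at h1
  have : 0 < m * (c - x) := mul_pos hm (by linarith)
  linarith

lemma sideData_right (h : CritChart F c p δ m M C φ) (hF : StrictMono F) (hp : 1 < p) (hm : 0 < m)
    (hδ : 0 ≤ δ) {x y : ℝ} (hx : |x - c| ≤ δ) (hcy : c ≤ y) (hyx : y < x) :
    SideData F c p m M C x y |φ x| |φ y| := by
  have hy : |y - c| ≤ δ := by
    rw [abs_of_nonneg (by linarith)]; have := abs_le.1 hx; linarith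
  have hc : |c - c| ≤ δ := by simpa using hδ
  obtain ⟨a1, a2, a3, a4, a5⟩ := h.2 y x hy hx hyx
  obtain ⟨b1, b2, b3, b4, b5⟩ := h.2 c x hc hx (by linarith)
  have px := h.coord_pos hm hδ hx (by linarith)
  have py : 0 ≤ φ y := by
    rcases hcy.eq_or_lt with rfl | h'
    · rw [h.1]
    · exact (h.coord_pos hm hδ hy h').le
  have hyM : φ y ≤ M * (y - c) := by
    rcases hcy.eq_or_lt with rfl | h'
    · rw [h.1]; simp
    · have := (h.2 c y hc hy h').2.1
      rwa [h.1, sub_zero] at this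
  have f1 := hF hyx
  have f2 : F c < F x := hF (by linarith)
  rw [h.1] at b1 b2 b3 b4 b5
  have o0 : opow p 0 = 0 := by simp [opow]
  rw [o0] at b5 b4
  rw [opow_of_nonneg px.le hp] at a4 a5 a3 b5
  rw [opow_of_nonneg py hp] at a4 a5 a3
  rw [abs_of_pos px, abs_of_nonneg py] at *
  refine ⟨py, ?_, px, ?_, ?_, ?_, ?_, ?_, ?_, ?_, ?_⟩
  · have : 0 < m * (x - y) := mul_pos hm (by linarith)
    linarith
  · rw [abs_of_pos (by linarith)]; linarith
  · rw [abs_of_pos (by linarith)]; linarith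
  · rw [abs_of_nonneg (by linarith)]; linarith
  · rw [abs_of_neg (by linarith)]; linarith
  · rw [abs_of_neg (by linarith)]; linarith
  · rw [abs_of_neg (by linarith)]; linarith
  · rw [abs_of_neg (by linarith)]; linarith
  · intro k hk hP
    have := (a3 k hk (by linarith)).symm
    rwa [show (x - y) ^ 2 = (y - x) ^ 2 by ring] at this

lemma sideData_left (h : CritChart F c p δ m M C φ) (hF : StrictMono F) (hp : 1 < p) (hm : 0 < m)
    (hδ : 0 ≤ δ) {x y : ℝ} (hx : |x - c| ≤ δ) (hcy : y ≤ c) (hyx : x < y) :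
    SideData F c p m M C x y |φ x| |φ y| := by
  have hy : |y - c| ≤ δ := by
    rw [abs_of_nonpos (by linarith)]; have := abs_le.1 hx; linarith
  have hc : |c - c| ≤ δ := by simpa using hδ
  obtain ⟨a1, a2, a3, a4, a5⟩ := h.2 x y hx hy hyx
  obtain ⟨b1, b2, b3, b4, b5⟩ := h.2 x c hx hc (by linarith)
  have px := h.coord_neg hm hδ hx (by linarith)
  have py : φ y ≤ 0 := by
    rcases hcy.eq_or_lt with rfl | h'
    · rw [h.1]
    · exact (h.coord_neg hm hδ hy h').le
  have hyM : -φ y ≤ M * (c - y) := by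
    rcases hcy.eq_or_lt with rfl | h'
    · rw [h.1]; simp
    · have := (h.2 y c hy hc h').2.1
      rwa [h.1, zero_sub] at this
  have f1 := hF hyx
  have f2 : F x < F c := hF (by linarith)
  rw [h.1] at b1 b2 b3 b4 b5
  have o0 : opow p 0 = 0 := by simp [opow]
  have ox : opow p (φ x) = -(-φ x) ^ p := by
    rw [← opow_of_nonneg (by linarith) hp, opow_neg, neg_neg]
  have oy : opow p (φ y) = -(-φ y) ^ p := by
    rw [← opow_of_nonneg (by linarith) hp, opow_neg, neg_neg]
  rw [o0] at b5 b4
  rw [ox] at a4 a5 a3 b5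
  rw [oy] at a4 a5 a3
  rw [abs_of_neg px, abs_of_nonpos py] at *
  refine ⟨by linarith, ?_, by linarith, ?_, ?_, ?_, ?_, ?_, ?_, ?_, ?_⟩
  · have : 0 < m * (y - x) := mul_pos hm (by linarith)
    linarith
  · rw [abs_of_neg (by linarith)]; linarith
  · rw [abs_of_neg (by linarith)]; linarith
  · rw [abs_of_nonpos (by linarith)]; linarith
  · rw [abs_of_pos (by linarith)]; linarith
  · rw [abs_of_pos (by linarith)]; linarith
  · rw [abs_of_pos (by linarith)]; linarith
  · rw [abs_of_pos (by linarith)]; linarith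
  · intro k hk hP
    exact a3 k hk (by linarith)

lemma sideData (h : CritChart F c p δ m M C φ) (hF : StrictMono F) (hp : 1 < p) (hm : 0 < m)
    (hδ : 0 ≤ δ) {x y : ℝ} (hx : |x - c| ≤ δ) (hyx : |y - c| < |x - c|)
    (hs : 0 ≤ (x - c) * (y - c)) : SideData F c p m M C x y |φ x| |φ y| := by
  rcases lt_trichotomy x c with hxc | rfl | hxc
  · have : y ≤ c := by nlinarith
    rw [abs_of_nonpos (by linarith), abs_of_neg (by linarith)] at hyx
    exact h.sideData_left hF hp hm hδ hx this (by linarith)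
  · simp at hyx; exact absurd hyx (not_lt.2 (abs_nonneg _))
  · have : c ≤ y := by nlinarith
    rw [abs_of_nonneg (by linarith), abs_of_pos (by linarith)] at hyx
    exact h.sideData_right hF hp hm hδ hx this (by linarith)

lemma pair_cross (h : CritChart F c p δ m M C φ) (hp : 1 < p) (hm : 0 < m) (hC : 0 ≤ C)
    (hδ : 0 ≤ δ) {x y : ℝ} (hx : |x - c| ≤ δ) (hy : |y - c| ≤ δ) (hxc : x < c) (hcy : c < y) :
    PairBound F (4 * p ^ 2 * Real.exp (C * (2 * δ) ^ 2)) x y := by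
  obtain ⟨-, -, a3, -⟩ := h.2 x y hx hy (by linarith)
  have px := h.coord_neg hm hδ hx hxc
  have py := h.coord_pos hm hδ hy hcy
  have ox : opow p (φ x) = -(-φ x) ^ p := by
    rw [← opow_of_nonneg (by linarith) hp, opow_neg, neg_neg]
  rw [ox, opow_of_nonneg py.le hp, abs_of_neg px, abs_of_pos py] at a3
  have := a3 (4 * p ^ 2) (by positivity) (by
    rcases le_total (φ y) (-φ x) with hle | hle
    · have := rpow_pair_cross hp py.le hle
      linarith
    · have := rpow_pair_cross hp (by linarith) hle
      linarith)
  refine this.mono ?_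
  have h1 := abs_le.1 hx
  have h2 := abs_le.1 hy
  have : 0 ≤ y - x := by linarith
  gcongr
  linarith

lemma pair_side (h : CritChart F c p δ m M C φ) (hF : StrictMono F) (hp : 1 < p) (hm : 0 < m)
    (hδ : 0 ≤ δ) {x y : ℝ} (hx : |x - c| ≤ δ) (hyx : |y - c| < |x - c|)
    (hs : 0 ≤ (x - c) * (y - c)) : PairBound F (Real.exp (C * (y - x) ^ 2)) x y := by
  obtain ⟨s1, s2, s3, -, -, -, -, -, -, -, s⟩ := h.sideData hF hp hm hδ hx hyx hs
  have := s 1 zero_le_one (by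
    have := rpow_pair hp s1 s2 s3
    have h0 : 0 ≤ p ^ 2 * (|φ x| ^ (p - 1) * |φ y| ^ (p - 1)) * (|φ x| - |φ y|) ^ 2 *
      ((p - 1) / 6 * ((|φ x| - |φ y|) / |φ x|) ^ 2) := by
      have : 0 ≤ p - 1 := by linarith
      positivity
    rw [one_mul]
    refine le_trans ?_ this
    rw [mul_add, mul_one]
    exact le_add_of_nonneg_right h0)
  rwa [one_mul] at this

lemma contraction (h : CritChart F c p δ m M C φ) (hF : StrictMono F) (hp : 1 < p) (hm : 0 < m)
    (hM : 0 < M) (hC : 0 ≤ C) (hδ : 0 < δ) : ∃ κ δ', 0 < κ ∧ 0 < δ' ∧ ∀ x y, |x - c| ≤ δ' →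
      |y - c| < |x - c| → 0 ≤ (x - c) * (y - c) →
      PairBound F (Real.exp (-(κ * ((y - x) / (x - c)) ^ 2))) x y := by
  set κ₀ := min ((p - 1) / 6 * (m / M) ^ 2) 1 with hκ
  have κ0 : 0 < κ₀ := by
    have : 0 < p - 1 := by linarith
    exact lt_min (by positivity) one_pos
  obtain ⟨δ', hδ', hδC⟩ : ∃ δ' > 0, C * δ' ^ 2 ≤ κ₀ / 4 := by
    refine ⟨min 1 (κ₀ / (4 * (C + 1))), by positivity, ?_⟩
    set d := min 1 (κ₀ / (4 * (C + 1)))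
    have d1 : d ≤ 1 := min_le_left _ _
    have d2 : d ≤ κ₀ / (4 * (C + 1)) := min_le_right _ _
    have d0 : 0 < d := by positivity
    rw [le_div_iff₀ (by positivity)] at d2
    have : d ^ 2 ≤ d := by nlinarith
    nlinarith
  refine ⟨κ₀ / 4, min δ δ', by linarith, lt_min hδ hδ', fun x y hx hyx hs => ?_⟩
  obtain ⟨s1, s2, s3, -, s5, -, s7, -, -, -, s⟩ :=
    h.sideData hF hp hm hδ.le (hx.trans (min_le_left _ _)) hyx hs
  have xc : 0 < |x - c| := (abs_nonneg _).trans_lt hyx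
  have xc' : x - c ≠ 0 := abs_pos.1 xc
  have hρ1 : |y - x| ≤ |x - c| := by
    rcases le_total 0 (x - c) with h0 | h0
    · rw [abs_of_nonneg h0] at *
      have : 0 ≤ y - c := by nlinarith
      rw [abs_of_nonneg this] at hyx
      rw [abs_of_neg (by linarith)]; linarith
    · rw [abs_of_nonpos h0] at *
      have : y - c ≤ 0 := by nlinarith
      rw [abs_of_nonpos this] at hyx
      rw [abs_of_pos (by linarith)]; linarith
  set ρ := |y - x| / |x - c| with hρ
  have ρ0 : 0 ≤ ρ := by positivity
  have ρ1 : ρ ≤ 1 := (div_le_one xc).2 hρ1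
  have hρ2 : ((y - x) / (x - c)) ^ 2 = ρ ^ 2 := by rw [hρ, ← abs_div, sq_abs]
  set a := |φ x|
  set b := |φ y|
  have hr : m / M * ρ ≤ (a - b) / a := by
    rw [hρ, div_mul_div_comm, div_le_div_iff₀ (by positivity) s3]
    calc m * |y - x| * a ≤ (a - b) * (M * |x - c|) := by gcongr
      _ = _ := rfl
  have hkr : κ₀ * ρ ^ 2 ≤ (p - 1) / 6 * ((a - b) / a) ^ 2 := by
    calc κ₀ * ρ ^ 2 ≤ (p - 1) / 6 * (m / M) ^ 2 * ρ ^ 2 := by gcongr; exact min_le_left _ _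
      _ = (p - 1) / 6 * (m / M * ρ) ^ 2 := by ring
      _ ≤ _ := by
        apply mul_le_mul_of_nonneg_left _ (by linarith)
        gcongr
  have hu1 : κ₀ * ρ ^ 2 ≤ 1 := mul_le_one₀ (min_le_right _ _) (by positivity) (by nlinarith)
  have hu0 : 0 ≤ κ₀ * ρ ^ 2 := by positivity
  have hlog := half_le_log_one_add hu0 hu1
  have key := s (Real.exp (-(κ₀ * ρ ^ 2 / 2))) (Real.exp_pos _).le (by
    have h1 := rpow_pair hp s1 s2 s3
    set A := p ^ 2 * (a ^ (p - 1) * b ^ (p - 1)) * (a - b) ^ 2 with hA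
    have A0 : 0 ≤ A := by positivity
    have h2 : Real.exp (κ₀ * ρ ^ 2 / 2) ≤ 1 + κ₀ * ρ ^ 2 := by
      rw [← Real.exp_log (show 0 < 1 + κ₀ * ρ ^ 2 by linarith), Real.exp_le_exp]
      linarith
    rw [Real.exp_neg, inv_mul_eq_div, le_div_iff₀ (Real.exp_pos _)]
    calc A * Real.exp (κ₀ * ρ ^ 2 / 2) ≤ A * (1 + (p - 1) / 6 * ((a - b) / a) ^ 2) := by
          gcongr; linarith
      _ ≤ _ := h1)
  refine key.mono ?_
  rw [← Real.exp_add, Real.exp_le_exp, hρ2]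
  have e : (y - x) ^ 2 = ρ ^ 2 * |x - c| ^ 2 := by
    rw [hρ, div_pow, sq_abs]; field_simp
  have : C * |x - c| ^ 2 ≤ κ₀ / 4 := by
    refine le_trans ?_ hδC
    have := hx.trans (min_le_right _ _)
    gcongr
  have := mul_le_mul_of_nonneg_right this (sq_nonneg ρ)
  rw [e]
  linarith

lemma far (h : CritChart F c p δ m M C φ) (hF : StrictMono F) (hp : 1 < p) (hm : 0 < m)
    (hC : 0 ≤ C) (hδ : 0 < δ) {ε : ℝ} (hε : 0 < ε) : ∃ Q, 1 < Q ∧ ∀ x y,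
      |x - c| ≤ δ → Q * |y - c| ≤ |x - c| → 0 ≤ (x - c) * (y - c) → PairBound F ε x y := by
  set E := 4 * p ^ 2 * Real.exp (C * (2 * δ) ^ 2) with hE
  have E0 : 0 < E := by positivity
  set t₀ := min (1 / 2) ((ε / E) ^ (1 / (p - 1))) with ht
  have p1 : 0 < p - 1 := by linarith
  have t0 : 0 < t₀ := by positivity
  have ht1 : t₀ ^ (p - 1) * E ≤ ε := by
    rw [← le_div_iff₀ E0]
    calc t₀ ^ (p - 1) ≤ ((ε / E) ^ (1 / (p - 1))) ^ (p - 1) :=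
          Real.rpow_le_rpow t0.le (min_le_right _ _) p1.le
      _ = ε / E := by
        rw [← Real.rpow_mul (by positivity), one_div_mul_cancel p1.ne', Real.rpow_one]
  refine ⟨max 2 (M / (m * t₀)), lt_max_of_lt_left (by norm_num), fun x y hx hyx hs => ?_⟩
  rcases eq_or_ne x c with rfl | hne
  · have : |y - x| ≤ 0 := by
      rw [sub_self, abs_zero] at hyx
      by_contra h0
      push Not at h0
      have : 0 < max 2 (M / (m * t₀)) * |y - x| := by positivity
      linarith
    have : y = x := by
      have := abs_eq_zero.1 (le_antisymm this (abs_nonneg _)); linarith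
    rw [this]; exact pairBound_self
  have xc : 0 < |x - c| := abs_pos.2 (sub_ne_zero.2 hne)
  have hy2 : 2 * |y - c| ≤ |x - c| := by
    refine le_trans ?_ hyx
    gcongr; exact le_max_left _ _
  have hyQ : M / (m * t₀) * |y - c| ≤ |x - c| := by
    refine le_trans ?_ hyx
    gcongr; exact le_max_right _ _
  have hlt : |y - c| < |x - c| := by linarith [abs_nonneg (y - c)]
  obtain ⟨s1, s2, s3, s4, -, s6, -, -, -, -, s⟩ := h.sideData hF hp hm hδ.le hx hlt hs
  set a := |φ x|
  set b := |φ y|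
  have hba : b / a ≤ t₀ := by
    rw [div_le_iff₀ s3]
    rw [div_mul_eq_mul_div, div_le_iff₀ (by positivity)] at hyQ
    have := mul_le_mul_of_nonneg_left s4 t0.le
    linarith
  have hba2 : 2 * b ≤ a := by
    have := hba.trans (min_le_left _ _)
    rw [div_le_iff₀ s3] at this
    linarith
  have h0 : 0 ≤ b / a := by positivity
  have h1 : 0 ≤ (b / a) ^ (p - 1) := Real.rpow_nonneg h0 _
  have key := s (4 * p ^ 2 * (b / a) ^ (p - 1)) (by positivity) (rpow_pair_far hp s1 hba2 s3)
  refine key.mono ?_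
  have h2 : |y - x| ≤ 2 * δ := by
    have h3 := abs_sub_le y c x
    rw [abs_sub_comm c x] at h3
    linarith
  have h4 : (y - x) ^ 2 ≤ (2 * δ) ^ 2 := by
    rw [← sq_abs]; exact pow_le_pow_left₀ (abs_nonneg _) h2 2
  calc 4 * p ^ 2 * (b / a) ^ (p - 1) * Real.exp (C * (y - x) ^ 2)
      ≤ 4 * p ^ 2 * t₀ ^ (p - 1) * Real.exp (C * (2 * δ) ^ 2) := by gcongr
    _ = t₀ ^ (p - 1) * E := by rw [hE]; ring
    _ ≤ ε := ht1

lemma growth (h : CritChart F c p δ m M C φ) (hF : StrictMono F) (hp : 1 < p) (hm : 0 < m)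
    (hM : 0 < M) (hδ : 0 < δ) : ∃ K, ∀ x y, |x - c| ≤ δ → |y - c| < |x - c| →
      0 ≤ (x - c) * (y - c) → |F y - F x| * |x - c| ≤ K * |y - x| * |F c - F x| := by
  refine ⟨M * p * M / m * M, fun x y hx hyx hs => ?_⟩
  obtain ⟨s1, s2, s3, s4, -, -, -, s8, s9, s10, -⟩ := h.sideData hF hp hm hδ.le hx hyx hs
  set a := |φ x|
  set b := |φ y|
  have h1 := rpow_sub_le hp s1 s3
  have ap : 0 < a ^ (p - 1) := Real.rpow_pos_of_pos s3 _
  calc |F y - F x| * |x - c| ≤ (M * (p * a ^ (p - 1) * (M * |y - x|))) * (a / m) := by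
        gcongr
        · refine s9.trans ?_
          gcongr
          refine h1.trans ?_
          gcongr
        · rw [le_div_iff₀ hm]; linarith
    _ = M * p * M / m * |y - x| * (a ^ (p - 1) * a) := by ring
    _ = M * p * M / m * |y - x| * a ^ p := by rw [rpow_sub_one_mul s3]
    _ ≤ M * p * M / m * |y - x| * (M * |F c - F x|) := by gcongr
    _ = _ := by ring

end CritChart

lemma exists_uniform_fin {n : ℕ} {P : Fin n → ℝ → ℝ → Prop}
    (mono : ∀ i δ C δ' C', P i δ C → 0 < δ' → δ' ≤ δ → C ≤ C' → P i δ' C')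
    (h : ∀ i, ∃ δ C, 0 < δ ∧ P i δ C) : ∃ δ C, 0 < δ ∧ ∀ i, P i δ C := by
  choose δ C hδ hP using h
  have h1 : ∀ᶠ d in nhdsWithin (0 : ℝ) (Ioi 0), ∀ i, d ≤ δ i :=
    eventually_all.2 fun i => mem_of_superset (Ioc_mem_nhdsGT (hδ i)) fun d hd => hd.2
  have h2 : ∀ᶠ c in atTop, ∀ i, C i ≤ c := eventually_all.2 fun i => eventually_ge_atTop (C i)
  obtain ⟨d, hd, hd0⟩ := (h1.and self_mem_nhdsWithin).exists
  obtain ⟨c, hc⟩ := h2.exists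
  exact ⟨d, c, hd0, fun i => mono i _ _ _ _ (hP i) hd0 (hd i) (hc i)⟩

lemma exists_bound_of_periodic {u : ℝ → ℝ} (hu : Continuous u) (hp : ∀ x, u (x + 1) = u x) :
    ∃ B, 0 < B ∧ ∀ x, |u x| ≤ B := by
  obtain ⟨B, hB⟩ := isCompact_Icc.exists_bound_of_continuousOn (s := Icc (0 : ℝ) 1) hu.continuousOn
  refine ⟨max B 1, by positivity, fun x => ?_⟩
  obtain ⟨y, hy, e⟩ := (show Function.Periodic u 1 from hp).exists_mem_Ico₀ one_pos x
  rw [e]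
  exact (hB y ⟨hy.1, hy.2.le⟩).trans (le_max_left _ _)

lemma deriv_add_one {g : ℝ → ℝ} {a : ℝ} (h : ∀ x, g (x + 1) = g x + a) (x : ℝ) :
    deriv g (x + 1) = deriv g x := by
  rw [← deriv_comp_add_const, show (fun x => g (x + 1)) = fun x => g x + a from funext h,
    deriv_add_const]

namespace MulticriticalCircleMap

variable (f : MulticriticalCircleMap)

lemma lift_add_int (x : ℝ) (k : ℤ) : f.lift (x + k) = f.lift x + k := by
  have hper : Function.Periodic (fun x => f.lift x - x) 1 := fun x => by
    simp only [f.lift_add_one]; ring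
  have := hper.int_mul k x
  simp only [mul_one] at this
  linarith

lemma deriv_add_int (x : ℝ) (k : ℤ) : deriv f.lift (x + k) = deriv f.lift x := by
  have := (show Function.Periodic (deriv f.lift) 1 from deriv_add_one f.lift_add_one).int_mul k x
  simpa using this

lemma pairBound_add_int {K x y : ℝ} (k : ℤ) (h : PairBound f.lift K (x - k) (y - k)) :
    PairBound f.lift K x y := by
  unfold PairBound at *
  rw [← f.deriv_add_int (x - k) k, ← f.deriv_add_int (y - k) k] at h
  have h1 := f.lift_add_int (x - k) k
  have h2 := f.lift_add_int (y - k) k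
  rw [sub_add_cancel] at h h1 h2
  rw [sub_add_cancel] at h
  rw [h1, h2]
  convert h using 2 <;> ring

lemma exists_chart (i : Fin f.N) : ∃ φ δ m M C, 0 < δ ∧ 0 < m ∧ 0 < M ∧ 0 ≤ C ∧
    CritChart f.lift (f.crit i) (f.critExp i) δ m M C φ :=
  exists_critChart (f.critExp_gt_one i) f.smooth (f.crit_powerLaw i)

lemma exists_cross : ∃ δ K, 0 < δ ∧ ∀ i x y, |x - f.crit i| ≤ δ → |y - f.crit i| ≤ δ →
    x < f.crit i → f.crit i < y → PairBound f.lift K x y := by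
  obtain ⟨δ, K, h0, h⟩ := exists_uniform_fin (n := f.N) (P := fun i δ K => ∀ x y,
    |x - f.crit i| ≤ δ → |y - f.crit i| ≤ δ → x < f.crit i → f.crit i < y →
      PairBound f.lift K x y)
    (fun i δ C δ' C' h _ h2 h3 x y hx hy hxc hcy =>
      (h x y (hx.trans h2) (hy.trans h2) hxc hcy).mono h3) (fun i => by
    obtain ⟨φ, δ, m, M, C, hδ, hm, hM, hC, hc⟩ := f.exists_chart i
    exact ⟨δ, _, hδ, fun x y hx hy hxc hcy =>
      hc.pair_cross (f.critExp_gt_one i) hm hC hδ.le hx hy hxc hcy⟩)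
  exact ⟨δ, K, h0, h⟩

lemma exists_side : ∃ δ C, 0 < δ ∧ ∀ i x y, |x - f.crit i| ≤ δ → |y - f.crit i| ≤ δ →
    x < y → f.crit i ∉ Ioo x y → PairBound f.lift (Real.exp (C * (y - x) ^ 2)) x y := by
  obtain ⟨δ, K, h0, h⟩ := exists_uniform_fin (n := f.N) (P := fun i δ C => ∀ x y,
    |x - f.crit i| ≤ δ → |y - f.crit i| ≤ δ → x < y → f.crit i ∉ Ioo x y →
      PairBound f.lift (Real.exp (C * (y - x) ^ 2)) x y)
    (fun i δ C δ' C' h _ h2 h3 x y hx hy hxc hcy =>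
      (h x y (hx.trans h2) (hy.trans h2) hxc hcy).mono (by gcongr)) (fun i => by
    obtain ⟨φ, δ, m, M, C, hδ, hm, hM, hC, hc⟩ := f.exists_chart i
    refine ⟨δ, C, hδ, fun x y hx hy hxy hn => ?_⟩
    have hp := f.critExp_gt_one i
    by_cases hcx : f.crit i ≤ x
    · have := (hc.pair_side f.lift_strictMono hp hm hδ.le hy (y := x) (by
        rw [abs_of_nonneg (by linarith), abs_of_pos (by linarith)]; linarith)
        (mul_nonneg (by linarith) (by linarith))).symm
      rwa [show (x - y) ^ 2 = (y - x) ^ 2 by ring] at this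
    · have hyc : y ≤ f.crit i := by
        by_contra h'
        exact hn ⟨by linarith, by linarith⟩
      exact hc.pair_side f.lift_strictMono hp hm hδ.le hx (by
        rw [abs_of_nonpos (by linarith), abs_of_neg (by linarith)]; linarith)
        (mul_nonneg_of_nonpos_of_nonpos (by linarith) (by linarith)))
  exact ⟨δ, K, h0, h⟩

lemma exists_contraction : ∃ κ δ, 0 < κ ∧ 0 < δ ∧ ∀ i x y, |x - f.crit i| ≤ δ →
    |y - f.crit i| < |x - f.crit i| → 0 ≤ (x - f.crit i) * (y - f.crit i) →
    PairBound f.lift (Real.exp (-(κ * ((y - x) / (x - f.crit i)) ^ 2))) x y := by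
  obtain ⟨δ, K, h0, h⟩ := exists_uniform_fin (n := f.N) (P := fun i δ C => 0 < C ∧ ∀ x y,
    |x - f.crit i| ≤ δ → |y - f.crit i| < |x - f.crit i| →
    0 ≤ (x - f.crit i) * (y - f.crit i) →
    PairBound f.lift (Real.exp (-(1 / C * ((y - x) / (x - f.crit i)) ^ 2))) x y)
    (fun i δ C δ' C' h _ h2 h3 => ⟨h.1.trans_le h3, fun x y hx hy hxc =>
      (h.2 x y (hx.trans h2) hy hxc).mono (by
        rw [Real.exp_le_exp, neg_le_neg_iff]
        have := h.1
        gcongr)⟩) (fun i => by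
    obtain ⟨φ, δ, m, M, C, hδ, hm, hM, hC, hc⟩ := f.exists_chart i
    obtain ⟨κ, δ', hκ, hδ', h⟩ := hc.contraction f.lift_strictMono (f.critExp_gt_one i) hm hM hC hδ
    exact ⟨δ', 1 / κ, hδ', by positivity, by simpa using h⟩)
  by_cases hK : 0 < K
  · exact ⟨1 / K, δ, by positivity, h0, fun i => (h i).2⟩
  · exact absurd (h ⟨0, f.N_pos⟩).1 hK

lemma exists_far {ε : ℝ} (hε : 0 < ε) : ∃ Q δ, 1 < Q ∧ 0 < δ ∧ ∀ i x y, |x - f.crit i| ≤ δ →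
    Q * |y - f.crit i| ≤ |x - f.crit i| → 0 ≤ (x - f.crit i) * (y - f.crit i) →
    PairBound f.lift ε x y := by
  obtain ⟨δ, K, h0, h⟩ := exists_uniform_fin (n := f.N) (P := fun i δ C => 1 < C ∧ ∀ x y,
    |x - f.crit i| ≤ δ → C * |y - f.crit i| ≤ |x - f.crit i| →
    0 ≤ (x - f.crit i) * (y - f.crit i) → PairBound f.lift ε x y)
    (fun i δ C δ' C' h _ h2 h3 => ⟨h.1.trans_le h3, fun x y hx hy hxc =>
      (h.2 x y (hx.trans h2) (le_trans (by gcongr) hy) hxc)⟩) (fun i => by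
    obtain ⟨φ, δ, m, M, C, hδ, hm, hM, hC, hc⟩ := f.exists_chart i
    obtain ⟨Q, hQ, h⟩ := hc.far f.lift_strictMono (f.critExp_gt_one i) hm hC hδ hε
    exact ⟨δ, Q, hδ, hQ, h⟩)
  exact ⟨K, δ, (h ⟨0, f.N_pos⟩).1, h0, fun i => (h i).2⟩

lemma exists_growth : ∃ C δ, 0 < δ ∧ ∀ i x y, |x - f.crit i| ≤ δ →
    |y - f.crit i| < |x - f.crit i| → 0 ≤ (x - f.crit i) * (y - f.crit i) →
    |f.lift y - f.lift x| * |x - f.crit i| ≤ C * |y - x| * |f.lift (f.crit i) - f.lift x| := by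
  obtain ⟨δ, K, h0, h⟩ := exists_uniform_fin (n := f.N) (P := fun i δ C => ∀ x y,
    |x - f.crit i| ≤ δ → |y - f.crit i| < |x - f.crit i| →
    0 ≤ (x - f.crit i) * (y - f.crit i) →
    |f.lift y - f.lift x| * |x - f.crit i| ≤ C * |y - x| * |f.lift (f.crit i) - f.lift x|)
    (fun i δ C δ' C' h _ h2 h3 x y hx hy hxc =>
      (h x y (hx.trans h2) hy hxc).trans (by gcongr)) (fun i => by
    obtain ⟨φ, δ, m, M, C, hδ, hm, hM, hC, hc⟩ := f.exists_chart i
    obtain ⟨K, h⟩ := hc.growth f.lift_strictMono (f.critExp_gt_one i) hm hM hδ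
    exact ⟨δ, K, hδ, h⟩)
  exact ⟨K, δ, h0, h⟩

lemma exists_deriv_ge {η : ℝ} (hη : 0 < η) : ∃ m, 0 < m ∧ ∀ t,
    (∀ i (k : ℤ), η ≤ |t - (f.crit i + k)|) → m ≤ deriv f.lift t := by
  set G : Set ℝ := {t | ∀ i (k : ℤ), η ≤ |t - (f.crit i + k)|} with hG
  have hcl : IsClosed G := by
    simp only [hG, ofPred_forall]
    exact isClosed_iInter fun i => isClosed_iInter fun k =>
      isClosed_le continuous_const (by fun_prop)
  have hF1 : Continuous (deriv f.lift) := f.smooth.continuous_deriv (by norm_num)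
  have hpos : ∀ t ∈ G, 0 < deriv f.lift t := by
    intro t ht
    refine lt_of_le_of_ne f.lift_strictMono.monotone.deriv_nonneg fun h => ?_
    obtain ⟨i, k, e⟩ := f.crit_complete t h.symm
    have := ht i k
    rw [e] at this
    simp at this
    linarith
  have key : ∃ m, 0 < m ∧ ∀ t ∈ Icc (0 : ℝ) 1 ∩ G, m ≤ deriv f.lift t := by
    rcases (Icc (0 : ℝ) 1 ∩ G).eq_empty_or_nonempty with he | hne
    · exact ⟨1, one_pos, by simp [he]⟩
    · obtain ⟨t, ht, hmin⟩ := (isCompact_Icc.inter_right hcl).exists_isMinOn hne hF1.continuousOn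
      exact ⟨_, hpos t ht.2, fun s hs => hmin hs⟩
  obtain ⟨m, hm, h⟩ := key
  refine ⟨m, hm, fun t ht => ?_⟩
  have e := f.deriv_add_int (Int.fract t) ⌊t⌋
  rw [Int.fract_add_floor] at e
  rw [e]
  refine h _ ⟨⟨Int.fract_nonneg t, (Int.fract_lt_one t).le⟩, fun i k => ?_⟩
  have := ht i (k + ⌊t⌋)
  push_cast at this
  rwa [show t - (f.crit i + (k + ⌊t⌋)) = Int.fract t - (f.crit i + k) by
    rw [← Int.self_sub_floor]; ring] at this

lemma exists_pair_away {η : ℝ} (hη : 0 < η) : ∃ C, ∀ x y, x < y →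
    (∀ t ∈ Icc x y, ∀ i (k : ℤ), η ≤ |t - (f.crit i + k)|) →
    PairBound f.lift (Real.exp (C * (y - x) ^ 2)) x y := by
  obtain ⟨m, hm, hmk⟩ := f.exists_deriv_ge hη
  have c1 : ContDiff ℝ 2 (deriv f.lift) := by
    have := (contDiff_succ_iff_deriv (n := 2) (f := f.lift)).1 (by
      rw [show ((2 : WithTop ℕ∞) + 1) = 3 by norm_num]; exact f.smooth)
    exact this.2.2
  have c2 : ContDiff ℝ 1 (deriv (deriv f.lift)) := by
    have := (contDiff_succ_iff_deriv (n := 1) (f := deriv f.lift)).1 (by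
      rw [show ((1 : WithTop ℕ∞) + 1) = 2 by norm_num]; exact c1)
    exact this.2.2
  have c3 : Continuous (deriv (deriv (deriv f.lift))) := c2.continuous_deriv le_rfl
  have p1 := deriv_add_one f.lift_add_one
  have p2 := deriv_add_one (g := deriv f.lift) (a := 0) (by simpa using p1)
  have p3 := deriv_add_one (g := deriv (deriv f.lift)) (a := 0) (by simpa using p2)
  obtain ⟨M, M0, hM⟩ := exists_bound_of_periodic c1.continuous p1
  obtain ⟨B1, B10, hB1⟩ := exists_bound_of_periodic c2.continuous p2
  obtain ⟨B2, B20, hB2⟩ := exists_bound_of_periodic c3 p3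
  refine ⟨_, fun x y hxy hG => (pair_of_third (M := M) (B := max B1 B2) (m := m) hxy hm
    (fun t _ => (f.smooth.differentiable (by norm_num) t).hasDerivAt)
    (fun t _ => (c1.differentiable (by norm_num) t).hasDerivAt)
    (fun t _ => (c2.differentiable (by norm_num) t).hasDerivAt)
    (fun t ht => hmk t (hG t ht))
    (fun t _ => (le_abs_self _).trans (hM t))
    (fun t _ => (hB1 t).trans (le_max_left _ _))
    (fun t _ => (hB2 t).trans (le_max_right _ _))).2.2.1⟩

lemma exists_pair_short : ∃ C δ, 0 < δ ∧ ∀ x y, x < y → y - x ≤ δ →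
    (∀ i (k : ℤ), f.crit i + k ∉ Ioo x y) →
    PairBound f.lift (Real.exp (C * (y - x) ^ 2)) x y := by
  obtain ⟨δ, C, hδ, h⟩ := f.exists_side
  obtain ⟨C', h'⟩ := f.exists_pair_away (half_pos hδ)
  refine ⟨max C C', δ / 2, half_pos hδ, fun x y hxy hs hn => ?_⟩
  by_cases hG : ∀ t ∈ Icc x y, ∀ i (k : ℤ), δ / 2 ≤ |t - (f.crit i + k)|
  · refine (h' x y hxy hG).mono ?_
    gcongr; exact le_max_right _ _
  · push Not at hG
    obtain ⟨t, ht, i, k, hk⟩ := hG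
    apply f.pairBound_add_int k
    have hk := abs_lt.1 hk
    refine (h i (x - k) (y - k) ?_ ?_ (by linarith) ?_).mono ?_
    · rw [abs_le]; constructor <;> linarith [ht.1, ht.2]
    · rw [abs_le]; constructor <;> linarith [ht.1, ht.2]
    · intro hI
      exact hn i k ⟨by linarith [hI.1], by linarith [hI.2]⟩
    · rw [show y - k - (x - k) = y - x by ring]
      gcongr; exact le_max_left _ _

lemma exists_pair : ∃ K, ∀ x y, x < y → y ≤ x + 1 → PairBound f.lift K x y := by
  obtain ⟨δ, K, hδ, h⟩ := f.exists_cross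
  obtain ⟨C, δ', hδ', h'⟩ := f.exists_pair_short
  set η := min δ δ' with hη
  have η0 : 0 < η := lt_min hδ hδ'
  have hF1 : Continuous (deriv f.lift) := f.smooth.continuous_deriv (by norm_num)
  obtain ⟨L, L0, hL⟩ := exists_bound_of_periodic hF1 (deriv_add_one f.lift_add_one)
  obtain ⟨μ, μ0, hμ⟩ : ∃ μ, 0 < μ ∧ ∀ x, μ ≤ f.lift (x + η) - f.lift x := by
    have hc : Continuous fun x => f.lift (x + η) - f.lift x := by
      have := f.lift_continuous
      fun_prop
    obtain ⟨t, ht, hmin⟩ := (isCompact_Icc (a := (0 : ℝ)) (b := 1)).exists_isMinOn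
      (nonempty_Icc.2 zero_le_one) hc.continuousOn
    refine ⟨_, sub_pos.2 (f.lift_strictMono (show t < t + η by linarith)), fun x => ?_⟩
    obtain ⟨z, hz, e⟩ := (show Function.Periodic (fun x => f.lift (x + η) - f.lift x) 1 from
      fun x => by
        simp only
        rw [show x + 1 + η = x + η + 1 by ring, f.lift_add_one, f.lift_add_one]; ring
      ).exists_mem_Ico₀ one_pos x
    rw [e]
    exact hmin ⟨hz.1, hz.2.le⟩
  refine ⟨max K (max (Real.exp (|C| * η ^ 2)) (L ^ 2 / μ ^ 2)), fun x y hxy hy1 => ?_⟩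
  have hs0 : 0 < y - x := by linarith
  rcases lt_or_ge (y - x) η with hs | hs
  · by_cases hn : ∀ i (k : ℤ), f.crit i + k ∉ Ioo x y
    · refine (h' x y hxy (hs.le.trans (min_le_right _ _)) hn).mono ?_
      refine le_trans ?_ ((le_max_left _ _).trans (le_max_right _ _))
      gcongr
      exact le_abs_self C
    · push Not at hn
      obtain ⟨i, k, hk⟩ := hn
      apply f.pairBound_add_int k
      have := hs.trans_le (min_le_left _ _)
      refine (h i _ _ ?_ ?_ ?_ ?_).mono (le_max_left _ _)
      · rw [abs_le]; constructor <;> linarith [hk.1, hk.2]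
      · rw [abs_le]; constructor <;> linarith [hk.1, hk.2]
      · linarith [hk.1]
      · linarith [hk.2]
  · refine PairBound.mono (k := L ^ 2 / μ ^ 2) ?_ ((le_max_right _ _).trans (le_max_right _ _))
    unfold PairBound
    have h1 : μ ≤ f.lift y - f.lift x := (hμ x).trans (by
      have := f.lift_strictMono.monotone (show x + η ≤ y by linarith)
      linarith)
    have h2 : deriv f.lift x * deriv f.lift y ≤ L * L :=
      mul_le_mul ((le_abs_self _).trans (hL x)) ((le_abs_self _).trans (hL y))
        f.lift_strictMono.monotone.deriv_nonneg L0.le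
    have h3 : (y - x) ^ 2 ≤ 1 := by nlinarith
    calc deriv f.lift x * deriv f.lift y * (y - x) ^ 2 ≤ (L * L) * 1 := by gcongr
      _ = L ^ 2 / μ ^ 2 * μ ^ 2 := by field_simp
      _ ≤ _ := by gcongr

/-- The analytic package of a multicritical circle map together with a semiconjugacy to a
rotation. -/
def toCData {h : ℝ → ℝ} {β : ℝ} (hβ : Irrational β) (hm : Monotone h) (hc : Continuous h)
    (h1 : ∀ x, h (x + 1) = h x + 1) (hF : ∀ x, h (f.lift x) = h x + β) : CData where
  F := f.lift
  diff := f.smooth.differentiable (by norm_num)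
  mono := f.lift_strictMono
  add_one := f.lift_add_one
  N := f.N
  N_pos := f.N_pos
  crit := f.crit
  d1 := f.exists_pair
  d2 := f.exists_pair_short
  d3 := f.exists_contraction
  d4 _ hε := f.exists_far hε
  d5 := f.exists_growth
  h := h
  β := β
  β_irr := hβ
  h_mono := hm
  h_cont := hc
  h_add_one := h1
  h_F := hF

end MulticriticalCircleMap

lemma PairBound.reflect {F : ℝ → ℝ} {k x y : ℝ} (h : PairBound F k (-x) (-y)) :
    PairBound (fun t => -F (-t)) k x y := by
  unfold PairBound at *
  have e : ∀ t, deriv (fun t => -F (-t)) t = deriv F (-t) := fun t => by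
    rw [deriv.fun_neg, deriv_comp_neg, neg_neg]
  rw [e, e]
  linarith

namespace CData

/-- Conjugation of all data by `x ↦ -x`. -/
def reflect (D : CData) : CData where
  F := fun t => -D.F (-t)
  diff := (D.diff.comp differentiable_neg).neg
  mono := fun x y hxy => neg_lt_neg (D.mono (neg_lt_neg hxy))
  add_one := fun x => by
    have := D.add_one (-(x + 1))
    rw [show -(x + 1) + 1 = -x by ring] at this
    linarith
  N := D.N
  N_pos := D.N_pos
  crit := fun i => -D.crit i
  d1 := by
    obtain ⟨K, h⟩ := D.d1
    exact ⟨K, fun x y hxy hy => (h (-y) (-x) (by linarith) (by linarith)).symm.reflect⟩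
  d2 := by
    obtain ⟨C, δ, hδ, h⟩ := D.d2
    refine ⟨C, δ, hδ, fun x y hxy hy hc => PairBound.reflect (PairBound.symm ?_)⟩
    have := h (-y) (-x) (by linarith) (by linarith) (fun i k hk => hc i (-k) ?_)
    · rwa [show -x - -y = y - x by ring] at this
    · push_cast
      constructor <;> linarith [hk.1, hk.2]
  d3 := by
    obtain ⟨κ, δ, hκ, hδ, h⟩ := D.d3
    refine ⟨κ, δ, hκ, hδ, fun i x y hx hy hxy => PairBound.reflect ?_⟩
    have e : ∀ t, -t - D.crit i = -(t - -D.crit i) := fun t => by ring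
    have := h i (-x) (-y) (by rw [e, abs_neg]; exact hx)
      (by rw [e, e, abs_neg, abs_neg]; exact hy) (by rw [e, e, neg_mul_neg]; exact hxy)
    rwa [e, show -y - -x = -(y - x) by ring, neg_div_neg_eq] at this
  d4 := fun ε hε => by
    obtain ⟨Q, δ, hQ, hδ, h⟩ := D.d4 ε hε
    refine ⟨Q, δ, hQ, hδ, fun i x y hx hy hxy => PairBound.reflect ?_⟩
    have e : ∀ t, -t - D.crit i = -(t - -D.crit i) := fun t => by ring
    exact h i (-x) (-y) (by rw [e, abs_neg]; exact hx)
      (by rw [e, e, abs_neg, abs_neg]; exact hy) (by rw [e, e, neg_mul_neg]; exact hxy)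
  d5 := by
    obtain ⟨C, δ, hδ, h⟩ := D.d5
    refine ⟨C, δ, hδ, fun i x y hx hy hxy => ?_⟩
    have e : ∀ t, -t - D.crit i = -(t - -D.crit i) := fun t => by ring
    have := h i (-x) (-y) (by rw [e, abs_neg]; exact hx)
      (by rw [e, e, abs_neg, abs_neg]; exact hy) (by rw [e, e, neg_mul_neg]; exact hxy)
    rw [e, abs_neg, show -y - -x = -(y - x) by ring, abs_neg] at this
    rw [neg_neg, show -D.F (-y) - -D.F (-x) = -(D.F (-y) - D.F (-x)) by ring, abs_neg,
      show -D.F (D.crit i) - -D.F (-x) = -(D.F (D.crit i) - D.F (-x)) by ring, abs_neg]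
    exact this
  h := fun t => -D.h (-t)
  β := -D.β
  β_irr := D.β_irr.neg
  h_mono := fun x y hxy => neg_le_neg (D.h_mono (neg_le_neg hxy))
  h_cont := (D.h_cont.comp continuous_neg).neg
  h_add_one := fun x => by
    have := D.h_add_one (-(x + 1))
    rw [show -(x + 1) + 1 = -x by ring] at this
    linarith
  h_F := fun x => by
    rw [neg_neg, D.h_F]; ring

lemma reflect_iter (D : CData) (i : ℕ) (x : ℝ) : D.reflect.F^[i] x = -D.F^[i] (-x) := by
  induction i generalizing x with
  | zero => simp
  | succ n ih =>
    rw [Function.iterate_succ_apply, Function.iterate_succ_apply, ih]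
    simp [reflect]

lemma strictMono_of_reflect (D : CData) (hs : StrictMono D.reflect.h) : StrictMono D.h := by
  intro x y hxy
  have := hs (neg_lt_neg hxy)
  simp only [reflect, neg_neg] at this
  linarith

/-- Very good rational approximations of the rotation number by one-sided fractions. -/
def Liouvillean (D : CData) (τ : ℝ) : Prop :=
  ∀ γ > 0, ∃ (q : ℕ) (p : ℤ), 0 < q ∧ IsCoprime (q : ℤ) p ∧ 0 < q * D.β - p ∧
    q * D.β - p < γ / (q : ℝ) ^ (τ + 1)

lemma Liouvillean.posApprox {D : CData} {τ : ℝ} (hτ : 0 < τ) (h : D.Liouvillean τ) :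
    D.PosApprox := by
  intro ε hε
  obtain ⟨q, p, hq, hc, h0, h1⟩ := h ε hε
  refine ⟨q, p, hq, hc, h0, h1.trans_le ?_⟩
  have hq1 : (1 : ℝ) ≤ q := by exact_mod_cast hq
  gcongr
  exact Real.self_le_rpow_of_one_le hq1 (by linarith)

lemma Liouvillean.exists_ge {D : CData} {τ : ℝ} (h : D.Liouvillean τ) (q₀ : ℕ) :
    ∀ γ > 0, ∃ (q : ℕ) (p : ℤ), q₀ ≤ q ∧ 0 < q ∧ IsCoprime (q : ℤ) p ∧ 0 < q * D.β - p ∧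
      q * D.β - p < γ / (q : ℝ) ^ (τ + 1) := by
  intro γ hγ
  have hpos : ∀ q : ℕ, 0 < q → 0 < Int.fract (q * D.β) := by
    intro q hq
    apply Int.fract_pos.2
    have := (D.β_irr.natCast_mul hq.ne').ne_int ⌊(q : ℝ) * D.β⌋
    exact this
  have key : ∃ γ₀ > 0, ∀ q : ℕ, 0 < q → q < q₀ →
      γ₀ ≤ Int.fract (q * D.β) * (q : ℝ) ^ (τ + 1) := by
    induction q₀ with
    | zero => exact ⟨1, one_pos, fun q _ h => absurd h (Nat.not_lt_zero _)⟩
    | succ n ih =>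
      obtain ⟨g, hg, H⟩ := ih
      rcases Nat.eq_zero_or_pos n with rfl | hn
      · exact ⟨1, one_pos, fun q h1 h2 => by omega⟩
      refine ⟨min g (Int.fract (n * D.β) * (n : ℝ) ^ (τ + 1)),
        lt_min hg (mul_pos (hpos n hn) (Real.rpow_pos_of_pos (by exact_mod_cast hn) _)),
        fun q h1 h2 => ?_⟩
      rcases Nat.lt_succ_iff_lt_or_eq.1 h2 with h | rfl
      · exact (min_le_left _ _).trans (H q h1 h)
      · exact min_le_right _ _
  obtain ⟨γ₀, hγ₀, H⟩ := key
  obtain ⟨q, p, hq, hc, h0, h1⟩ := h (min γ γ₀) (lt_min hγ hγ₀)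
  have hqp : 0 < (q : ℝ) ^ (τ + 1) := Real.rpow_pos_of_pos (by exact_mod_cast hq) _
  refine ⟨q, p, ?_, hq, hc, h0, h1.trans_le ?_⟩
  · by_contra hlt
    push Not at hlt
    have h2 := H q hq hlt
    rw [lt_div_iff₀ hqp] at h1
    have h3 : Int.fract (q * D.β) ≤ q * D.β - p := by
      have : p ≤ ⌊(q : ℝ) * D.β⌋ := Int.le_floor.2 (by linarith)
      have : (p : ℝ) ≤ ⌊(q : ℝ) * D.β⌋ := by exact_mod_cast this
      rw [Int.fract]; linarith
    have := mul_le_mul_of_nonneg_right h3 hqp.le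
    linarith [min_le_right γ γ₀]
  · gcongr
    exact min_le_left _ _

end CData

/-- A number outside `D_τ` has coprime approximations with arbitrarily small constants. -/
lemma exists_coprime_approx {α β τ : ℝ} (hα : Int.fract β = α)
    (hτ : 0 < τ) (hD : α ∉ DiophTau τ) : ∀ γ > 0, ∃ (q : ℕ) (p : ℤ), 0 < q ∧
      IsCoprime (q : ℤ) p ∧ |q * β - p| < γ / (q : ℝ) ^ (τ + 1) := by
  intro γ hγ
  have h : α ∉ DiophClass γ τ := fun h => hD ⟨γ, hγ, h⟩
  simp only [DiophClass, mem_ofPred_eq, not_forall, not_le] at h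
  obtain ⟨p, q, hq, h⟩ := h
  set r : ℚ := (p + ⌊β⌋ * q : ℤ) / (q : ℤ) with hr
  have hrd : (r.den : ℤ) ∣ q := by
    rw [hr, ← Rat.divInt_eq_div]
    exact Rat.den_dvd _ _
  have hdpos : 0 < r.den := r.den_pos
  have hle : (r.den : ℝ) ≤ |(q : ℝ)| := by
    have := Int.le_of_dvd (abs_pos.2 hq) ((dvd_abs _ _).2 hrd)
    exact_mod_cast this
  have hd0 : (0 : ℝ) < r.den := by exact_mod_cast hdpos
  refine ⟨r.den, r.num, hdpos, ?_, ?_⟩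
  · rw [Int.isCoprime_iff_gcd_eq_one, Int.gcd_comm]
    exact r.reduced
  · have e : (r.den : ℝ) * β - r.num = r.den * (α - p / q) := by
      have e1 : (r.num : ℝ) = r.den * r := by
        have := Rat.den_mul_eq_num r
        exact_mod_cast this.symm
      have e2 : (r : ℝ) = p / q + ⌊β⌋ := by
        have hq' : (q : ℝ) ≠ 0 := by exact_mod_cast hq
        rw [hr]; push_cast; field_simp
      rw [e1, e2, ← hα, Int.fract]; ring
    rw [e, abs_mul, abs_of_pos hd0, show τ + 1 = (τ + 2) - 1 by ring, Real.rpow_sub_one hd0.ne',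
      div_div_eq_mul_div, mul_comm γ, mul_div_assoc]
    gcongr
    refine h.trans_le ?_
    gcongr

namespace CData

lemma liouvillean_or_reflect {D : CData} {τ : ℝ}
    (h : ∀ γ > 0, ∃ (q : ℕ) (p : ℤ), 0 < q ∧ IsCoprime (q : ℤ) p ∧
      |q * D.β - p| < γ / (q : ℝ) ^ (τ + 1)) :
    D.Liouvillean τ ∨ D.reflect.Liouvillean τ := by
  by_contra hcon
  simp only [not_or, Liouvillean, not_forall] at hcon
  obtain ⟨⟨γ₁, h1, n1⟩, ⟨γ₂, h2, n2⟩⟩ := hcon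
  obtain ⟨q, p, hq, hc, hlt⟩ := h (min γ₁ γ₂) (lt_min h1 h2)
  have hne : (q : ℝ) * D.β - p ≠ 0 :=
    sub_ne_zero.2 ((D.β_irr.natCast_mul hq.ne').ne_int p)
  rcases lt_or_gt_of_ne hne with hs | hs
  · refine n2 ⟨q, -p, hq, hc.neg_right, ?_, ?_⟩
    · simp only [reflect]; push_cast; linarith
    · rw [abs_of_neg hs] at hlt
      have : (q : ℝ) * D.reflect.β - (-p : ℤ) = -(q * D.β - p) := by
        simp only [reflect]; push_cast; ring
      rw [this]
      refine hlt.trans_le ?_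
      gcongr
      exact min_le_right _ _
  · refine n1 ⟨q, p, hq, hc, hs, ?_⟩
    rw [abs_of_pos hs] at hlt
    refine hlt.trans_le ?_
    gcongr
    exact min_le_left _ _

/-- Arcs whose images are disjoint, fill a definite proportion of the circle as seen by `h`, and
have arbitrarily small total `s`-content. -/
def SmallArcs (D : CData) (t : ℝ) : Prop :=
  ∃ c > 0, ∀ s, t < s → s < 1 → ∀ ε > 0, ∃ q : ℕ, 0 < q ∧ ∃ a b, a ≤ b ∧
    c / q ≤ D.h b - D.h a ∧ D.h b - D.h a ≤ 1 / (4 * q) ∧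
    (∀ i : ℕ, 0 < i → i < q → ∀ k : ℤ, 1 / (2 * (q : ℝ)) ≤ |i * D.β - k|) ∧
    ∑ i ∈ Finset.range q, (D.F^[i] b - D.F^[i] a) ^ s ≤ ε

lemma SmallArcs.of_reflect {D : CData} {t : ℝ} (h : D.reflect.SmallArcs t) : D.SmallArcs t := by
  obtain ⟨c, hc, H⟩ := h
  refine ⟨c, hc, fun s hs hs1 ε hε => ?_⟩
  obtain ⟨q, hq, a, b, hab, h1, h2, h3, h4⟩ := H s hs hs1 ε hε
  have e : D.reflect.h b - D.reflect.h a = D.h (-a) - D.h (-b) := by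
    simp only [reflect]; ring
  rw [e] at h1 h2
  refine ⟨q, hq, -b, -a, by linarith, h1, h2, fun i hi hiq k => ?_, ?_⟩
  · refine (h3 i hi hiq (-k)).trans_eq ?_
    rw [← abs_neg]
    congr 1
    simp only [reflect]; push_cast; ring
  · refine le_trans (le_of_eq ?_) h4
    refine Finset.sum_congr rfl fun i _ => ?_
    rw [reflect_iter, reflect_iter]
    congr 1; ring

lemma Liouvillean.smallArcs {D : CData} {τ : ℝ} (hτ : 0 < τ) (h : D.Liouvillean τ) :
    D.SmallArcs (1 / (τ + 1)) := by
  have hs := D.h_strictMono (h.posApprox hτ)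
  obtain ⟨C, q₀, hC, H⟩ := exists_small_arcs hs
  set c : ℝ := 1 / (128 * (D.N + 1)) with hcdef
  have hc0 : 0 < c := by positivity
  have hc1 : c ≤ 1 / 2 := by
    rw [hcdef]
    apply one_div_le_one_div_of_le (by norm_num)
    have : (0 : ℝ) ≤ D.N := by positivity
    linarith
  refine ⟨c, hc0, fun s hst hs1 ε hε => ?_⟩
  have hs0 : 0 < s := lt_trans (by positivity) hst
  set σ := (1 - s) / (τ * s) with hσ
  have hσ0 : 0 < σ := div_pos (by linarith) (by positivity)
  have hσ1 : σ < 1 := by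
    rw [hσ, div_lt_one (by positivity)]
    rw [div_lt_iff₀ (by linarith)] at hst
    linarith
  set r := 1 - σ with hr
  have hr0 : 0 < r := by linarith
  set E := ε ^ (1 / s) with hE
  have hE0 : 0 < E := Real.rpow_pos_of_pos hε _
  set X := E * r / (2 * (C + 1)) with hX
  have hX0 : 0 < X := by positivity
  set γ := min c (X ^ (1 / σ)) with hγ
  have hγ0 : 0 < γ := lt_min hc0 (Real.rpow_pos_of_pos hX0 _)
  have hγσ : γ ^ σ ≤ X := by
    calc γ ^ σ ≤ (X ^ (1 / σ)) ^ σ := Real.rpow_le_rpow hγ0.le (min_le_right _ _) hσ0.le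
      _ = X := by rw [← Real.rpow_mul hX0.le, one_div_mul_cancel hσ0.ne', Real.rpow_one]
  obtain ⟨q, p, hqq, hq, hcop, hp0, hp1⟩ := h.exists_ge q₀ γ hγ0
  have hqR : (0 : ℝ) < q := by exact_mod_cast hq
  have hq1 : (1 : ℝ) ≤ q := by exact_mod_cast hq
  have hθ : q * D.β - p ≤ c / q := by
    refine hp1.le.trans ?_
    gcongr
    · exact min_le_left _ _
    · exact Real.self_le_rpow_of_one_le hq1 (by linarith)
  obtain ⟨a, b, hab, h1, h2, h3⟩ := H q p hqq hcop hp0 hθ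
  refine ⟨q, hq, a, b, hab, h1, h2, fun i hi hiq k => ?_, ?_⟩
  · refine approx_sep hq hcop hp0.le (hθ.trans ?_) hi hiq k
    rw [div_le_div_iff₀ hqR (by positivity)]
    nlinarith
  set u := q * (q * D.β - p) with hu
  have hu0 : 0 < u := mul_pos hqR hp0
  have hu1 : u ≤ 1 := by
    rw [le_div_iff₀ hqR] at hθ
    rw [hu, mul_comm]; linarith
  have huγ : u ≤ γ * (q : ℝ) ^ (-τ) := by
    have : (q : ℝ) * (γ / (q : ℝ) ^ (τ + 1)) = γ * (q : ℝ) ^ (-τ) := by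
      rw [Real.rpow_add_one hqR.ne', Real.rpow_neg hqR.le]
      field_simp
    rw [← this]
    exact mul_le_mul_of_nonneg_left hp1.le hqR.le
  have hlog : u * Real.log (1 + 1 / u) ≤ 2 / r * u ^ σ := by
    have l1 : Real.log (1 + 1 / u) ≤ Real.log (2 / u) := by
      apply Real.log_le_log (by positivity)
      rw [← sub_nonneg]
      have : 2 / u - (1 + 1 / u) = (1 - u) / u := by field_simp; ring
      rw [this]
      exact div_nonneg (by linarith) hu0.le
    have l2 : Real.log (2 / u) ≤ (2 / u) ^ r / r := Real.log_le_rpow_div (by positivity) hr0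
    have l3 : (2 / u) ^ r ≤ 2 * u ^ (-r) := by
      rw [Real.div_rpow (by norm_num) hu0.le, Real.rpow_neg hu0.le, div_eq_mul_inv]
      gcongr
      calc (2 : ℝ) ^ r ≤ 2 ^ (1 : ℝ) := Real.rpow_le_rpow_of_exponent_le (by norm_num) (by linarith)
        _ = 2 := Real.rpow_one 2
    have l4 : u ^ σ = u * u ^ (-r) := by
      rw [show σ = 1 + -r by simp only [hr]; ring, Real.rpow_add hu0, Real.rpow_one]
    rw [l4]
    calc u * Real.log (1 + 1 / u) ≤ u * (2 * u ^ (-r) / r) := by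
          gcongr
          exact (l1.trans l2).trans (by gcongr)
      _ = _ := by ring
  have huσ : u ^ σ ≤ X * (q : ℝ) ^ (-((1 - s) / s)) := by
    calc u ^ σ ≤ (γ * (q : ℝ) ^ (-τ)) ^ σ := Real.rpow_le_rpow hu0.le huγ hσ0.le
      _ = γ ^ σ * (q : ℝ) ^ (-((1 - s) / s)) := by
        rw [Real.mul_rpow hγ0.le (by positivity), ← Real.rpow_mul hqR.le]
        congr 2
        rw [hσ]; field_simp
      _ ≤ _ := by gcongr
  have hsum : ∑ i ∈ Finset.range q, (D.F^[i] b - D.F^[i] a) ≤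
      E * (q : ℝ) ^ (-((1 - s) / s)) := by
    refine h3.trans ?_
    calc C * (u * Real.log (1 + 1 / u)) ≤ C * (2 / r * (X * (q : ℝ) ^ (-((1 - s) / s)))) := by
          refine mul_le_mul_of_nonneg_left (hlog.trans ?_) hC
          gcongr
      _ = (C / (C + 1)) * (E * (q : ℝ) ^ (-((1 - s) / s))) := by
          rw [hX]; field_simp
      _ ≤ 1 * (E * (q : ℝ) ^ (-((1 - s) / s))) := by
          gcongr
          rw [div_le_one (by linarith)]; linarith
      _ = _ := one_mul _
  have hS : ∀ i, 0 ≤ D.F^[i] b - D.F^[i] a := fun i =>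
    sub_nonneg.2 ((D.iter_mono i).monotone hab)
  have hJ := Real.rpow_sum_le_const_mul_sum_rpow (p := 1 / s) (Finset.range q)
    (fun i => (D.F^[i] b - D.F^[i] a) ^ s) (by rw [le_div_iff₀ hs0]; linarith)
  have habs : ∀ i, |(D.F^[i] b - D.F^[i] a) ^ s| = (D.F^[i] b - D.F^[i] a) ^ s := fun i =>
    abs_of_nonneg (Real.rpow_nonneg (hS i) _)
  simp only [habs, Finset.card_range, ← Real.rpow_mul (hS _), mul_one_div_cancel hs0.ne',
    Real.rpow_one] at hJ
  have hfin : (∑ i ∈ Finset.range q, (D.F^[i] b - D.F^[i] a) ^ s) ^ (1 / s) ≤ ε ^ (1 / s) := by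
    refine hJ.trans ?_
    calc (q : ℝ) ^ (1 / s - 1) * ∑ i ∈ Finset.range q, (D.F^[i] b - D.F^[i] a)
        ≤ (q : ℝ) ^ (1 / s - 1) * (E * (q : ℝ) ^ (-((1 - s) / s))) := by gcongr
      _ = E * (q : ℝ) ^ ((1 / s - 1) + -((1 - s) / s)) := by rw [Real.rpow_add hqR]; ring
      _ = E := by
        rw [show (1 / s - 1) + -((1 - s) / s) = 0 by field_simp; ring, Real.rpow_zero, mul_one]
  exact (Real.rpow_le_rpow_iff (Finset.sum_nonneg fun i _ => Real.rpow_nonneg (hS i) _) hε.le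
    (by positivity)).1 hfin

end CData

lemma norm_projC (x : ℝ) : ‖projC x‖ = |x - round x| := UnitAddCircle.norm_eq

lemma projC_sub (x y : ℝ) : projC x - projC y = projC (x - y) := rfl

lemma projC_add (x y : ℝ) : projC x + projC y = projC (x + y) := rfl

lemma projC_add_int (x : ℝ) (k : ℤ) : projC (x + k) = projC x := by
  have : projC (k : ℝ) = 0 := by
    have := AddCircle.coe_eq_zero_iff (p := (1 : ℝ)) (x := (k : ℝ))
    exact this.2 ⟨k, by simp⟩
  rw [← projC_add, this, add_zero]

lemma projC_surjective : Function.Surjective projC := QuotientAddGroup.mk_surjective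

lemma projC_continuous : Continuous projC := AddCircle.continuous_mk' (1 : ℝ)

lemma projC_lipschitz : LipschitzWith 1 projC := by
  refine LipschitzWith.of_dist_le_mul fun x y => ?_
  rw [dist_eq_norm, projC_sub, norm_projC, NNReal.coe_one, one_mul, Real.dist_eq]
  simpa using round_le (x - y) 0

/-- The self-map of the circle induced by a degree one map of the line. -/
lemma exists_circle_map {g : ℝ → ℝ} (hc : Continuous g) (h1 : ∀ x, g (x + 1) = g x + 1) :
    ∃ G : Circle1 → Circle1, Continuous G ∧ ∀ x, G (projC x) = projC (g x) := by
  have hp : Function.Periodic (fun x => projC (g x)) (1 : ℝ) := fun x => by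
    have := projC_add_int (g x) 1
    simp only [h1]
    simpa using this
  refine ⟨hp.lift, ?_, fun x => hp.lift_coe x⟩
  have hq : Topology.IsQuotientMap projC := QuotientAddGroup.isQuotientMap_mk _
  rw [hq.continuous_iff]
  exact projC_continuous.comp hc

lemma ediam_projC_image_Icc (a b : ℝ) :
    Metric.ediam (projC '' Icc a b) ≤ ENNReal.ofReal (b - a) := by
  have := projC_lipschitz.ediam_image_le (Icc a b)
  simpa [Real.ediam_Icc] using this

lemma sum_volume_le_of_separated {q : ℕ} {ℓ β m : ℝ} (hq : 0 < q) 
    (hℓ : ℓ ≤ 1 / (4 * q))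
    (hsep : ∀ i : ℕ, 0 < i → i < q → ∀ k : ℤ, 1 / (2 * (q : ℝ)) ≤ |i * β - k|) :
    volume (⋃ i ∈ Finset.range q, Metric.closedBall (projC (m + i * β)) (ℓ / 2)) =
      q * ENNReal.ofReal ℓ := by
  have hqR : (0 : ℝ) < q := by exact_mod_cast hq
  have hq1 : (1 : ℝ) ≤ q := by exact_mod_cast hq
  have hlt : ℓ < 1 / (2 * q) := hℓ.trans_lt (by
    apply one_div_lt_one_div_of_lt <;> linarith)
  have hℓ1 : ℓ ≤ 1 := hℓ.trans (by rw [div_le_one (by linarith)]; linarith)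
  have hdis : ∀ i j : ℕ, i < j → j < q →
      Disjoint (Metric.closedBall (projC (m + i * β)) (ℓ / 2))
        (Metric.closedBall (projC (m + j * β)) (ℓ / 2)) := by
    intro i j hij hj
    apply Metric.closedBall_disjoint_closedBall
    rw [dist_comm, dist_eq_norm, projC_sub, norm_projC]
    have := hsep (j - i) (by omega) (by omega) (round (m + j * β - (m + i * β)))
    rw [Nat.cast_sub hij.le] at this
    rw [show m + j * β - (m + i * β) = ((j : ℝ) - i) * β by ring] at this ⊢
    linarith
  rw [measure_biUnion_finset]
  · have : ∀ i : ℕ, volume (Metric.closedBall (projC (m + i * β)) (ℓ / 2)) =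
        ENNReal.ofReal ℓ := fun i => by
      rw [AddCircle.volume_closedBall, mul_div_cancel₀ _ (two_ne_zero), min_eq_right hℓ1]
    simp [this]
  · intro i hi j hj hij
    simp only [Finset.coe_range, mem_Iio] at hi hj
    rcases lt_or_gt_of_ne hij with h | h
    · exact hdis i j h hj
    · exact (hdis j i h hi).symm
  · exact fun i _ => Metric.isClosed_closedBall.measurableSet

section Invariant

variable {H : CircleHomeo} {D : CData} {μ : Measure Circle1}

/-- The invariant measure is the image of Lebesgue measure under the conjugacy. -/
lemma exists_conjugacy (hF : D.F = H.lift) (hs : StrictMono D.h)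
    (huniq : ∀ ν : Measure Circle1, IsInvProbMeasure H ν → ν = μ) :
    ∃ G : Circle1 → Circle1, Continuous G ∧ (∀ x, G (projC x) = projC (D.g x)) ∧
      μ = volume.map G := by
  obtain ⟨G, hG, hGp⟩ := exists_circle_map (CData.g_cont hs) (CData.g_add_one hs)
  refine ⟨G, hG, hGp, (huniq _ ⟨?_, ?_⟩).symm⟩
  · have : IsProbabilityMeasure (volume : Measure Circle1) := ⟨by
      rw [AddCircle.measure_univ]; simp⟩
    exact Measure.isProbabilityMeasure_map hG.aemeasurable
  · have hH : Measurable H.toFun := H.toHomeo.continuous.measurable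
    rw [Measure.map_map hH hG.measurable]
    have e : H.toFun ∘ G = G ∘ fun z => z + projC D.β := by
      funext z
      obtain ⟨t, rfl⟩ := projC_surjective z
      simp only [Function.comp_apply, projC_add, hGp]
      have := CData.iter_g hs 1 t
      simp only [Function.iterate_one, Nat.cast_one, one_mul] at this
      rw [← this, hF]
      exact H.lift_proj _
    rw [e, ← Measure.map_map hG.measurable (measurable_add_const _),
      (measurePreserving_add_right volume (projC D.β)).map_eq]

lemma measure_arcs_ge (hF : D.F = H.lift) (hs : StrictMono D.h)
    (huniq : ∀ ν : Measure Circle1, IsInvProbMeasure H ν → ν = μ)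
    {c a b : ℝ} {q : ℕ} (hq : 0 < q)
    (h1 : c / q ≤ D.h b - D.h a) (h2 : D.h b - D.h a ≤ 1 / (4 * q))
    (hsep : ∀ i : ℕ, 0 < i → i < q → ∀ k : ℤ, 1 / (2 * (q : ℝ)) ≤ |i * D.β - k|) :
    ENNReal.ofReal c ≤ μ (⋃ i ∈ Finset.range q, projC '' Icc (D.F^[i] a) (D.F^[i] b)) := by
  obtain ⟨G, hG, hGp, hμ⟩ := exists_conjugacy hF hs huniq
  have hqR : (0 : ℝ) < q := by exact_mod_cast hq
  have hmeas : MeasurableSet (⋃ i ∈ Finset.range q, projC '' Icc (D.F^[i] a) (D.F^[i] b)) :=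
    Finset.measurableSet_biUnion _ fun i _ =>
      (isCompact_Icc.image projC_continuous).isClosed.measurableSet
  rw [hμ, Measure.map_apply hG.measurable hmeas]
  set ℓ := D.h b - D.h a with hℓ
  have hvol := sum_volume_le_of_separated (m := (D.h a + D.h b) / 2) hq h2 hsep
  calc ENNReal.ofReal c ≤ q * ENNReal.ofReal ℓ := by
        rw [← ENNReal.ofReal_natCast, ← ENNReal.ofReal_mul hqR.le]
        apply ENNReal.ofReal_le_ofReal
        rw [div_le_iff₀ hqR] at h1
        linarith
    _ = _ := hvol.symm
    _ ≤ _ := measure_mono ?_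
  intro z hz
  simp only [mem_iUnion, exists_prop] at hz
  obtain ⟨i, hi, hz⟩ := hz
  obtain ⟨t, rfl⟩ := projC_surjective z
  simp only [mem_preimage, mem_iUnion, exists_prop]
  refine ⟨i, hi, ?_⟩
  rw [Metric.mem_closedBall, dist_eq_norm, projC_sub, norm_projC, abs_le] at hz
  set k := round (t - ((D.h a + D.h b) / 2 + i * D.β))
  have e : projC t = projC (t + (-k : ℤ)) := (projC_add_int t (-k)).symm
  rw [e, hGp]
  have gm := CData.g_mono hs
  refine ⟨_, ⟨?_, ?_⟩, rfl⟩
  · rw [← CData.g_h hs a, CData.iter_g hs]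
    apply gm.monotone
    push_cast
    linarith [hz.1]
  · rw [← CData.g_h hs b, CData.iter_g hs]
    apply gm.monotone
    push_cast
    linarith [hz.2]

end Invariant

/-- If a definite proportion of the measure is carried by finite families of sets of arbitrarily
small `s`-content, then a set of positive measure has dimension at most `s`. -/
lemma exists_dimH_le_of_small_content {X : Type*} [MetricSpace X] [MeasurableSpace X] [BorelSpace X]
    {μ : Measure X} [IsFiniteMeasure μ] {s : ℝ≥0} (hs : 0 < s) {c : ℝ≥0∞}
    (h : ∀ ε : ℝ≥0∞, 0 < ε → ∃ (q : ℕ) (A : Fin q → Set X), (∀ i, MeasurableSet (A i)) ∧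
      c ≤ μ (⋃ i, A i) ∧ ∑ i, Metric.ediam (A i) ^ (s : ℝ) ≤ ε) :
    ∃ Y, MeasurableSet Y ∧ c ≤ μ Y ∧ dimH Y ≤ s := by
  have hpos : ∀ n : ℕ, (0 : ℝ≥0∞) < 2⁻¹ ^ n := fun n => ENNReal.pow_pos (by simp) n
  choose q A hA hc hsum using fun n : ℕ => h (2⁻¹ ^ n) (hpos n)
  have hsR : (0 : ℝ) < s := hs
  set E : ℕ → Set X := fun n => ⋃ k, ⋃ i, A (n + k) i with hE
  have hEm : ∀ n, MeasurableSet (E n) := fun n =>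
    MeasurableSet.iUnion fun k => MeasurableSet.iUnion fun i => hA _ i
  have hanti : Antitone E := by
    apply antitone_nat_of_succ_le
    intro n z hz
    simp only [hE, mem_iUnion] at hz ⊢
    obtain ⟨k, i, hz⟩ := hz
    have e : n + 1 + k = n + (k + 1) := by ring
    exact ⟨k + 1, by rw [← e]; exact ⟨i, hz⟩⟩
  refine ⟨⋂ n, E n, MeasurableSet.iInter hEm, ?_, ?_⟩
  · rw [hanti.measure_iInter (fun n => (hEm n).nullMeasurableSet) ⟨0, measure_ne_top _ _⟩]
    refine le_iInf fun n => (hc n).trans (measure_mono ?_)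
    exact subset_iUnion (fun k => ⋃ i, A (n + k) i) 0
  · apply dimH_le_of_hausdorffMeasure_ne_top
    have key := Measure.hausdorffMeasure_le_liminf_tsum (s : ℝ) (⋂ n, E n) (l := atTop)
      (ι := fun m : ℕ => Σ k : ℕ, Fin (q (m + k)))
      (fun m : ℕ => ((2⁻¹ : ℝ≥0∞) ^ m) ^ (1 / (s : ℝ))) ?_ (fun m p => A (m + p.1) p.2) ?_ ?_
    · refine ne_top_of_le_ne_top (b := 2) (by simp) (key.trans ?_)
      refine (liminf_le_liminf (v := fun _ => (2 : ℝ≥0∞)) ?_).trans (by simp)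
      refine Eventually.of_forall fun m => ?_
      rw [ENNReal.tsum_sigma']
      calc ∑' k, ∑' i : Fin (q (m + k)), Metric.ediam (A (m + k) i) ^ (s : ℝ)
          ≤ ∑' k : ℕ, (2⁻¹ : ℝ≥0∞) ^ k := by
            refine ENNReal.tsum_le_tsum fun k => ?_
            rw [tsum_fintype]
            refine (hsum (m + k)).trans ?_
            exact pow_le_pow_of_le_one (by simp) (by simp) (by omega)
        _ = 2 := by rw [ENNReal.tsum_geometric]; simp
    · have h0 : Tendsto (fun m : ℕ => (2⁻¹ : ℝ≥0∞) ^ m) atTop (nhds 0) :=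
        ENNReal.tendsto_pow_atTop_nhds_zero_of_lt_one (by simp)
      have := (ENNReal.continuous_rpow_const (y := 1 / (s : ℝ))).tendsto 0 |>.comp h0
      rwa [ENNReal.zero_rpow_of_pos (by positivity)] at this
    · refine Eventually.of_forall fun m p => ?_
      rw [one_div, ENNReal.le_rpow_inv_iff hsR]
      refine le_trans ?_ ((hsum (m + p.1)).trans
        (pow_le_pow_of_le_one (by simp) (by simp) (by omega)))
      exact Finset.single_le_sum (f := fun i => Metric.ediam (A (m + p.1) i) ^ (s : ℝ))
        (fun _ _ => zero_le) (Finset.mem_univ p.2)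
    · refine Eventually.of_forall fun m => (iInter_subset E m).trans ?_
      intro z hz
      simp only [hE, mem_iUnion] at hz ⊢
      obtain ⟨k, i, hz⟩ := hz
      exact ⟨⟨k, i⟩, hz⟩

/-- A forward saturated set of positive measure has full measure for a uniquely ergodic map. -/
lemma dimHMeasure_le_of_pos {H : CircleHomeo} {μ : Measure Circle1} (hμ : IsInvProbMeasure H μ)
    (huniq : ∀ ν : Measure Circle1, IsInvProbMeasure H ν → ν = μ) {K : ℝ≥0}
    (hL : LipschitzWith K H.toFun) {Y : Set Circle1} (hY : MeasurableSet Y) (hpos : μ Y ≠ 0) :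
    dimHMeasure μ ≤ dimH Y := by
  obtain ⟨hprob, hinv⟩ := hμ
  have hfm : Measurable H.toFun := H.toHomeo.continuous.measurable
  set Z : Set Circle1 := ⋃ n : ℕ, H.toFun^[n] '' Y with hZ
  have himg : ∀ n, MeasurableSet (H.toFun^[n] '' Y) := by
    intro n
    induction n with
    | zero => simpa using hY
    | succ n ih =>
      rw [Function.iterate_succ', image_comp]
      exact H.toHomeo.toMeasurableEquiv.measurableSet_image.2 ih
  have hZm : MeasurableSet Z := MeasurableSet.iUnion himg
  have hYZ : Y ⊆ Z := fun y hy => mem_iUnion.2 ⟨0, y, hy, rfl⟩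
  have hZ0 : μ Z ≠ 0 := fun h => hpos (measure_mono_null hYZ h)
  have hsub : Z ⊆ H.toFun ⁻¹' Z := by
    intro z hz
    obtain ⟨n, y, hy, rfl⟩ := mem_iUnion.1 hz
    exact mem_iUnion.2 ⟨n + 1, y, hy, Function.iterate_succ_apply' _ _ _⟩
  have hpre : ∀ B, MeasurableSet B → μ (H.toFun ⁻¹' B) = μ B := fun B hB => by
    conv_rhs => rw [← hinv]
    rw [Measure.map_apply hfm hB]
  have hae : Z =ᵐ[μ] (H.toFun ⁻¹' Z : Set Circle1) :=
    ae_eq_of_subset_of_measure_ge hsub (hpre Z hZm).le hZm.nullMeasurableSet (measure_ne_top _ _)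
  have hν : ProbabilityTheory.cond μ Z = μ := by
    refine huniq _ ⟨ProbabilityTheory.cond_isProbabilityMeasure hZ0, ?_⟩
    ext B hB
    rw [Measure.map_apply hfm hB, ProbabilityTheory.cond_apply hZm,
      ProbabilityTheory.cond_apply hZm, ← hpre (Z ∩ B) (hZm.inter hB), preimage_inter]
    congr 1
    exact measure_congr (hae.inter (ae_eq_refl _))
  have hZ1 : μ Z = 1 := by
    rw [← hν, ProbabilityTheory.cond_apply hZm, inter_self,
      ENNReal.inv_mul_cancel hZ0 (measure_ne_top _ _)]
  unfold dimHMeasure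
  refine iInf_le_of_le Z (iInf_le_of_le hZm (iInf_le_of_le hZ1 ?_))
  rw [hZ, dimH_iUnion]
  exact iSup_le fun n => (hL.iterate n).dimH_image_le Y

/-- A circle homeomorphism with a differentiable lift of bounded derivative is Lipschitz. -/
lemma CircleHomeo.lipschitzWith {H : CircleHomeo} {K : ℝ≥0} (hK : LipschitzWith K H.lift) :
    LipschitzWith K H.toFun := by
  refine LipschitzWith.of_dist_le_mul fun z w => ?_
  obtain ⟨x, rfl⟩ := projC_surjective z
  obtain ⟨y, rfl⟩ := projC_surjective w
  rw [dist_eq_norm (projC x), projC_sub, norm_projC]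
  have e : projC y = projC (y + round (x - y)) := (projC_add_int y _).symm
  have h1 : ∀ t, H.toFun (projC t) = projC (H.lift t) := H.lift_proj
  rw [e, h1, h1]
  refine (projC_lipschitz.dist_le_mul _ _).trans ?_
  rw [NNReal.coe_one, one_mul]
  refine (hK.dist_le_mul _ _).trans_eq ?_
  rw [Real.dist_eq, sub_add_eq_sub_sub]

/-- Poincaré: a circle homeomorphism with irrational rotation number is semiconjugate to a
rotation. -/
lemma CircleHomeo.exists_semiconj (H : CircleHomeo) {β : ℝ} (hβ : Irrational β)
    (ht : Tendsto (fun n : ℕ => H.lift^[n] 0 / n) atTop (nhds β)) :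
    ∃ h : ℝ → ℝ, Monotone h ∧ Continuous h ∧ (∀ x, h (x + 1) = h x + 1) ∧
      ∀ x, h (H.lift x) = h x + β := by
  let f : CircleDeg1Lift := ⟨⟨H.lift, H.lift_strictMono.monotone⟩, H.lift_add_one⟩
  have hf : (f : ℝ → ℝ) = H.lift := rfl
  have hsurj : Function.Surjective H.lift := by
    rw [← hf]
    exact f.continuous_iff_surjective.1 (by rw [hf]; exact H.lift_continuous)
  let R : CircleDeg1Lift := CircleDeg1Lift.translate (Multiplicative.ofAdd β)
  have hR : ∀ x, R x = β + x := CircleDeg1Lift.translate_apply β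
  obtain ⟨h, hh⟩ := CircleDeg1Lift.semiconj_of_bijective_of_translationNumber_eq (f₁ := f)
    (f₂ := R) ⟨H.lift_strictMono.injective, hsurj⟩
    ⟨fun x y hxy => by simpa [hR] using hxy, fun y => ⟨y - β, by rw [hR]; ring⟩⟩
    (by rw [f.translationNumber_eq_of_tendsto₀ ht]
        exact (CircleDeg1Lift.translationNumber_translate β).symm)
  have hF : ∀ x, h (H.lift x) = h x + β := fun x => by
    have := hh x
    rw [hR] at this
    rw [add_comm]; exact this
  have hcl : ∀ g ∈ AddSubgroup.closure {β, (1 : ℝ)},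
      (∀ x, ∃ y, h y = h x + g) ∧ ∀ x, ∃ y, h y = h x - g := by
    intro g hg
    induction hg using AddSubgroup.closure_induction with
    | mem g hg =>
      rcases hg with rfl | rfl
      · refine ⟨fun x => ⟨_, hF x⟩, fun x => ?_⟩
        obtain ⟨y, rfl⟩ := hsurj x
        exact ⟨y, by rw [hF]; ring⟩
      · refine ⟨fun x => ⟨_, h.map_add_one x⟩, fun x => ⟨x - 1, ?_⟩⟩
        have := h.map_add_one (x - 1)
        rw [sub_add_cancel] at this
        linarith
    | zero => exact ⟨fun x => ⟨x, by ring⟩, fun x => ⟨x, by ring⟩⟩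
    | add a b _ _ ha hb =>
      constructor
      · intro x
        obtain ⟨y, hy⟩ := ha.1 x
        obtain ⟨z, hz⟩ := hb.1 y
        exact ⟨z, by rw [hz, hy]; ring⟩
      · intro x
        obtain ⟨y, hy⟩ := ha.2 x
        obtain ⟨z, hz⟩ := hb.2 y
        exact ⟨z, by rw [hz, hy]; ring⟩
    | neg a _ ha =>
      exact ⟨fun x => by simpa [sub_eq_add_neg] using ha.2 x, fun x => by simpa using ha.1 x⟩
  refine ⟨h, h.monotone, ?_, h.map_add_one, hF⟩
  apply h.monotone.continuous_of_denseRange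
  have hd : Dense (AddSubgroup.closure {β, (1 : ℝ)} : Set ℝ) :=
    dense_addSubgroupClosure_pair_iff.2 (by simpa using hβ)
  have hd' := (Homeomorph.addLeft (h 0)).surjective.denseRange.dense_image
    (Homeomorph.addLeft (h 0)).continuous hd
  refine hd'.mono ?_
  rintro _ ⟨g, hg, rfl⟩
  obtain ⟨y, hy⟩ := (hcl g hg).1 0
  exact ⟨y, hy⟩

lemma MulticriticalCircleMap.exists_lipschitzWith (f : MulticriticalCircleMap) :
    ∃ K, LipschitzWith K f.lift := by
  obtain ⟨B, hB, h⟩ := exists_bound_of_periodic (f.smooth.continuous_deriv (by norm_num))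
    (fun x => deriv_add_one f.lift_add_one x)
  refine ⟨⟨B, hB.le⟩, lipschitzWith_of_nnnorm_deriv_le (𝕜 := ℝ)
    (f.smooth.differentiable (by norm_num)) fun x => ?_⟩
  exact h x

lemma dimHMeasure_le_of_smallArcs {H : CircleHomeo} {D : CData} {μ : Measure Circle1}
    (hμ : IsInvProbMeasure H μ)
    (huniq : ∀ ν : Measure Circle1, IsInvProbMeasure H ν → ν = μ) {K : ℝ≥0}
    (hL : LipschitzWith K H.toFun) (hF : D.F = H.lift) (hs : StrictMono D.h) {t : ℝ}
    (ht0 : 0 ≤ t) (ht1 : t < 1) (hA : D.SmallArcs t) :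
    dimHMeasure μ ≤ ENNReal.ofReal t := by
  have := hμ.1
  obtain ⟨c, hc, hA⟩ := hA
  have key : ∀ s ∈ Ioo t 1, dimHMeasure μ ≤ ENNReal.ofReal s := by
    intro s hst
    have hs0 : 0 < s := ht0.trans_lt hst.1
    have hcont : ∀ ε : ℝ≥0∞, 0 < ε → ∃ (q : ℕ) (A : Fin q → Set Circle1),
        (∀ i, MeasurableSet (A i)) ∧ ENNReal.ofReal c ≤ μ (⋃ i, A i) ∧
          ∑ i, Metric.ediam (A i) ^ (s.toNNReal : ℝ) ≤ ε := by
      intro ε hε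
      obtain ⟨e, he0, heε⟩ := ENNReal.lt_iff_exists_nnreal_btwn.1 hε
      obtain ⟨q, hq, a, b, hab, h1, h2, h3, h4⟩ := hA s hst.1 hst.2 e (by exact_mod_cast he0)
      refine ⟨q, fun i => projC '' Icc (D.F^[i] a) (D.F^[i] b), fun i =>
        (isCompact_Icc.image projC_continuous).isClosed.measurableSet, ?_, ?_⟩
      · refine (measure_arcs_ge hF hs huniq hq h1 h2 h3).trans (measure_mono ?_)
        intro z hz
        simp only [mem_iUnion, Finset.mem_range, exists_prop] at hz ⊢
        obtain ⟨i, hi, hz⟩ := hz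
        exact ⟨⟨i, hi⟩, hz⟩
      · rw [Real.coe_toNNReal s hs0.le, Fin.sum_univ_eq_sum_range
          (fun i => Metric.ediam (projC '' Icc (D.F^[i] a) (D.F^[i] b)) ^ s) q]
        have hpos : ∀ i, 0 ≤ D.F^[i] b - D.F^[i] a := fun i =>
          sub_nonneg.2 ((D.iter_mono i).monotone hab)
        calc ∑ i ∈ Finset.range q, Metric.ediam (projC '' Icc (D.F^[i] a) (D.F^[i] b)) ^ s
            ≤ ∑ i ∈ Finset.range q, ENNReal.ofReal ((D.F^[i] b - D.F^[i] a) ^ s) := by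
              refine Finset.sum_le_sum fun i _ => ?_
              rw [← ENNReal.ofReal_rpow_of_nonneg (hpos i) hs0.le]
              exact ENNReal.rpow_le_rpow (ediam_projC_image_Icc _ _) hs0.le
          _ = ENNReal.ofReal (∑ i ∈ Finset.range q, (D.F^[i] b - D.F^[i] a) ^ s) :=
              (ENNReal.ofReal_sum_of_nonneg fun i _ => Real.rpow_nonneg (hpos i) _).symm
          _ ≤ ENNReal.ofReal e := ENNReal.ofReal_le_ofReal h4
          _ = e := ENNReal.ofReal_coe_nnreal
          _ ≤ ε := heε.le
    obtain ⟨Y, hY, hYc, hYd⟩ :=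
      exists_dimH_le_of_small_content (Real.toNNReal_pos.2 hs0) hcont
    refine (dimHMeasure_le_of_pos hμ huniq hL hY fun h0 => ?_).trans hYd
    rw [h0] at hYc
    exact absurd hYc (by simpa using hc)
  have hlim : Tendsto ENNReal.ofReal (nhdsWithin t (Ioi t)) (nhds (ENNReal.ofReal t)) :=
    (ENNReal.continuous_ofReal.tendsto t).mono_left nhdsWithin_le_nhds
  exact ge_of_tendsto hlim (mem_of_superset (Ioo_mem_nhdsGT ht1) key)

/-- If `f` is a `C³` multicritical circle map with irrational rotation number not in
`D_τ` for some `τ > 0`, then the unique invariant measure satisfies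
`dim_H(μ) ≤ 1/(τ+1)`. -/
theorem stmt1 (f : MulticriticalCircleMap) (α : ℝ) (hirr : Irrational α)
    (hrot : HasRotationNumber f.toCircleHomeo α) (μ : Measure Circle1)
    (hμ : IsInvProbMeasure f.toCircleHomeo μ)
    (huniq : ∀ ν : Measure Circle1, IsInvProbMeasure f.toCircleHomeo ν → ν = μ)
    (τ : ℝ) (hτ : 0 < τ) (hD : α ∉ DiophTau τ) :
    dimHMeasure μ ≤ ENNReal.ofReal (1 / (τ + 1)) := by
  obtain ⟨-, β, hβ, ht⟩ := hrot
  have hβirr : Irrational β := by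
    rw [← hβ, Int.fract] at hirr
    simpa using hirr.add_intCast ⌊β⌋
  obtain ⟨h, hm, hc, h1, hF⟩ := f.exists_semiconj hβirr (ht 0)
  let D : CData := f.toCData hβirr hm hc h1 hF
  obtain ⟨K, hK⟩ := f.exists_lipschitzWith
  have happ : D.Liouvillean τ ∨ D.reflect.Liouvillean τ :=
    CData.liouvillean_or_reflect (exists_coprime_approx hβ hτ hD)
  have ht1 : 1 / (τ + 1) < 1 := by rw [div_lt_one (by linarith)]; linarith
  rcases happ with hl | hl
  · exact dimHMeasure_le_of_smallArcs hμ huniq (CircleHomeo.lipschitzWith hK) (D := D) rfl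
      (D.h_strictMono (hl.posApprox hτ)) (by positivity) ht1 (hl.smallArcs hτ)
  · exact dimHMeasure_le_of_smallArcs hμ huniq (CircleHomeo.lipschitzWith hK) (D := D) rfl
      (D.strictMono_of_reflect (D.reflect.h_strictMono (hl.posApprox hτ))) (by positivity) ht1
      (hl.smallArcs hτ).of_reflect
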